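/- Let x: U → ℝ³ be a smooth immersed surface with unit normal N and let f(p,t) = (x(p), t·N(p)) be the normal bundle immersion into ℂ³. Then f is Hamiltonian stationary if and only if x is minimal (the trace of its shape operator vanishes identically), or x(U) is contained in a round sphere, or x(U) is contained in a circular cone with vertex angle π/2 (the image under a rigid motion of ℝ³ of C_1 = {(s·cos θ, s·sin θ, s)/√2 : s > 0, θ ∈ ℝ}). -/

import Mathlib

noncomputable section

open scoped InnerProductSpace

/-- Euclidean 3-space. -/
abbrev E3 : Type := EuclideanSpace ℝ (Fin 3)

/-- ℝ⁶ = ℝ³ × ℝ³, identified with ℂ³. -/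
abbrev V6 : Type := E3 × E3

/-- The domain of the normal bundle immersion: ℝ² × ℝ. -/
abbrev W3 : Type := (ℝ × ℝ) × ℝ

/-- The standard inner product on ℝ⁶ = ℝ³ × ℝ³. -/
def ip6 (v w : V6) : ℝ := ⟪v.1, w.1⟫_ℝ + ⟪v.2, w.2⟫_ℝ

/-- The complex structure J(X, Y) = (−Y, X) on ℝ³ × ℝ³ = ℂ³. -/
def Jc (v : V6) : V6 := (-v.2, v.1)

/-- The normal bundle immersion f(p, t) = (x(p), t·N(p)). -/
def nbi (x N : ℝ × ℝ → E3) : W3 → V6 := fun q => (x q.1, q.2 • N q.1)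

/-- Second derivative of `g` at `q` in directions `v`, `w`. -/
def d2 (g : W3 → V6) (q v w : W3) : V6 := fderiv ℝ (fun y => fderiv ℝ g y w) q v

/-- `n` is orthogonal to the tangent space (range of the differential) of `g` at `q`. -/
def IsNormalAt (g : W3 → V6) (q : W3) (n : V6) : Prop :=
  ∀ v : W3, ip6 n (fderiv ℝ g q v) = 0

/-- `n` is the second fundamental form `h(v, w)` of `g` at `q`: the orthogonal projection of
the second derivative in directions `v`, `w` onto the orthogonal complement of the tangent
space. -/
def IsSFF (g : W3 → V6) (q v w : W3) (n : V6) : Prop :=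
  IsNormalAt g q n ∧ d2 g q v w - n ∈ Set.range ⇑(fderiv ℝ g q)

/-- `v₁, v₂, v₃` is an orthonormal frame at `q` for the metric induced by `g`. -/
def ONFrame (g : W3 → V6) (q : W3) (v₁ v₂ v₃ : W3) : Prop :=
  ip6 (fderiv ℝ g q v₁) (fderiv ℝ g q v₁) = 1 ∧
  ip6 (fderiv ℝ g q v₂) (fderiv ℝ g q v₂) = 1 ∧
  ip6 (fderiv ℝ g q v₃) (fderiv ℝ g q v₃) = 1 ∧
  ip6 (fderiv ℝ g q v₁) (fderiv ℝ g q v₂) = 0 ∧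
  ip6 (fderiv ℝ g q v₁) (fderiv ℝ g q v₃) = 0 ∧
  ip6 (fderiv ℝ g q v₂) (fderiv ℝ g q v₃) = 0

/-- `Hq` is the mean curvature vector of `g` at `q`:
`H = Σᵢ h(ẽᵢ, ẽᵢ)` for an orthonormal frame `ẽ₁, ẽ₂, ẽ₃` of the induced metric. -/
def IsMeanCurvAt (g : W3 → V6) (q : W3) (Hq : V6) : Prop :=
  ∃ v₁ v₂ v₃ : W3, ONFrame g q v₁ v₂ v₃ ∧
    ∃ n₁ n₂ n₃ : V6, IsSFF g q v₁ v₁ n₁ ∧ IsSFF g q v₂ v₂ n₂ ∧ IsSFF g q v₃ v₃ n₃ ∧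
      Hq = n₁ + n₂ + n₃

/-- `u = A_ξ v`, the shape operator of `g` at `q` with respect to the normal vector `ξ`,
characterized by `⟨dg(A_ξ v), dg(w)⟩ = ⟨h(v, w), ξ⟩` for all `w`. -/
def IsShapeAt (g : W3 → V6) (q : W3) (ξ : V6) (v u : W3) : Prop :=
  ∀ w : W3, ∀ n : V6, IsSFF g q v w n →
    ip6 (fderiv ℝ g q u) (fderiv ℝ g q w) = ip6 n ξ

/-- `g` is a Lagrangian immersion at `q`: the differential is injective and `J` maps the
tangent space onto its orthogonal complement. -/
def LagrangianAt (g : W3 → V6) (q : W3) : Prop :=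
  Function.Injective ⇑(fderiv ℝ g q) ∧
    Jc '' Set.range ⇑(fderiv ℝ g q) =
      {u : V6 | ∀ w ∈ Set.range ⇑(fderiv ℝ g q), ip6 u w = 0}

/-- The Maslovian condition at `q` for the mean curvature vector `Hq`: `Hq ≠ 0` and
`A_H(JH)` is a real scalar multiple of `JH` (expressed via the tangent vector `V`
with `dg(V) = J Hq`). -/
def MaslovianAt (g : W3 → V6) (q : W3) (Hq : V6) : Prop :=
  Hq ≠ 0 ∧ ∀ V u : W3, fderiv ℝ g q V = Jc Hq → IsShapeAt g q Hq V u → ∃ c : ℝ, u = c • V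

/-- Standard hypotheses: `U` is a connected open set, `x` is a smooth immersion on `U`, and
`N` is a smooth unit normal field along `x` on `U`. -/
structure SurfaceData (U : Set (ℝ × ℝ)) (x N : ℝ × ℝ → E3) : Prop where
  open_U : IsOpen U
  conn_U : IsConnected U
  smooth_x : ContDiffOn ℝ (⊤ : ℕ∞) x U
  smooth_N : ContDiffOn ℝ (⊤ : ℕ∞) N U
  immersion : ∀ p ∈ U, Function.Injective ⇑(fderiv ℝ x p)
  unit_N : ∀ p ∈ U, ‖N p‖ = 1
  normal_N : ∀ p ∈ U, ∀ v : ℝ × ℝ, ⟪N p, fderiv ℝ x p v⟫_ℝ = 0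

/-- `x` is minimal at `p`: the trace of the shape operator `A = −dN ∘ dx⁻¹` vanishes,
expressed via orthonormal frames of the induced metric. -/
def SurfMinimalAt (x N : ℝ × ℝ → E3) (p : ℝ × ℝ) : Prop :=
  ∀ v₁ v₂ : ℝ × ℝ,
    ⟪fderiv ℝ x p v₁, fderiv ℝ x p v₁⟫_ℝ = 1 →
    ⟪fderiv ℝ x p v₂, fderiv ℝ x p v₂⟫_ℝ = 1 →
    ⟪fderiv ℝ x p v₁, fderiv ℝ x p v₂⟫_ℝ = 0 →
    ⟪fderiv ℝ N p v₁, fderiv ℝ x p v₁⟫_ℝ + ⟪fderiv ℝ N p v₂, fderiv ℝ x p v₂⟫_ℝ = 0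

/-- A rigid motion of ℝ³: `y ↦ S y + c` with `S ∈ SO(3)`. -/
def RigidMotion (Φ : E3 → E3) : Prop :=
  ∃ (S : E3 ≃ₗᵢ[ℝ] E3) (c : E3),
    LinearMap.det (S.toLinearEquiv : E3 →ₗ[ℝ] E3) = 1 ∧ ∀ y, Φ y = S y + c

/-- The circular cone `C_r = {(s·r·cos θ, s·r·sin θ, s)/√(r²+1) : s > 0, θ ∈ ℝ}`. -/
def coneSet (r : ℝ) : Set E3 :=
  { y | ∃ s θ : ℝ, 0 < s ∧
      y 0 = s * r * Real.cos θ / Real.sqrt (r ^ 2 + 1) ∧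
      y 1 = s * r * Real.sin θ / Real.sqrt (r ^ 2 + 1) ∧
      y 2 = s / Real.sqrt (r ^ 2 + 1) }

/-- `x(U)` is contained in a round sphere. -/
def InRoundSphere (U : Set (ℝ × ℝ)) (x : ℝ × ℝ → E3) : Prop :=
  ∃ (c : E3) (ρ : ℝ), 0 < ρ ∧ ∀ p ∈ U, ‖x p - c‖ = ρ

/-- `x(U)` is contained in a circular cylinder. -/
def InCircularCylinder (U : Set (ℝ × ℝ)) (x : ℝ × ℝ → E3) : Prop :=
  ∃ (c w : E3) (ρ : ℝ), ‖w‖ = 1 ∧ 0 < ρ ∧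
    ∀ p ∈ U, ‖(x p - c) - ⟪x p - c, w⟫_ℝ • w‖ = ρ

/-- `x(U)` is contained in a circular cone: the image under a rigid motion of `C_r`, `r ≠ 0`. -/
def InCircularCone (U : Set (ℝ × ℝ)) (x : ℝ × ℝ → E3) : Prop :=
  ∃ r : ℝ, r ≠ 0 ∧ ∃ Φ : E3 → E3, RigidMotion Φ ∧ ∀ p ∈ U, x p ∈ Φ '' coneSet r

open scoped ContDiff

/-- The divergence of the mean curvature field at height `t`, in terms of the principal curvatures
`a`, `b`, their first and second derivatives along a principal frame, and the geodesic
curvatures `p`, `q` of the frame. -/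
def divExpr (a b a₁ a₂ b₁ b₂ p q a₁₁ a₂₂ b₁₁ b₂₂ t : ℝ) : ℝ :=
  let A := 1 + t ^ 2 * a ^ 2
  let B := 1 + t ^ 2 * b ^ 2
  let y₁ := t * (a₁ / A + b₁ / B) / A
  let y₂ := t * (a₂ / A + b₂ / B) / B
  let y₃ := a / A + b / B
  (t * (a₁₁ / A - 2 * t ^ 2 * a * a₁ ^ 2 / A ^ 2 + b₁₁ / B - 2 * t ^ 2 * b * b₁ ^ 2 / B ^ 2)
    - y₁ * (t ^ 2 * a * a₁) - y₂ * (p * (1 + t ^ 2 * a * b)) + y₃ * (t * a ^ 2)) / A +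
  (t * (a₂₂ / A - 2 * t ^ 2 * a * a₂ ^ 2 / A ^ 2 + b₂₂ / B - 2 * t ^ 2 * b * b₂ ^ 2 / B ^ 2)
    - y₁ * (q * (1 + t ^ 2 * a * b)) - y₂ * (t ^ 2 * b * b₂) + y₃ * (t * b ^ 2)) / B +
  (-(2 * t * a ^ 3) / A ^ 2 - 2 * t * b ^ 3 / B ^ 2)

theorem divExpr_swap (a b a₁ a₂ b₁ b₂ p q a₁₁ a₂₂ b₁₁ b₂₂ t : ℝ) :
    divExpr b a b₂ b₁ a₂ a₁ q p b₂₂ b₁₁ a₂₂ a₁₁ t =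
      divExpr a b a₁ a₂ b₁ b₂ p q a₁₁ a₂₂ b₁₁ b₂₂ t := by
  unfold divExpr
  ring

theorem Polynomial.eval_eq_zero_of_pos {Q : Polynomial ℝ} (h : ∀ s : ℝ, 0 < s → Q.eval s = 0)
    (s : ℝ) : Q.eval s = 0 := by
  have : Q = 0 := by
    apply Polynomial.eq_zero_of_infinite_isRoot
    exact (Set.Ioi_infinite (0 : ℝ)).mono fun s hs => h s hs
  simp [this]

open Polynomial in
theorem divExpr_pole_three {a b a₁ a₂ b₁ b₂ p q a₁₁ a₂₂ b₁₁ b₂₂ : ℝ}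
    (h : ∀ t, divExpr a b a₁ a₂ b₁ b₂ p q a₁₁ a₂₂ b₁₁ b₂₂ t = 0)
    (ha : a ≠ 0) (hab : a ^ 2 ≠ b ^ 2) : a₁ = 0 := by
  let A : ℝ[X] := 1 + X * C (a ^ 2)
  let B : ℝ[X] := 1 + X * C (b ^ 2)
  let Q : ℝ[X] :=
    C a₁₁ * A * B ^ 3 - 2 * X * C (a * a₁ ^ 2) * B ^ 3 + C b₁₁ * A ^ 2 * B ^ 2
      - 2 * X * C (b * b₁ ^ 2) * A ^ 2 * B - X * C (a * a₁) * (C a₁ * B + C b₁ * A) * B ^ 2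
      - C p * (1 + X * C (a * b)) * (C a₂ * B + C b₂ * A) * A * B
      + C (a ^ 2) * (C a * B + C b * A) * A * B ^ 2
    + (C a₂₂ * A ^ 2 * B ^ 2 - 2 * X * C (a * a₂ ^ 2) * A * B ^ 2 + C b₂₂ * A ^ 3 * B
      - 2 * X * C (b * b₂ ^ 2) * A ^ 3 - X * C (b * b₂) * (C a₂ * B + C b₂ * A) * A ^ 2
      - C q * (1 + X * C (a * b)) * (C a₁ * B + C b₁ * A) * A * B
      + C (b ^ 2) * (C a * B + C b * A) * A ^ 2 * B)
    - 2 * C (a ^ 3) * A * B ^ 3 - 2 * C (b ^ 3) * A ^ 3 * B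
  have hQ : ∀ s : ℝ, 0 < s → Q.eval s = 0 := by
    intro s hs
    obtain ⟨t, ht, rfl⟩ : ∃ t : ℝ, 0 < t ∧ t ^ 2 = s :=
      ⟨√s, Real.sqrt_pos.mpr hs, Real.sq_sqrt hs.le⟩
    have hA : (1 + t ^ 2 * a ^ 2) ≠ 0 := by positivity
    have hB : (1 + t ^ 2 * b ^ 2) ≠ 0 := by positivity
    have key : t * Q.eval (t ^ 2) = divExpr a b a₁ a₂ b₁ b₂ p q a₁₁ a₂₂ b₁₁ b₂₂ t *
        ((1 + t ^ 2 * a ^ 2) ^ 3 * (1 + t ^ 2 * b ^ 2) ^ 3) := by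
      simp only [Q, A, B, eval_add, eval_sub, eval_mul, eval_pow, eval_X, eval_C, eval_one,
        eval_ofNat, divExpr]
      generalize hA' : (1 + t ^ 2 * a ^ 2) = A' at *
      generalize hB' : (1 + t ^ 2 * b ^ 2) = B' at *
      field_simp
      ring
    rw [h t, zero_mul] at key
    exact (mul_eq_zero.mp key).resolve_left ht.ne'
  have := eval_eq_zero_of_pos hQ (-1 / a ^ 2)
  have hA0 : A.eval (-1 / a ^ 2) = 0 := by
    simp only [A, eval_add, eval_mul, eval_X, eval_C, eval_one]
    field_simp
    ring
  have hB1 : B.eval (-1 / a ^ 2) = (a ^ 2 - b ^ 2) / a ^ 2 := by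
    simp only [B, eval_add, eval_mul, eval_X, eval_C, eval_one]
    field_simp
    ring
  have hB0 : B.eval (-1 / a ^ 2) ≠ 0 := by
    rw [hB1]
    exact div_ne_zero (sub_ne_zero.mpr hab) (by positivity)
  simp only [Q, eval_add, eval_sub, eval_mul, eval_pow, hA0] at this
  generalize B.eval (-1 / a ^ 2) = B' at *
  simp only [eval_X, eval_C, eval_ofNat] at this
  have h2 : B' ^ 3 * a₁ ^ 2 = 0 := by
    field_simp at this
    refine mul_left_cancel₀ ha ?_
    linear_combination this / 3
  simpa [hB0] using h2

open Polynomial in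
theorem divExpr_pole_two {a b a₂ b₁ p q a₂₂ b₁₁ : ℝ}
    (h : ∀ t, divExpr a b 0 a₂ b₁ 0 p q 0 a₂₂ b₁₁ 0 t = 0)
    (ha : a ≠ 0) (hab : a ^ 2 ≠ b ^ 2) (hp : a₂ = p * (a - b)) :
    a₂ ^ 2 = a ^ 2 * (a ^ 2 - b ^ 2) := by
  let A : ℝ[X] := 1 + X * C (a ^ 2)
  let B : ℝ[X] := 1 + X * C (b ^ 2)
  let Q : ℝ[X] :=
    C b₁₁ * A * B - 2 * X * C (b * b₁ ^ 2) * A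
      - C p * (1 + X * C (a * b)) * C a₂ * B
      + C (a ^ 2) * (C a * B + C b * A) * B
    + (C a₂₂ * A * B - 2 * X * C (a * a₂ ^ 2) * B
      - C q * (1 + X * C (a * b)) * C b₁ * A
      + C (b ^ 2) * (C a * B + C b * A) * A)
    - 2 * C (a ^ 3) * B ^ 2 - 2 * C (b ^ 3) * A ^ 2
  have hQ : ∀ s : ℝ, 0 < s → Q.eval s = 0 := by
    intro s hs
    obtain ⟨t, ht, rfl⟩ : ∃ t : ℝ, 0 < t ∧ t ^ 2 = s :=
      ⟨√s, Real.sqrt_pos.mpr hs, Real.sq_sqrt hs.le⟩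
    have hA : (1 + t ^ 2 * a ^ 2) ≠ 0 := by positivity
    have hB : (1 + t ^ 2 * b ^ 2) ≠ 0 := by positivity
    have key : t * Q.eval (t ^ 2) = divExpr a b 0 a₂ b₁ 0 p q 0 a₂₂ b₁₁ 0 t *
        ((1 + t ^ 2 * a ^ 2) ^ 2 * (1 + t ^ 2 * b ^ 2) ^ 2) := by
      simp only [Q, A, B, eval_add, eval_sub, eval_mul, eval_pow, eval_X, eval_C, eval_one,
        eval_ofNat, divExpr]
      generalize hA' : (1 + t ^ 2 * a ^ 2) = A' at *
      generalize hB' : (1 + t ^ 2 * b ^ 2) = B' at *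
      field_simp
      ring
    rw [h t, zero_mul] at key
    exact (mul_eq_zero.mp key).resolve_left ht.ne'
  have := eval_eq_zero_of_pos hQ (-1 / a ^ 2)
  have hA0 : A.eval (-1 / a ^ 2) = 0 := by
    simp only [A, eval_add, eval_mul, eval_X, eval_C, eval_one]
    field_simp
    ring
  have hB1 : B.eval (-1 / a ^ 2) = (a ^ 2 - b ^ 2) / a ^ 2 := by
    simp only [B, eval_add, eval_mul, eval_X, eval_C, eval_one]
    field_simp
    ring
  have hB0 : B.eval (-1 / a ^ 2) ≠ 0 := by
    rw [hB1]
    exact div_ne_zero (sub_ne_zero.mpr hab) (by positivity)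
  simp only [Q, eval_add, eval_sub, eval_mul, eval_pow, hA0] at this
  generalize B.eval (-1 / a ^ 2) = B' at *
  simp only [eval_X, eval_C, eval_ofNat, eval_one] at this
  have h2 : B' * (a₂ ^ 2 - a ^ 4 * B') = 0 := by
    have hab' : a - b ≠ 0 := by
      intro h0
      apply hab
      rw [sub_eq_zero.mp h0]
    obtain rfl : p = a₂ / (a - b) := by field_simp; linarith
    field_simp at this
    refine mul_left_cancel₀ (mul_ne_zero ha hab') ?_
    linear_combination this
  have h3 := (mul_eq_zero.mp h2).resolve_left hB0
  rw [hB1] at h3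
  field_simp at h3
  linarith

theorem divExpr_eq_zero_of_flat {a a₂ p q : ℝ} (ha : a ≠ 0) (h2 : a₂ ^ 2 = a ^ 4)
    (hp : a₂ = p * a) (t : ℝ) :
    divExpr a 0 0 a₂ 0 0 p q 0 (2 * a ^ 3) 0 0 t = 0 := by
  have hA : (1 + t ^ 2 * a ^ 2) ≠ 0 := by positivity
  obtain rfl : p = a₂ / a := by field_simp; linarith
  simp only [divExpr]
  field_simp
  linear_combination (-t - 3 * t ^ 3 * a ^ 2 - 2 * t ^ 5 * a ^ 4) * h2

theorem divExpr_eq_zero_of_umbilic (a p q t : ℝ) :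
    divExpr a a 0 0 0 0 p q 0 0 0 0 t = 0 := by
  have hA : (1 + t ^ 2 * a ^ 2) ≠ 0 := by positivity
  simp only [divExpr]
  field_simp
  ring

section Trace

variable {E ι : Type*} [AddCommGroup E] [Module ℝ E] [Fintype ι] [DecidableEq ι]

theorem eq_sum_smul_of_bilin_orthonormal [FiniteDimensional ℝ E]
    (hcard : Fintype.card ι = Module.finrank ℝ E)
    {G : E →ₗ[ℝ] E →ₗ[ℝ] ℝ} {u : ι → E} (hu : ∀ i j, G (u i) (u j) = if i = j then 1 else 0)
    (w : E) : w = ∑ i, G w (u i) • u i := by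
  have hG : ∀ (c : ι → ℝ) j, G (∑ i, c i • u i) (u j) = c j := by
    intro c j
    simp [map_sum, LinearMap.sum_apply, hu]
  have hli : LinearIndependent ℝ u := by
    rw [Fintype.linearIndependent_iff]
    intro c hc j
    rw [← hG c j, hc]
    simp
  have hspan := hli.span_eq_top_of_card_eq_finrank' hcard
  have hw : w ∈ Submodule.span ℝ (Set.range u) := by rw [hspan]; trivial
  obtain ⟨c, rfl⟩ := (Submodule.mem_span_range_iff_exists_fun ℝ).mp hw
  simp only [hG]

theorem sum_bilin_eq_of_orthonormal [FiniteDimensional ℝ E]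
    (hcard : Fintype.card ι = Module.finrank ℝ E)
    {G : E →ₗ[ℝ] E →ₗ[ℝ] ℝ} (hsymm : ∀ v w, G v w = G w v) (B : E →ₗ[ℝ] E →ₗ[ℝ] ℝ) {u v : ι → E}
    (hu : ∀ i j, G (u i) (u j) = if i = j then 1 else 0)
    (hv : ∀ i j, G (v i) (v j) = if i = j then 1 else 0) :
    ∑ i, B (v i) (v i) = ∑ i, B (u i) (u i) := by
  have hcol : ∀ j k, ∑ i, G (v i) (u j) * G (v i) (u k) = if j = k then 1 else 0 := by
    intro j k
    rw [← hu j k]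
    conv_rhs => rw [eq_sum_smul_of_bilin_orthonormal hcard hv (u j)]
    simp [map_sum, LinearMap.sum_apply, hsymm (u j)]
  have hB : ∀ i, B (v i) (v i) = ∑ j, ∑ k, (G (v i) (u j) * G (v i) (u k)) * B (u k) (u j) := by
    intro i
    conv_lhs => rw [eq_sum_smul_of_bilin_orthonormal hcard hu (v i)]
    simp only [map_sum, LinearMap.sum_apply, map_smul, LinearMap.smul_apply, smul_eq_mul,
      Finset.mul_sum]
    exact Finset.sum_congr rfl fun j _ => Finset.sum_congr rfl fun k _ => by ring
  simp_rw [hB]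
  rw [Finset.sum_comm]
  refine Finset.sum_congr rfl fun j _ => ?_
  rw [Finset.sum_comm]
  simp_rw [← Finset.sum_mul, hcol]
  simp

end Trace

theorem E3.eq_sum_smul {u v w : E3} (huu : ⟪u, u⟫_ℝ = 1) (hvv : ⟪v, v⟫_ℝ = 1) (hww : ⟪w, w⟫_ℝ = 1)
    (huv : ⟪u, v⟫_ℝ = 0) (huw : ⟪u, w⟫_ℝ = 0) (hvw : ⟪v, w⟫_ℝ = 0) (z : E3) :
    z = ⟪z, u⟫_ℝ • u + ⟪z, v⟫_ℝ • v + ⟪z, w⟫_ℝ • w := by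
  have h := eq_sum_smul_of_bilin_orthonormal (ι := Fin 3) (E := E3) (by simp)
    (G := innerₗ E3) (u := ![u, v, w]) (by
      have hvu : ⟪v, u⟫_ℝ = 0 := by rw [real_inner_comm, huv]
      have hwu : ⟪w, u⟫_ℝ = 0 := by rw [real_inner_comm, huw]
      have hwv : ⟪w, v⟫_ℝ = 0 := by rw [real_inner_comm, hvw]
      intro i j
      fin_cases i <;> fin_cases j <;> assumption) z
  simpa [Fin.sum_univ_three] using h

theorem E3.inner_eq_sum {u v w : E3} (huu : ⟪u, u⟫_ℝ = 1) (hvv : ⟪v, v⟫_ℝ = 1)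
    (hww : ⟪w, w⟫_ℝ = 1) (huv : ⟪u, v⟫_ℝ = 0) (huw : ⟪u, w⟫_ℝ = 0) (hvw : ⟪v, w⟫_ℝ = 0)
    (y z : E3) :
    ⟪y, z⟫_ℝ = ⟪y, u⟫_ℝ * ⟪z, u⟫_ℝ + ⟪y, v⟫_ℝ * ⟪z, v⟫_ℝ + ⟪y, w⟫_ℝ * ⟪z, w⟫_ℝ := by
  conv_lhs => rw [E3.eq_sum_smul huu hvv hww huv huw hvw z]
  simp only [inner_add_right, real_inner_smul_right]
  ring

theorem ip6_comm (v w : V6) : ip6 v w = ip6 w v := by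
  simp [ip6, real_inner_comm]

theorem ip6_Jc_left (v w : V6) : ip6 (Jc v) w = -ip6 v (Jc w) := by
  simp [ip6, Jc]

theorem ip6_add_left (u v w : V6) : ip6 (u + v) w = ip6 u w + ip6 v w := by
  simp [ip6, inner_add_left]; ring

theorem ip6_sub_left (u v w : V6) : ip6 (u - v) w = ip6 u w - ip6 v w := by
  simp [ip6, inner_sub_left]; ring

theorem ip6_smul_left (c : ℝ) (v w : V6) : ip6 (c • v) w = c * ip6 v w := by
  simp [ip6, real_inner_smul_left]; ring

theorem ip6_add_right (u v w : V6) : ip6 u (v + w) = ip6 u v + ip6 u w := by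
  simp [ip6, inner_add_right]; ring

theorem ip6_smul_right (c : ℝ) (v w : V6) : ip6 v (c • w) = c * ip6 v w := by
  simp [ip6, real_inner_smul_right]; ring

theorem ip6_self_eq_zero {v : V6} (h : ip6 v v = 0) : v = 0 := by
  have h1 := real_inner_self_nonneg (x := v.1)
  have h2 := real_inner_self_nonneg (x := v.2)
  unfold ip6 at h
  have e1 : v.1 = 0 := inner_self_eq_zero.mp (by linarith : ⟪v.1, v.1⟫_ℝ = 0)
  have e2 : v.2 = 0 := inner_self_eq_zero.mp (by linarith : ⟪v.2, v.2⟫_ℝ = 0)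
  exact Prod.ext e1 e2

/-- The inner product of `ℝ⁶` as a bilinear map. -/
def ip6ₗ : V6 →ₗ[ℝ] V6 →ₗ[ℝ] ℝ :=
  LinearMap.mk₂ ℝ ip6 ip6_add_left ip6_smul_left ip6_add_right ip6_smul_right

theorem ip6ₗ_apply (v w : V6) : ip6ₗ v w = ip6 v w := rfl

theorem ONFrame.sum_bilin_eq {g : W3 → V6} {q u₁ u₂ u₃ v₁ v₂ v₃ : W3}
    (hu : ONFrame g q u₁ u₂ u₃) (hv : ONFrame g q v₁ v₂ v₃) (B : W3 →ₗ[ℝ] W3 →ₗ[ℝ] ℝ) :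
    B v₁ v₁ + B v₂ v₂ + B v₃ v₃ = B u₁ u₁ + B u₂ u₂ + B u₃ u₃ := by
  let L : W3 →ₗ[ℝ] V6 := fderiv ℝ g q
  have key : ∀ {w₁ w₂ w₃ : W3}, ONFrame g q w₁ w₂ w₃ → ∀ i j : Fin 3,
      (ip6ₗ.compl₁₂ L L) (![w₁, w₂, w₃] i) (![w₁, w₂, w₃] j) = if i = j then 1 else 0 := by
    rintro w₁ w₂ w₃ ⟨h1, h2, h3, h4, h5, h6⟩ i j
    have h4' := ip6_comm (fderiv ℝ g q w₁) (fderiv ℝ g q w₂)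
    have h5' := ip6_comm (fderiv ℝ g q w₁) (fderiv ℝ g q w₃)
    have h6' := ip6_comm (fderiv ℝ g q w₂) (fderiv ℝ g q w₃)
    rw [h4] at h4'
    rw [h5] at h5'
    rw [h6] at h6'
    fin_cases i <;> fin_cases j <;>
      simp [ip6ₗ_apply, L, h1, h2, h3, h4, h5, h6, ← h4', ← h5', ← h6']
  have := sum_bilin_eq_of_orthonormal (E := W3) (ι := Fin 3) (by simp)
    (fun v w => by simp [ip6ₗ_apply, ip6_comm]) B (key hu) (key hv)
  simpa [Fin.sum_univ_three] using this

section Along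

variable {F : Type*} [NormedAddCommGroup F] [NormedSpace ℝ F]

/-- The derivative of `g` along the vector field `e`. -/
def along (e : ℝ × ℝ → ℝ × ℝ) (g : ℝ × ℝ → F) : ℝ × ℝ → F := fun p => fderiv ℝ g p (e p)

variable {W : Set (ℝ × ℝ)} {e e' : ℝ × ℝ → ℝ × ℝ} {g g' : ℝ × ℝ → F} {p : ℝ × ℝ}

theorem ContDiffOn.differentiableAt_of_isOpen {E : Type*} [NormedAddCommGroup E] [NormedSpace ℝ E]
    {g : E → F} {W : Set E} {p : E} (hg : ContDiffOn ℝ ∞ g W) (hW : IsOpen W)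
    (hp : p ∈ W) : DifferentiableAt ℝ g p :=
  (hg.contDiffAt (hW.mem_nhds hp)).differentiableAt (by simp)

theorem ContDiffOn.fderiv_infty {E : Type*} [NormedAddCommGroup E] [NormedSpace ℝ E]
    {g : E → F} {W : Set E} (hg : ContDiffOn ℝ ∞ g W) (hW : IsOpen W) :
    ContDiffOn ℝ ∞ (fderiv ℝ g) W :=
  hg.fderiv_of_isOpen hW (by simp)

theorem ContDiffOn.along (hg : ContDiffOn ℝ ∞ g W) (he : ContDiffOn ℝ ∞ e W) (hW : IsOpen W) :
    ContDiffOn ℝ ∞ (along e g) W :=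
  (hg.fderiv_infty hW).clm_apply he

theorem along_congr (hW : IsOpen W) (h : Set.EqOn g g' W) (hp : p ∈ W) :
    along e g p = along e g' p := by
  unfold along
  rw [(h.eventuallyEq_of_mem (hW.mem_nhds hp)).fderiv_eq]

theorem along_eq_zero_of_const (hW : IsOpen W) {c : F} (h : ∀ p ∈ W, g p = c) (hp : p ∈ W) :
    along e g p = 0 := by
  rw [along_congr (g' := fun _ => c) hW h hp]
  simp [along]

theorem along_add (hg : DifferentiableAt ℝ g p) (hg' : DifferentiableAt ℝ g' p) :
    along e (fun p => g p + g' p) p = along e g p + along e g' p := by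
  simp [along, fderiv_fun_add hg hg']

theorem along_neg : along e (fun p => -g p) p = -along e g p := by
  simp [along, fderiv_fun_neg]

theorem along_smul {c : ℝ × ℝ → ℝ} (hc : DifferentiableAt ℝ c p) (hg : DifferentiableAt ℝ g p) :
    along e (fun p => c p • g p) p = c p • along e g p + along e c p • g p := by
  simp [along, fderiv_fun_smul hc hg]

theorem along_inner {f g : ℝ × ℝ → E3} (hf : DifferentiableAt ℝ f p)
    (hg : DifferentiableAt ℝ g p) :
    along e (fun p => ⟪f p, g p⟫_ℝ) p = ⟪along e f p, g p⟫_ℝ + ⟪f p, along e g p⟫_ℝ := by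
  simp only [along]
  rw [fderiv_inner_apply ℝ hf hg, add_comm]

theorem along_along (hg : ContDiffOn ℝ ∞ g W) (he' : ContDiffOn ℝ ∞ e' W) (hW : IsOpen W)
    (hp : p ∈ W) :
    along e (along e' g) p =
      fderiv ℝ (fderiv ℝ g) p (e p) (e' p) + fderiv ℝ g p (along e e' p) := by
  have h1 := (hg.fderiv_infty hW).differentiableAt_of_isOpen hW hp
  have h2 := he'.differentiableAt_of_isOpen hW hp
  change fderiv ℝ (fun y => fderiv ℝ g y (e' y)) p (e p) = _
  rw [fderiv_clm_apply h1 h2]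
  simp [along, add_comm]

theorem fderiv_fderiv_const_apply (hg : ContDiffOn ℝ ∞ g W) (hW : IsOpen W) (hp : p ∈ W)
    (v w : ℝ × ℝ) : fderiv ℝ (fun y => fderiv ℝ g y w) p v = fderiv ℝ (fderiv ℝ g) p v w := by
  have h1 := (hg.fderiv_infty hW).differentiableAt_of_isOpen hW hp
  rw [fderiv_clm_apply h1 (differentiableAt_const w)]
  simp

theorem fderiv_fderiv_comm (hg : ContDiffOn ℝ ∞ g W) (hW : IsOpen W) (hp : p ∈ W)
    (v w : ℝ × ℝ) : fderiv ℝ (fderiv ℝ g) p v w = fderiv ℝ (fderiv ℝ g) p w v :=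
  (hg.contDiffAt (hW.mem_nhds hp)).isSymmSndFDerivAt
    (by simpa using WithTop.coe_le_coe.mpr (le_top : (2 : ℕ∞) ≤ ⊤)) v w

theorem along_comm (hg : ContDiffOn ℝ ∞ g W) (he : ContDiffOn ℝ ∞ e W) (he' : ContDiffOn ℝ ∞ e' W)
    (hW : IsOpen W) (hp : p ∈ W) :
    along e (along e' g) p - along e' (along e g) p =
      fderiv ℝ g p (along e e' p - along e' e p) := by
  rw [along_along hg he' hW hp, along_along hg he hW hp, fderiv_fderiv_comm hg hW hp, map_sub]
  abel

end Along

/-- `e₁, e₂` is a smooth frame on `W`, orthonormal for the metric induced by the immersion `x`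
with unit normal `N`. -/
structure MovingFrame (W : Set (ℝ × ℝ)) (x N : ℝ × ℝ → E3) (e₁ e₂ : ℝ × ℝ → ℝ × ℝ) : Prop where
  isOpen : IsOpen W
  smooth_x : ContDiffOn ℝ ∞ x W
  smooth_N : ContDiffOn ℝ ∞ N W
  smooth₁ : ContDiffOn ℝ ∞ e₁ W
  smooth₂ : ContDiffOn ℝ ∞ e₂ W
  inj : ∀ p ∈ W, Function.Injective (fderiv ℝ x p)
  unit_N : ∀ p ∈ W, ⟪N p, N p⟫_ℝ = 1
  normal_N : ∀ p ∈ W, ∀ v, ⟪N p, fderiv ℝ x p v⟫_ℝ = 0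
  unit₁ : ∀ p ∈ W, ⟪along e₁ x p, along e₁ x p⟫_ℝ = 1
  unit₂ : ∀ p ∈ W, ⟪along e₂ x p, along e₂ x p⟫_ℝ = 1
  orth : ∀ p ∈ W, ⟪along e₁ x p, along e₂ x p⟫_ℝ = 0

/-- The coefficients `⟨A e, e'⟩` of the shape operator. -/
def sff (x N : ℝ × ℝ → E3) (e e' : ℝ × ℝ → ℝ × ℝ) : ℝ × ℝ → ℝ :=
  fun p => -⟪along e N p, along e' x p⟫_ℝ

/-- The geodesic curvature coefficient `⟨∇_e e, e'⟩`. -/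
def geo (x : ℝ × ℝ → E3) (e e' : ℝ × ℝ → ℝ × ℝ) : ℝ × ℝ → ℝ :=
  fun p => ⟪along e (along e x) p, along e' x p⟫_ℝ

namespace MovingFrame

variable {W : Set (ℝ × ℝ)} {x N : ℝ × ℝ → E3} {e₁ e₂ : ℝ × ℝ → ℝ × ℝ} {p : ℝ × ℝ}

theorem swap (h : MovingFrame W x N e₁ e₂) : MovingFrame W x N e₂ e₁ where
  __ := h
  smooth₁ := h.smooth₂
  smooth₂ := h.smooth₁
  unit₁ := h.unit₂
  unit₂ := h.unit₁
  orth p hp := by rw [real_inner_comm, h.orth p hp]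

theorem mono (h : MovingFrame W x N e₁ e₂) {W' : Set (ℝ × ℝ)} (hW' : IsOpen W') (hs : W' ⊆ W) :
    MovingFrame W' x N e₁ e₂ where
  isOpen := hW'
  smooth_x := h.smooth_x.mono hs
  smooth_N := h.smooth_N.mono hs
  smooth₁ := h.smooth₁.mono hs
  smooth₂ := h.smooth₂.mono hs
  inj p hp := h.inj p (hs hp)
  unit_N p hp := h.unit_N p (hs hp)
  normal_N p hp := h.normal_N p (hs hp)
  unit₁ p hp := h.unit₁ p (hs hp)
  unit₂ p hp := h.unit₂ p (hs hp)
  orth p hp := h.orth p (hs hp)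

theorem orth' (h : MovingFrame W x N e₁ e₂) (hp : p ∈ W) :
    ⟪along e₂ x p, along e₁ x p⟫_ℝ = 0 := h.swap.orth p hp

theorem normal_left (h : MovingFrame W x N e₁ e₂) (hp : p ∈ W) (e : ℝ × ℝ → ℝ × ℝ) :
    ⟪along e x p, N p⟫_ℝ = 0 := by
  rw [real_inner_comm]; exact h.normal_N p hp _

theorem normal_right (h : MovingFrame W x N e₁ e₂) (hp : p ∈ W) (e : ℝ × ℝ → ℝ × ℝ) :
    ⟪N p, along e x p⟫_ℝ = 0 := h.normal_N p hp _

theorem smooth_E₁ (h : MovingFrame W x N e₁ e₂) : ContDiffOn ℝ ∞ (along e₁ x) W :=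
  h.smooth_x.along h.smooth₁ h.isOpen

theorem smooth_E₂ (h : MovingFrame W x N e₁ e₂) : ContDiffOn ℝ ∞ (along e₂ x) W :=
  h.swap.smooth_E₁

theorem smooth_N₁ (h : MovingFrame W x N e₁ e₂) : ContDiffOn ℝ ∞ (along e₁ N) W :=
  h.smooth_N.along h.smooth₁ h.isOpen

theorem smooth_sff₁₁ (h : MovingFrame W x N e₁ e₂) : ContDiffOn ℝ ∞ (sff x N e₁ e₁) W :=
  (h.smooth_N₁.inner ℝ h.smooth_E₁).neg

theorem smooth_sff₁₂ (h : MovingFrame W x N e₁ e₂) : ContDiffOn ℝ ∞ (sff x N e₁ e₂) W :=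
  (h.smooth_N₁.inner ℝ h.smooth_E₂).neg

theorem smooth_sff₂₂ (h : MovingFrame W x N e₁ e₂) : ContDiffOn ℝ ∞ (sff x N e₂ e₂) W :=
  h.swap.smooth_sff₁₁

theorem smooth_along {F : Type*} [NormedAddCommGroup F] [NormedSpace ℝ F] {g : ℝ × ℝ → F}
    (h : MovingFrame W x N e₁ e₂) (hg : ContDiffOn ℝ ∞ g W) : ContDiffOn ℝ ∞ (along e₁ g) W :=
  hg.along h.smooth₁ h.isOpen

theorem diff {F : Type*} [NormedAddCommGroup F] [NormedSpace ℝ F] {g : ℝ × ℝ → F}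
    (h : MovingFrame W x N e₁ e₂) (hp : p ∈ W) (hg : ContDiffOn ℝ ∞ g W) :
    DifferentiableAt ℝ g p := hg.differentiableAt_of_isOpen h.isOpen hp

theorem expand (h : MovingFrame W x N e₁ e₂) (hp : p ∈ W) (z : E3) :
    z = ⟪z, along e₁ x p⟫_ℝ • along e₁ x p + ⟪z, along e₂ x p⟫_ℝ • along e₂ x p
      + ⟪z, N p⟫_ℝ • N p :=
  E3.eq_sum_smul (h.unit₁ p hp) (h.unit₂ p hp) (h.unit_N p hp) (h.orth p hp)
    (h.normal_left hp e₁) (h.normal_left hp e₂) z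

theorem expand_vector (h : MovingFrame W x N e₁ e₂) (hp : p ∈ W) (v : ℝ × ℝ) :
    v = ⟪fderiv ℝ x p v, along e₁ x p⟫_ℝ • e₁ p + ⟪fderiv ℝ x p v, along e₂ x p⟫_ℝ • e₂ p := by
  apply h.inj p hp
  rw [map_add, map_smul, map_smul]
  conv_lhs => rw [h.expand hp (fderiv ℝ x p v)]
  rw [real_inner_comm (N p), h.normal_N p hp v]
  simp [along]

theorem inner_along_eq_of_const {f g : ℝ × ℝ → E3} (h : MovingFrame W x N e₁ e₂) (hp : p ∈ W)
    (hf : ContDiffOn ℝ ∞ f W) (hg : ContDiffOn ℝ ∞ g W) {c : ℝ} (hc : ∀ p ∈ W, ⟪f p, g p⟫_ℝ = c)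
    (e : ℝ × ℝ → ℝ × ℝ) : ⟪along e f p, g p⟫_ℝ = -⟪along e g p, f p⟫_ℝ := by
  have := along_inner (e := e) (h.diff hp hf) (h.diff hp hg)
  rw [along_eq_zero_of_const h.isOpen hc hp] at this
  linarith [real_inner_comm (f p) (along e g p)]

theorem inner_dN_symm (h : MovingFrame W x N e₁ e₂) (hp : p ∈ W) (v w : ℝ × ℝ) :
    ⟪fderiv ℝ N p v, fderiv ℝ x p w⟫_ℝ = ⟪fderiv ℝ N p w, fderiv ℝ x p v⟫_ℝ := by
  have key : ∀ v w, ⟪fderiv ℝ N p v, fderiv ℝ x p w⟫_ℝ =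
      -⟪fderiv ℝ (fderiv ℝ x) p v w, N p⟫_ℝ := by
    intro v w
    have := h.inner_along_eq_of_const hp h.smooth_N
      ((h.smooth_x.fderiv_infty h.isOpen).clm_apply (contDiffOn_const (c := w)))
      (fun p hp => h.normal_N p hp w) (fun _ => v)
    simp only [along] at this
    rwa [fderiv_fderiv_const_apply h.smooth_x h.isOpen hp] at this
  rw [key, key, fderiv_fderiv_comm h.smooth_x h.isOpen hp]

theorem sff_comm (h : MovingFrame W x N e₁ e₂) (hp : p ∈ W) (e e' : ℝ × ℝ → ℝ × ℝ) :
    sff x N e e' p = sff x N e' e p := by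
  simp only [sff, along]
  rw [h.inner_dN_symm hp]

theorem along_N (h : MovingFrame W x N e₁ e₂) (hp : p ∈ W) (e : ℝ × ℝ → ℝ × ℝ) :
    along e N p = -(sff x N e e₁ p) • along e₁ x p + -(sff x N e e₂ p) • along e₂ x p := by
  have h0 : ⟪along e N p, N p⟫_ℝ = 0 := by
    have := h.inner_along_eq_of_const hp h.smooth_N h.smooth_N h.unit_N e
    linarith
  conv_lhs => rw [h.expand hp (along e N p), h0]
  simp [sff]

theorem along_E₁_normal (h : MovingFrame W x N e₁ e₂) (hp : p ∈ W) (e : ℝ × ℝ → ℝ × ℝ) :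
    ⟪along e (along e₁ x) p, N p⟫_ℝ = sff x N e e₁ p :=
  h.inner_along_eq_of_const hp h.smooth_E₁ h.smooth_N (fun _ hp => h.normal_left hp e₁) e

theorem along_E₁_self (h : MovingFrame W x N e₁ e₂) (hp : p ∈ W) (e : ℝ × ℝ → ℝ × ℝ) :
    ⟪along e (along e₁ x) p, along e₁ x p⟫_ℝ = 0 := by
  have := h.inner_along_eq_of_const hp h.smooth_E₁ h.smooth_E₁ h.unit₁ e
  linarith

theorem along₁_E₁ (h : MovingFrame W x N e₁ e₂) (hp : p ∈ W) :
    along e₁ (along e₁ x) p =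
      geo x e₁ e₂ p • along e₂ x p + sff x N e₁ e₁ p • N p := by
  conv_lhs => rw [h.expand hp (along e₁ (along e₁ x) p), h.along_E₁_self hp, h.along_E₁_normal hp]
  simp [geo]

theorem along₁_E₂ (h : MovingFrame W x N e₁ e₂) (hp : p ∈ W) :
    along e₁ (along e₂ x) p =
      -(geo x e₁ e₂ p) • along e₁ x p + sff x N e₁ e₂ p • N p := by
  conv_lhs => rw [h.expand hp (along e₁ (along e₂ x) p), h.swap.along_E₁_self hp,
    h.swap.along_E₁_normal hp,
    h.inner_along_eq_of_const hp h.smooth_E₂ h.smooth_E₁ (fun _ hp => h.orth' hp) e₁]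
  simp [geo]

theorem along₂_E₁ (h : MovingFrame W x N e₁ e₂) (hp : p ∈ W) :
    along e₂ (along e₁ x) p =
      -(geo x e₂ e₁ p) • along e₂ x p + sff x N e₁ e₂ p • N p := by
  rw [h.swap.along₁_E₂ hp, h.sff_comm hp]

theorem along₂_E₂ (h : MovingFrame W x N e₁ e₂) (hp : p ∈ W) :
    along e₂ (along e₂ x) p =
      geo x e₂ e₁ p • along e₁ x p + sff x N e₂ e₂ p • N p :=
  h.swap.along₁_E₁ hp

theorem along₁_N (h : MovingFrame W x N e₁ e₂) (hp : p ∈ W) :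
    along e₁ N p = -(sff x N e₁ e₁ p) • along e₁ x p + -(sff x N e₁ e₂ p) • along e₂ x p :=
  h.along_N hp e₁

theorem along₂_N (h : MovingFrame W x N e₁ e₂) (hp : p ∈ W) :
    along e₂ N p = -(sff x N e₁ e₂ p) • along e₁ x p + -(sff x N e₂ e₂ p) • along e₂ x p := by
  rw [h.along_N hp e₂, h.sff_comm hp e₂ e₁]

theorem along_along_N (h : MovingFrame W x N e₁ e₂) (hp : p ∈ W) (e : ℝ × ℝ → ℝ × ℝ) :
    along e (along e₁ N) p =
      -(sff x N e₁ e₁ p) • along e (along e₁ x) p + -(along e (sff x N e₁ e₁) p) • along e₁ x p +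
      (-(sff x N e₁ e₂ p) • along e (along e₂ x) p +
        -(along e (sff x N e₁ e₂) p) • along e₂ x p) := by
  have d1 := h.diff hp h.smooth_sff₁₁.neg
  have d2 := h.diff hp h.smooth_sff₁₂.neg
  have d3 := h.diff hp h.smooth_E₁
  have d4 := h.diff hp h.smooth_E₂
  rw [along_congr h.isOpen (fun p hp => h.along₁_N hp) hp, along_add (d1.fun_smul d3) (d2.fun_smul d4),
    along_smul d1 d3, along_smul d2 d4, along_neg, along_neg]

theorem bracket (h : MovingFrame W x N e₁ e₂) (hp : p ∈ W) :
    along e₁ e₂ p - along e₂ e₁ p = -(geo x e₁ e₂ p) • e₁ p + geo x e₂ e₁ p • e₂ p := by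
  apply h.inj p hp
  rw [← along_comm h.smooth_x h.smooth₁ h.smooth₂ h.isOpen hp, h.along₁_E₂ hp, h.along₂_E₁ hp,
    map_add, map_smul, map_smul]
  simp only [along]
  module

theorem codazzi₁ (h : MovingFrame W x N e₁ e₂) (hp : p ∈ W) :
    along e₂ (sff x N e₁ e₁) p - along e₁ (sff x N e₁ e₂) p =
      geo x e₁ e₂ p * (sff x N e₁ e₁ p - sff x N e₂ e₂ p)
        - 2 * geo x e₂ e₁ p * sff x N e₁ e₂ p := by
  have hc := along_comm h.smooth_N h.smooth₁ h.smooth₂ h.isOpen hp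
  rw [h.bracket hp, map_add, map_smul, map_smul, h.along_along_N hp, h.swap.along_along_N hp,
    h.along₁_E₁ hp, h.along₁_E₂ hp, h.along₂_E₁ hp, h.along₂_E₂ hp] at hc
  have e1 : fderiv ℝ N p (e₁ p) = _ := h.along₁_N hp
  have e2 : fderiv ℝ N p (e₂ p) = _ := h.along₂_N hp
  rw [e1, e2, along_congr (g := sff x N e₂ e₁) h.isOpen (fun p hp => h.sff_comm hp _ _) hp,
    h.sff_comm hp e₂ e₁] at hc
  have := congrArg (fun z => ⟪z, along e₁ x p⟫_ℝ) hc
  simp only [inner_add_left, inner_sub_left, real_inner_smul_left, h.unit₁ p hp, h.orth' hp,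
    h.normal_right hp] at this
  linarith

theorem codazzi₂ (h : MovingFrame W x N e₁ e₂) (hp : p ∈ W) :
    along e₁ (sff x N e₂ e₂) p - along e₂ (sff x N e₁ e₂) p =
      geo x e₂ e₁ p * (sff x N e₂ e₂ p - sff x N e₁ e₁ p)
        - 2 * geo x e₁ e₂ p * sff x N e₁ e₂ p := by
  have := h.swap.codazzi₁ hp
  rwa [along_congr (g := sff x N e₂ e₁) h.isOpen (fun p hp => h.sff_comm hp _ _) hp,
    h.sff_comm hp e₂ e₁] at this

end MovingFrame

theorem fderiv_apply_fst {F : Type*} [NormedAddCommGroup F] [NormedSpace ℝ F] {G : W3 → F}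
    {p : ℝ × ℝ} {t : ℝ} (hG : DifferentiableAt ℝ G (p, t)) (v : ℝ × ℝ) :
    fderiv ℝ G (p, t) (v, 0) = fderiv ℝ (fun p' => G (p', t)) p v := by
  have h : HasFDerivAt (fun p' : ℝ × ℝ => (p', t)) (ContinuousLinearMap.inl ℝ (ℝ × ℝ) ℝ) p :=
    hasFDerivAt_prodMk_left p t
  have := (hG.hasFDerivAt.comp p h).fderiv
  rw [show (fun p' => G (p', t)) = G ∘ fun p' : ℝ × ℝ => (p', t) from rfl, this]
  simp

theorem fderiv_apply_snd {F : Type*} [NormedAddCommGroup F] [NormedSpace ℝ F] {G : W3 → F}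
    {p : ℝ × ℝ} {t : ℝ} (hG : DifferentiableAt ℝ G (p, t)) :
    fderiv ℝ G (p, t) (0, 1) = deriv (fun t' => G (p, t')) t := by
  have h : HasFDerivAt (fun t' : ℝ => (p, t')) (ContinuousLinearMap.inr ℝ (ℝ × ℝ) ℝ) t :=
    hasFDerivAt_prodMk_right p t
  have := (hG.hasFDerivAt.comp t h).fderiv
  rw [show (fun t' => G (p, t')) = G ∘ fun t' : ℝ => (p, t') from rfl, ← fderiv_apply_one_eq_deriv,
    this]
  simp

namespace MovingFrame

variable {W : Set (ℝ × ℝ)} {x N : ℝ × ℝ → E3} {e₁ e₂ : ℝ × ℝ → ℝ × ℝ} {p : ℝ × ℝ}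

theorem isOpen_prod (h : MovingFrame W x N e₁ e₂) : IsOpen (W ×ˢ (Set.univ : Set ℝ)) :=
  h.isOpen.prod isOpen_univ

theorem smooth_nbi (h : MovingFrame W x N e₁ e₂) :
    ContDiffOn ℝ ∞ (nbi x N) (W ×ˢ (Set.univ : Set ℝ)) :=
  (h.smooth_x.comp contDiffOn_fst fun _ hq => hq.1).prodMk
    (contDiffOn_snd.smul (h.smooth_N.comp contDiffOn_fst fun _ hq => hq.1))

theorem fderiv_nbi (h : MovingFrame W x N e₁ e₂) (hp : p ∈ W) (t : ℝ) (v : ℝ × ℝ) (s : ℝ) :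
    fderiv ℝ (nbi x N) (p, t) (v, s) = (fderiv ℝ x p v, s • N p + t • fderiv ℝ N p v) := by
  have h1 : HasFDerivAt (fun q : W3 => x q.1)
      ((fderiv ℝ x p).comp (ContinuousLinearMap.fst ℝ (ℝ × ℝ) ℝ)) (p, t) :=
    (h.diff hp h.smooth_x).hasFDerivAt.comp (p, t) hasFDerivAt_fst
  have h2 : HasFDerivAt (fun q : W3 => N q.1)
      ((fderiv ℝ N p).comp (ContinuousLinearMap.fst ℝ (ℝ × ℝ) ℝ)) (p, t) :=
    (h.diff hp h.smooth_N).hasFDerivAt.comp (p, t) hasFDerivAt_fst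
  have h3 : HasFDerivAt (fun q : W3 => q.2) (ContinuousLinearMap.snd ℝ (ℝ × ℝ) ℝ) (p, t) :=
    hasFDerivAt_snd
  have := (h1.prodMk (h3.smul h2)).fderiv
  change fderiv ℝ (nbi x N) (p, t) = _ at this
  rw [this]
  simp [add_comm]

theorem d2_nbi_eq (h : MovingFrame W x N e₁ e₂) (hp : p ∈ W) (t : ℝ) (v w : W3) :
    d2 (nbi x N) (p, t) v w = fderiv ℝ (fderiv ℝ (nbi x N)) (p, t) v w := by
  have h1 := (h.smooth_nbi.fderiv_infty h.isOpen_prod).differentiableAt_of_isOpen h.isOpen_prod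
    (p := (p, t)) ⟨hp, trivial⟩
  unfold d2
  rw [fderiv_clm_apply h1 (differentiableAt_const w)]
  simp

theorem differentiableAt_fderiv_nbi (h : MovingFrame W x N e₁ e₂) (hp : p ∈ W) (t : ℝ) (w : W3) :
    DifferentiableAt ℝ (fun y => fderiv ℝ (nbi x N) y w) (p, t) :=
  ((h.smooth_nbi.fderiv_infty h.isOpen_prod).differentiableAt_of_isOpen h.isOpen_prod
    (p := (p, t)) ⟨hp, trivial⟩).clm_apply (differentiableAt_const w)

theorem d2_nbi_fst (h : MovingFrame W x N e₁ e₂) (hp : p ∈ W) (t : ℝ) (v : ℝ × ℝ) :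
    d2 (nbi x N) (p, t) (v, 0) (v, 0) =
      (fderiv ℝ (fderiv ℝ x) p v v, t • fderiv ℝ (fderiv ℝ N) p v v) := by
  unfold d2
  rw [fderiv_apply_fst (h.differentiableAt_fderiv_nbi hp t _)]
  have : (fun p' => fderiv ℝ (nbi x N) (p', t) (v, 0)) =ᶠ[nhds p]
      fun p' => (fderiv ℝ x p' v, t • fderiv ℝ N p' v) := by
    filter_upwards [h.isOpen.mem_nhds hp] with p' hp'
    rw [h.fderiv_nbi hp']
    simp
  have d1 : DifferentiableAt ℝ (fun p' => fderiv ℝ x p' v) p :=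
    (h.diff hp (h.smooth_x.fderiv_infty h.isOpen)).clm_apply (differentiableAt_const v)
  have d2 : DifferentiableAt ℝ (fun p' => fderiv ℝ N p' v) p :=
    (h.diff hp (h.smooth_N.fderiv_infty h.isOpen)).clm_apply (differentiableAt_const v)
  rw [this.fderiv_eq, d1.fderiv_prodMk (d2.fun_const_smul t), fderiv_fun_const_smul d2]
  simp [fderiv_fderiv_const_apply h.smooth_x h.isOpen hp,
    fderiv_fderiv_const_apply h.smooth_N h.isOpen hp]

theorem d2_nbi_snd (h : MovingFrame W x N e₁ e₂) (hp : p ∈ W) (t : ℝ) :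
    d2 (nbi x N) (p, t) (0, 1) (0, 1) = 0 := by
  unfold d2
  rw [fderiv_apply_snd (h.differentiableAt_fderiv_nbi hp t _)]
  have : (fun t' => fderiv ℝ (nbi x N) (p, t') (0, 1)) = fun _ => (0, N p) := by
    funext t'
    rw [h.fderiv_nbi hp]
    simp
  rw [this]
  simp

theorem isNormalAt_Jc (h : MovingFrame W x N e₁ e₂) (hp : p ∈ W) (t : ℝ) (w : W3) :
    IsNormalAt (nbi x N) (p, t) (Jc (fderiv ℝ (nbi x N) (p, t) w)) := by
  rintro ⟨v, s⟩
  obtain ⟨w, r⟩ := w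
  rw [h.fderiv_nbi hp, h.fderiv_nbi hp]
  simp only [ip6, Jc, inner_add_left, inner_add_right, inner_neg_left, real_inner_smul_left,
    real_inner_smul_right, h.normal_N p hp]
  rw [real_inner_comm (N p), h.normal_N p hp, h.inner_dN_symm hp, real_inner_comm]
  ring

/-- The second derivative of `f` paired with a vector, as a bilinear map. -/
def d2Form (f : W3 → V6) (q : W3) (ξ : V6) : W3 →ₗ[ℝ] W3 →ₗ[ℝ] ℝ :=
  LinearMap.mk₂ ℝ (fun v w => ip6 (fderiv ℝ (fderiv ℝ f) q v w) ξ)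
    (by intros; simp [ip6_add_left]) (by intros; simp [ip6_smul_left])
    (by intros; simp [ip6_add_left]) (by intros; simp [ip6_smul_left])

theorem d2Form_apply (h : MovingFrame W x N e₁ e₂) (hp : p ∈ W) (t : ℝ) (ξ : V6) (v w : W3) :
    d2Form (nbi x N) (p, t) ξ v w = ip6 (d2 (nbi x N) (p, t) v w) ξ := by
  rw [h.d2_nbi_eq hp]
  rfl

theorem ip6_meanCurv (h : MovingFrame W x N e₁ e₂) (hp : p ∈ W) {t : ℝ} {Hq ξ : V6}
    (hH : IsMeanCurvAt (nbi x N) (p, t) Hq) (hξ : IsNormalAt (nbi x N) (p, t) ξ) {u₁ u₂ u₃ : W3}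
    (hu : ONFrame (nbi x N) (p, t) u₁ u₂ u₃) :
    ip6 Hq ξ = d2Form (nbi x N) (p, t) ξ u₁ u₁ + d2Form (nbi x N) (p, t) ξ u₂ u₂ +
      d2Form (nbi x N) (p, t) ξ u₃ u₃ := by
  obtain ⟨v₁, v₂, v₃, hv, n₁, n₂, n₃, h1, h2, h3, rfl⟩ := hH
  have key : ∀ {v n}, IsSFF (nbi x N) (p, t) v v n →
      ip6 n ξ = d2Form (nbi x N) (p, t) ξ v v := by
    rintro v n ⟨-, w, hw⟩
    have := hξ w
    rw [hw, ip6_comm, ip6_sub_left] at this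
    rw [h.d2Form_apply hp]
    linarith
  rw [← hu.sum_bilin_eq hv, ip6_add_left, ip6_add_left, key h1, key h2, key h3]

end MovingFrame

/-- The squared length of `(e, 0)` in the metric induced by the normal bundle immersion. -/
def nbiNormSq (x N : ℝ × ℝ → E3) (e e' : ℝ × ℝ → ℝ × ℝ) (p : ℝ × ℝ) (t : ℝ) : ℝ :=
  1 + t ^ 2 * (sff x N e e p ^ 2 + sff x N e e' p ^ 2)

theorem nbiNormSq_pos (x N : ℝ × ℝ → E3) (e e' : ℝ × ℝ → ℝ × ℝ) (p : ℝ × ℝ) (t : ℝ) :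
    0 < nbiNormSq x N e e' p t := by
  unfold nbiNormSq
  positivity

namespace MovingFrame

variable {W : Set (ℝ × ℝ)} {x N : ℝ × ℝ → E3} {e₁ e₂ : ℝ × ℝ → ℝ × ℝ} {p : ℝ × ℝ}

theorem fderiv_nbi_e₁ (h : MovingFrame W x N e₁ e₂) (hp : p ∈ W) (t : ℝ) :
    fderiv ℝ (nbi x N) (p, t) (e₁ p, 0) = (along e₁ x p, t • along e₁ N p) := by
  rw [h.fderiv_nbi hp]
  simp [along]

theorem fderiv_nbi_t (h : MovingFrame W x N e₁ e₂) (hp : p ∈ W) (t : ℝ) :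
    fderiv ℝ (nbi x N) (p, t) (0, 1) = (0, N p) := by
  rw [h.fderiv_nbi hp]
  simp

theorem ip6_e₁_e₁ (h : MovingFrame W x N e₁ e₂) (hp : p ∈ W) (t : ℝ) :
    ip6 (fderiv ℝ (nbi x N) (p, t) (e₁ p, 0)) (fderiv ℝ (nbi x N) (p, t) (e₁ p, 0)) =
      nbiNormSq x N e₁ e₂ p t := by
  rw [h.fderiv_nbi_e₁ hp, h.along₁_N hp]
  simp only [ip6, nbiNormSq, inner_add_left, inner_add_right, real_inner_smul_left,
    real_inner_smul_right, h.unit₁ p hp, h.unit₂ p hp, h.orth p hp, h.orth' hp]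
  ring

theorem ip6_e₁_e₂ (h : MovingFrame W x N e₁ e₂) (hp : p ∈ W) (t : ℝ) :
    ip6 (fderiv ℝ (nbi x N) (p, t) (e₁ p, 0)) (fderiv ℝ (nbi x N) (p, t) (e₂ p, 0)) =
      t ^ 2 * (sff x N e₁ e₂ p * (sff x N e₁ e₁ p + sff x N e₂ e₂ p)) := by
  rw [h.fderiv_nbi_e₁ hp, h.swap.fderiv_nbi_e₁ hp, h.along₁_N hp, h.along₂_N hp]
  simp only [ip6, inner_add_left, inner_add_right, real_inner_smul_left,
    real_inner_smul_right, h.unit₁ p hp, h.unit₂ p hp, h.orth p hp, h.orth' hp]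
  ring

theorem ip6_e₁_t (h : MovingFrame W x N e₁ e₂) (hp : p ∈ W) (t : ℝ) :
    ip6 (fderiv ℝ (nbi x N) (p, t) (e₁ p, 0)) (fderiv ℝ (nbi x N) (p, t) (0, 1)) = 0 := by
  rw [h.fderiv_nbi_e₁ hp, h.fderiv_nbi_t hp, h.along₁_N hp]
  simp only [ip6, inner_add_left, inner_zero_right, real_inner_smul_left, h.normal_left hp]
  ring

theorem ip6_t_t (h : MovingFrame W x N e₁ e₂) (hp : p ∈ W) (t : ℝ) :
    ip6 (fderiv ℝ (nbi x N) (p, t) (0, 1)) (fderiv ℝ (nbi x N) (p, t) (0, 1)) = 1 := by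
  rw [h.fderiv_nbi_t hp]
  simp only [ip6, inner_zero_left, zero_add]
  exact h.unit_N p hp

theorem onFrame (h : MovingFrame W x N e₁ e₂) (hp : p ∈ W)
    (hm : sff x N e₁ e₂ p * (sff x N e₁ e₁ p + sff x N e₂ e₂ p) = 0) (t : ℝ) :
    ONFrame (nbi x N) (p, t) ((√(nbiNormSq x N e₁ e₂ p t))⁻¹ • (e₁ p, 0))
      ((√(nbiNormSq x N e₂ e₁ p t))⁻¹ • (e₂ p, 0)) (0, 1) := by
  have hA := nbiNormSq_pos x N e₁ e₂ p t
  have hB := nbiNormSq_pos x N e₂ e₁ p t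
  have sA := Real.sq_sqrt hA.le
  have sB := Real.sq_sqrt hB.le
  have pA := Real.sqrt_pos.mpr hA
  have pB := Real.sqrt_pos.mpr hB
  simp only [ONFrame, map_smul, ip6_smul_left, ip6_smul_right, h.ip6_e₁_e₁ hp,
    h.swap.ip6_e₁_e₁ hp, h.ip6_e₁_e₂ hp, h.ip6_e₁_t hp, h.swap.ip6_e₁_t hp, h.ip6_t_t hp, hm]
  refine ⟨?_, ?_, trivial, by ring, by ring, by ring⟩
  · field_simp; linarith
  · field_simp; linarith

theorem sum_bilin (h : MovingFrame W x N e₁ e₂) (hp : p ∈ W)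
    (hm : sff x N e₁ e₂ p * (sff x N e₁ e₁ p + sff x N e₂ e₂ p) = 0) {t : ℝ} {v₁ v₂ v₃ : W3}
    (hv : ONFrame (nbi x N) (p, t) v₁ v₂ v₃) (B : W3 →ₗ[ℝ] W3 →ₗ[ℝ] ℝ) :
    B v₁ v₁ + B v₂ v₂ + B v₃ v₃ =
      B (e₁ p, 0) (e₁ p, 0) / nbiNormSq x N e₁ e₂ p t +
      B (e₂ p, 0) (e₂ p, 0) / nbiNormSq x N e₂ e₁ p t + B (0, 1) (0, 1) := by
  have hA := nbiNormSq_pos x N e₁ e₂ p t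
  have hB := nbiNormSq_pos x N e₂ e₁ p t
  have sA := Real.sq_sqrt hA.le
  have sB := Real.sq_sqrt hB.le
  have pA := Real.sqrt_pos.mpr hA
  have pB := Real.sqrt_pos.mpr hB
  rw [(h.onFrame hp hm t).sum_bilin_eq hv B]
  simp only [map_smul, LinearMap.smul_apply, smul_eq_mul]
  rw [← mul_assoc, ← mul_assoc, ← mul_inv, ← mul_inv, ← sq, ← sq, sA, sB]
  ring

theorem ip6_Jc_meanCurv (h : MovingFrame W x N e₁ e₂) (hp : p ∈ W)
    (hm : sff x N e₁ e₂ p * (sff x N e₁ e₁ p + sff x N e₂ e₂ p) = 0) {t : ℝ} {Hq : V6}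
    (hH : IsMeanCurvAt (nbi x N) (p, t) Hq) (w : W3) :
    ip6 (Jc Hq) (fderiv ℝ (nbi x N) (p, t) w) =
      -(ip6 (d2 (nbi x N) (p, t) (e₁ p, 0) (e₁ p, 0)) (Jc (fderiv ℝ (nbi x N) (p, t) w))
          / nbiNormSq x N e₁ e₂ p t +
        ip6 (d2 (nbi x N) (p, t) (e₂ p, 0) (e₂ p, 0)) (Jc (fderiv ℝ (nbi x N) (p, t) w))
          / nbiNormSq x N e₂ e₁ p t) := by
  rw [ip6_Jc_left, h.ip6_meanCurv hp hH (h.isNormalAt_Jc hp t w) (h.onFrame hp hm t),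
    h.sum_bilin hp hm (h.onFrame hp hm t)]
  simp only [h.d2Form_apply hp, h.d2_nbi_snd hp]
  simp [ip6]

theorem d2_nbi_e₁ (h : MovingFrame W x N e₁ e₂) (hp : p ∈ W) (t : ℝ) :
    ∃ α β : ℝ, d2 (nbi x N) (p, t) (e₁ p, 0) (e₁ p, 0) =
      (along e₁ (along e₁ x) p - (α • along e₁ x p + β • along e₂ x p),
        t • (along e₁ (along e₁ N) p - (α • along e₁ N p + β • along e₂ N p))) := by
  refine ⟨⟪fderiv ℝ x p (along e₁ e₁ p), along e₁ x p⟫_ℝ,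
    ⟪fderiv ℝ x p (along e₁ e₁ p), along e₂ x p⟫_ℝ, ?_⟩
  have ex := congrArg (fderiv ℝ x p) (h.expand_vector hp (along e₁ e₁ p))
  have eN := congrArg (fderiv ℝ N p) (h.expand_vector hp (along e₁ e₁ p))
  rw [map_add, map_smul, map_smul] at ex eN
  rw [h.d2_nbi_fst hp, along_along h.smooth_x h.smooth₁ h.isOpen hp,
    along_along h.smooth_N h.smooth₁ h.isOpen hp]
  rw [show along e₁ N p = fderiv ℝ N p (e₁ p) from rfl,
    show along e₂ N p = fderiv ℝ N p (e₂ p) from rfl, ← eN]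
  congr 1
  · rw [eq_sub_iff_add_eq]
    exact congrArg _ ex.symm
  · rw [add_sub_cancel_right]

theorem ip6_d2_e₁_e₁ (h : MovingFrame W x N e₁ e₂) (hp : p ∈ W) (t : ℝ) :
    ip6 (d2 (nbi x N) (p, t) (e₁ p, 0) (e₁ p, 0)) (Jc (fderiv ℝ (nbi x N) (p, t) (e₁ p, 0))) =
      t * (2 * geo x e₁ e₂ p * sff x N e₁ e₂ p - along e₁ (sff x N e₁ e₁) p) := by
  obtain ⟨α, β, hαβ⟩ := h.d2_nbi_e₁ hp t
  rw [hαβ, h.fderiv_nbi_e₁ hp, h.along_along_N hp, h.along₁_E₁ hp, h.along₁_E₂ hp,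
    h.along₁_N hp, h.along₂_N hp]
  simp only [ip6, Jc, inner_add_left, inner_add_right, inner_sub_left, inner_neg_right,
    real_inner_smul_left, real_inner_smul_right, h.unit₁ p hp, h.unit₂ p hp, 
    h.orth p hp, h.orth' hp, h.normal_right hp]
  ring

theorem ip6_d2_e₁_e₂ (h : MovingFrame W x N e₁ e₂) (hp : p ∈ W) (t : ℝ) :
    ip6 (d2 (nbi x N) (p, t) (e₁ p, 0) (e₁ p, 0)) (Jc (fderiv ℝ (nbi x N) (p, t) (e₂ p, 0))) =
      t * (geo x e₁ e₂ p * (sff x N e₂ e₂ p - sff x N e₁ e₁ p)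
        - along e₁ (sff x N e₁ e₂) p) := by
  obtain ⟨α, β, hαβ⟩ := h.d2_nbi_e₁ hp t
  rw [hαβ, h.swap.fderiv_nbi_e₁ hp, h.along_along_N hp, h.along₁_E₁ hp, h.along₁_E₂ hp,
    h.along₁_N hp, h.along₂_N hp]
  simp only [ip6, Jc, inner_add_left, inner_add_right, inner_sub_left, inner_neg_right,
    real_inner_smul_left, real_inner_smul_right, h.unit₁ p hp, h.unit₂ p hp, 
    h.orth p hp, h.orth' hp, h.normal_right hp]
  ring

theorem ip6_d2_e₁_t (h : MovingFrame W x N e₁ e₂) (hp : p ∈ W) (t : ℝ) :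
    ip6 (d2 (nbi x N) (p, t) (e₁ p, 0) (e₁ p, 0)) (Jc (fderiv ℝ (nbi x N) (p, t) (0, 1))) =
      -sff x N e₁ e₁ p := by
  obtain ⟨α, β, hαβ⟩ := h.d2_nbi_e₁ hp t
  rw [hαβ, h.fderiv_nbi_t hp, h.along₁_E₁ hp]
  simp only [ip6, Jc, inner_add_left, inner_sub_left, inner_neg_right, inner_zero_right,
    real_inner_smul_left, h.unit_N p hp, h.normal_left hp]
  ring

theorem along_sff_comm (h : MovingFrame W x N e₁ e₂) (hp : p ∈ W) (e : ℝ × ℝ → ℝ × ℝ) :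
    along e (sff x N e₂ e₁) p = along e (sff x N e₁ e₂) p :=
  along_congr h.isOpen (fun _ hp => h.sff_comm hp _ _) hp

/-- The normal bundle immersion of a minimal surface is a minimal immersion. -/
theorem Jc_meanCurv_eq_zero_of_minimal (h : MovingFrame W x N e₁ e₂) (hp : p ∈ W)
    (hmin : ∀ p ∈ W, sff x N e₁ e₁ p + sff x N e₂ e₂ p = 0) {t : ℝ} {Hq : V6} {Vq : W3}
    (hH : IsMeanCurvAt (nbi x N) (p, t) Hq) (hV : fderiv ℝ (nbi x N) (p, t) Vq = Jc Hq) :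
    Jc Hq = 0 := by
  have hm : sff x N e₁ e₂ p * (sff x N e₁ e₁ p + sff x N e₂ e₂ p) = 0 := by
    rw [hmin p hp, mul_zero]
  have hn : sff x N e₂ e₂ p = -sff x N e₁ e₁ p := by linarith [hmin p hp]
  have hAB : nbiNormSq x N e₂ e₁ p t = nbiNormSq x N e₁ e₂ p t := by
    simp only [nbiNormSq, hn, h.sff_comm hp e₂ e₁]
    ring
  have hd : ∀ e, along e (sff x N e₂ e₂) p = -along e (sff x N e₁ e₁) p := by
    intro e
    have := along_eq_zero_of_const (e := e) h.isOpen hmin hp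
    rw [along_add (h.diff hp h.smooth_sff₁₁) (h.diff hp h.smooth_sff₂₂)] at this
    linarith
  have c1 := h.codazzi₁ hp
  have c2 := h.codazzi₂ hp
  have z1 : ip6 (Jc Hq) (fderiv ℝ (nbi x N) (p, t) (e₁ p, 0)) = 0 := by
    rw [h.ip6_Jc_meanCurv hp hm hH, hAB, ← add_div, h.ip6_d2_e₁_e₁ hp, h.swap.ip6_d2_e₁_e₂ hp,
      h.along_sff_comm hp, neg_eq_zero, div_eq_zero_iff]
    left
    rw [hd] at c2
    linear_combination t * c2
  have z2 : ip6 (Jc Hq) (fderiv ℝ (nbi x N) (p, t) (e₂ p, 0)) = 0 := by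
    rw [h.ip6_Jc_meanCurv hp hm hH, hAB, ← add_div, h.ip6_d2_e₁_e₂ hp, h.swap.ip6_d2_e₁_e₁ hp,
      hd, h.sff_comm hp e₂ e₁, neg_eq_zero, div_eq_zero_iff]
    left
    linear_combination t * c1
  have z3 : ip6 (Jc Hq) (fderiv ℝ (nbi x N) (p, t) (0, 1)) = 0 := by
    rw [h.ip6_Jc_meanCurv hp hm hH, hAB, ← add_div, h.ip6_d2_e₁_t hp, h.swap.ip6_d2_e₁_t hp, hn]
    simp
  apply ip6_self_eq_zero
  obtain ⟨v, s⟩ := Vq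
  obtain ⟨α, β, hv⟩ : ∃ α β : ℝ, v = α • e₁ p + β • e₂ p := ⟨_, _, h.expand_vector hp v⟩
  have : ((v, s) : W3) = α • (e₁ p, 0) + β • (e₂ p, 0) + s • (0, 1) := by
    rw [hv]
    ext <;> simp
  have e : ip6 (Jc Hq) (fderiv ℝ (nbi x N) (p, t) (v, s)) = 0 := by
    rw [this, map_add, map_add, map_smul, map_smul, map_smul, ip6_add_right,
      ip6_add_right, ip6_smul_right, ip6_smul_right, ip6_smul_right, z1, z2, z3]
    ring
  rwa [hV] at e

end MovingFrame

theorem along_ip6 {e : ℝ × ℝ → ℝ × ℝ} {p : ℝ × ℝ} {f g : ℝ × ℝ → V6}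
    (hf : DifferentiableAt ℝ f p) (hg : DifferentiableAt ℝ g p) :
    along e (fun p => ip6 (f p) (g p)) p = ip6 (along e f p) (g p) + ip6 (f p) (along e g p) := by
  have h := ((hf.fst.hasFDerivAt.inner ℝ hg.fst.hasFDerivAt).add
    (hf.snd.hasFDerivAt.inner ℝ hg.snd.hasFDerivAt)).fderiv
  have e1 : fderiv ℝ (fun p => ip6 (f p) (g p)) p = _ := h
  simp only [along, e1, fderiv.fst hf, fderiv.snd hf, fderiv.fst hg, fderiv.snd hg]
  simp [ip6]
  ring

theorem hasDerivAt_along {F : Type*} [NormedAddCommGroup F] [NormedSpace ℝ F]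
    {e : ℝ × ℝ → ℝ × ℝ} {p : ℝ × ℝ} {g : ℝ × ℝ → F} (hg : DifferentiableAt ℝ g p) :
    HasDerivAt (fun s : ℝ => g (p + s • e p)) (along e g p) 0 := by
  have h1 : HasDerivAt (fun s : ℝ => p + s • e p) (e p) 0 := by
    simpa using ((hasDerivAt_id (0 : ℝ)).smul_const (e p)).const_add p
  have h2 : HasFDerivAt g (fderiv ℝ g p) (p + (0 : ℝ) • e p) := by simpa using hg.hasFDerivAt
  exact h2.comp_hasDerivAt 0 h1

theorem DifferentiableAt.div_one_add_sq {p : ℝ × ℝ} {f a : ℝ × ℝ → ℝ} (t : ℝ)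
    (hf : DifferentiableAt ℝ f p) (ha : DifferentiableAt ℝ a p) :
    DifferentiableAt ℝ (fun p => f p / (1 + t ^ 2 * a p ^ 2)) p := by
  have h0 : 1 + t ^ 2 * a p ^ 2 ≠ 0 := by positivity
  fun_prop (disch := assumption)

theorem along_div_one_add_sq {e : ℝ × ℝ → ℝ × ℝ} {p : ℝ × ℝ} {f a : ℝ × ℝ → ℝ} (t : ℝ)
    (hf : DifferentiableAt ℝ f p) (ha : DifferentiableAt ℝ a p) :
    along e (fun p => f p / (1 + t ^ 2 * a p ^ 2)) p =
      along e f p / (1 + t ^ 2 * a p ^ 2)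
        - 2 * t ^ 2 * a p * along e a p * f p / (1 + t ^ 2 * a p ^ 2) ^ 2 := by
  have h0 : ∀ p, 1 + t ^ 2 * a p ^ 2 ≠ 0 := fun p => by positivity
  have h1 := (hasDerivAt_along (e := e) hf).fun_div
    ((((hasDerivAt_along (e := e) ha).fun_pow 2).const_mul (t ^ 2)).const_add 1) (h0 _)
  rw [(hasDerivAt_along (hf.div_one_add_sq t ha)).unique h1]
  have h0' := h0 p
  simp only [zero_smul, add_zero]
  field_simp
  push_cast
  ring

namespace MovingFrame

variable {W : Set (ℝ × ℝ)} {x N : ℝ × ℝ → E3} {e₁ e₂ : ℝ × ℝ → ℝ × ℝ} {p : ℝ × ℝ}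
  {H : W3 → V6} {V : W3 → W3}

/-- The tangential component of `Jc H` along the first leg of a principal frame. -/
def coeff (x N : ℝ × ℝ → E3) (e₁ e₂ : ℝ × ℝ → ℝ × ℝ) (q : W3) : ℝ :=
  q.2 * (along e₁ (sff x N e₁ e₁) q.1 / (1 + q.2 ^ 2 * sff x N e₁ e₁ q.1 ^ 2) +
    along e₁ (sff x N e₂ e₂) q.1 / (1 + q.2 ^ 2 * sff x N e₂ e₂ q.1 ^ 2)) /
      (1 + q.2 ^ 2 * sff x N e₁ e₁ q.1 ^ 2)

/-- The normal component of `Jc H` in a principal frame. -/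
def coeffN (x N : ℝ × ℝ → E3) (e₁ e₂ : ℝ × ℝ → ℝ × ℝ) (q : W3) : ℝ :=
  sff x N e₁ e₁ q.1 / (1 + q.2 ^ 2 * sff x N e₁ e₁ q.1 ^ 2) +
    sff x N e₂ e₂ q.1 / (1 + q.2 ^ 2 * sff x N e₂ e₂ q.1 ^ 2)

theorem nbiNormSq_eq (hm : sff x N e₁ e₂ p = 0) (t : ℝ) :
    nbiNormSq x N e₁ e₂ p t = 1 + t ^ 2 * sff x N e₁ e₁ p ^ 2 := by
  simp [nbiNormSq, hm]

theorem ip6_Jc_meanCurv_e₁ (h : MovingFrame W x N e₁ e₂) (hp : p ∈ W)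
    (hm : ∀ p ∈ W, sff x N e₁ e₂ p = 0) {t : ℝ} {Hq : V6}
    (hH : IsMeanCurvAt (nbi x N) (p, t) Hq) :
    ip6 (Jc Hq) (fderiv ℝ (nbi x N) (p, t) (e₁ p, 0)) =
      coeff x N e₁ e₂ (p, t) * (1 + t ^ 2 * sff x N e₁ e₁ p ^ 2) := by
  have hm' : sff x N e₂ e₁ p = 0 := by rw [h.sff_comm hp, hm p hp]
  have h0 : 1 + t ^ 2 * sff x N e₁ e₁ p ^ 2 ≠ 0 := by positivity
  have c2 := h.codazzi₂ hp
  rw [h.ip6_Jc_meanCurv hp (by rw [hm p hp, zero_mul]) hH, h.ip6_d2_e₁_e₁ hp,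
    h.swap.ip6_d2_e₁_e₂ hp, nbiNormSq_eq (hm p hp), nbiNormSq_eq hm', hm p hp,
    h.along_sff_comm hp]
  rw [along_eq_zero_of_const h.isOpen hm hp, hm p hp] at *
  rw [coeff, div_mul_cancel₀ _ h0]
  have : along e₁ (sff x N e₂ e₂) p = geo x e₂ e₁ p * (sff x N e₂ e₂ p - sff x N e₁ e₁ p) := by
    linarith
  rw [this]
  ring

theorem ip6_Jc_meanCurv_t (h : MovingFrame W x N e₁ e₂) (hp : p ∈ W)
    (hm : ∀ p ∈ W, sff x N e₁ e₂ p = 0) {t : ℝ} {Hq : V6}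
    (hH : IsMeanCurvAt (nbi x N) (p, t) Hq) :
    ip6 (Jc Hq) (fderiv ℝ (nbi x N) (p, t) (0, 1)) = coeffN x N e₁ e₂ (p, t) := by
  have hm' : sff x N e₂ e₁ p = 0 := by rw [h.sff_comm hp, hm p hp]
  rw [h.ip6_Jc_meanCurv hp (by rw [hm p hp, zero_mul]) hH, h.ip6_d2_e₁_t hp,
    h.swap.ip6_d2_e₁_t hp, nbiNormSq_eq (hm p hp), nbiNormSq_eq hm', coeffN]
  ring

theorem coeffN_swap (q : W3) : coeffN x N e₂ e₁ q = coeffN x N e₁ e₂ q := by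
  rw [coeffN, coeffN, add_comm]

theorem Jc_meanCurv_eq (h : MovingFrame W x N e₁ e₂) (hp : p ∈ W)
    (hm : ∀ p ∈ W, sff x N e₁ e₂ p = 0) {t : ℝ} {Hq : V6} {Vq : W3}
    (hH : IsMeanCurvAt (nbi x N) (p, t) Hq) (hV : fderiv ℝ (nbi x N) (p, t) Vq = Jc Hq) :
    Jc Hq = coeff x N e₁ e₂ (p, t) • fderiv ℝ (nbi x N) (p, t) (e₁ p, 0) +
      coeff x N e₂ e₁ (p, t) • fderiv ℝ (nbi x N) (p, t) (e₂ p, 0) +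
      coeffN x N e₁ e₂ (p, t) • fderiv ℝ (nbi x N) (p, t) (0, 1) := by
  have hm' : ∀ p ∈ W, sff x N e₂ e₁ p = 0 := fun p hp => by rw [h.sff_comm hp, hm p hp]
  have h1 : 1 + t ^ 2 * sff x N e₁ e₁ p ^ 2 ≠ 0 := by positivity
  have h2 : 1 + t ^ 2 * sff x N e₂ e₂ p ^ 2 ≠ 0 := by positivity
  obtain ⟨v, s⟩ := Vq
  obtain ⟨α, β, hv⟩ : ∃ α β : ℝ, v = α • e₁ p + β • e₂ p := ⟨_, _, h.expand_vector hp v⟩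
  have : ((v, s) : W3) = α • (e₁ p, 0) + β • (e₂ p, 0) + s • (0, 1) := by
    rw [hv]
    ext <;> simp
  rw [this, map_add, map_add, map_smul, map_smul, map_smul] at hV
  have k1 := h.ip6_Jc_meanCurv_e₁ hp hm hH
  have k2 := h.swap.ip6_Jc_meanCurv_e₁ hp hm' hH
  have k3 := h.ip6_Jc_meanCurv_t hp hm hH
  rw [← hV] at k1 k2 k3
  simp only [ip6_add_left, ip6_smul_left, h.ip6_e₁_e₁ hp, h.swap.ip6_e₁_e₁ hp, h.ip6_e₁_e₂ hp,
    h.swap.ip6_e₁_e₂ hp, h.ip6_e₁_t hp, h.swap.ip6_e₁_t hp, h.ip6_t_t hp, hm p hp, hm' p hp,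
    nbiNormSq, ip6_comm (fderiv ℝ (nbi x N) (p, t) (0, 1))] at k1 k2 k3
  have l1 : coeff x N e₁ e₂ (p, t) = α := by
    apply mul_right_cancel₀ h1
    linarith
  have l2 : coeff x N e₂ e₁ (p, t) = β := by
    apply mul_right_cancel₀ h2
    linarith
  have l3 : coeffN x N e₁ e₂ (p, t) = s := by linarith
  rw [l1, l2, l3, hV]

theorem smooth_coeff (h : MovingFrame W x N e₁ e₂) :
    ContDiffOn ℝ ∞ (coeff x N e₁ e₂) (W ×ˢ (Set.univ : Set ℝ)) := by
  have hf : ∀ {g : ℝ × ℝ → ℝ}, ContDiffOn ℝ ∞ g W →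
      ContDiffOn ℝ ∞ (fun q : W3 => g q.1) (W ×ˢ (Set.univ : Set ℝ)) := fun hg =>
    hg.comp contDiffOn_fst fun q hq => hq.1
  have h1 := hf h.smooth_sff₁₁
  have h2 := hf h.smooth_sff₂₂
  have h3 := hf (h.smooth_along h.smooth_sff₁₁)
  have h4 := hf (h.smooth_along h.smooth_sff₂₂)
  have ht : ContDiffOn ℝ ∞ (fun q : W3 => q.2) (W ×ˢ (Set.univ : Set ℝ)) := contDiffOn_snd
  have hA := contDiffOn_const (c := (1 : ℝ)).add ((ht.pow 2).mul (h1.pow 2))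
  have hB := contDiffOn_const (c := (1 : ℝ)).add ((ht.pow 2).mul (h2.pow 2))
  have zA : ∀ q ∈ W ×ˢ (Set.univ : Set ℝ), 1 + q.2 ^ 2 * sff x N e₁ e₁ q.1 ^ 2 ≠ 0 :=
    fun q _ => by positivity
  have zB : ∀ q ∈ W ×ˢ (Set.univ : Set ℝ), 1 + q.2 ^ 2 * sff x N e₂ e₂ q.1 ^ 2 ≠ 0 :=
    fun q _ => by positivity
  exact (ht.mul ((h3.div hA zA).add (h4.div hB zB))).div hA zA

theorem smooth_coeffN (h : MovingFrame W x N e₁ e₂) :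
    ContDiffOn ℝ ∞ (coeffN x N e₁ e₂) (W ×ˢ (Set.univ : Set ℝ)) := by
  have hf : ∀ {g : ℝ × ℝ → ℝ}, ContDiffOn ℝ ∞ g W →
      ContDiffOn ℝ ∞ (fun q : W3 => g q.1) (W ×ˢ (Set.univ : Set ℝ)) := fun hg =>
    hg.comp contDiffOn_fst fun q hq => hq.1
  have h1 := hf h.smooth_sff₁₁
  have h2 := hf h.smooth_sff₂₂
  have ht : ContDiffOn ℝ ∞ (fun q : W3 => q.2) (W ×ˢ (Set.univ : Set ℝ)) := contDiffOn_snd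
  have hA := contDiffOn_const (c := (1 : ℝ)).add ((ht.pow 2).mul (h1.pow 2))
  have hB := contDiffOn_const (c := (1 : ℝ)).add ((ht.pow 2).mul (h2.pow 2))
  exact (h1.div hA fun q _ => by positivity).add (h2.div hB fun q _ => by positivity)

theorem smooth_leg (h : MovingFrame W x N e₁ e₂) :
    ContDiffOn ℝ ∞ (fun q : W3 => fderiv ℝ (nbi x N) q (e₁ q.1, 0)) (W ×ˢ (Set.univ : Set ℝ)) :=
  (h.smooth_nbi.fderiv_infty h.isOpen_prod).clm_apply
    ((h.smooth₁.comp contDiffOn_fst fun _ hq => hq.1).prodMk contDiffOn_const)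

theorem smooth_Jc_meanCurv (h : MovingFrame W x N e₁ e₂) (hm : ∀ p ∈ W, sff x N e₁ e₂ p = 0)
    (hH : ∀ q : W3, q.1 ∈ W → IsMeanCurvAt (nbi x N) q (H q))
    (hV : ∀ q : W3, q.1 ∈ W → fderiv ℝ (nbi x N) q (V q) = Jc (H q)) :
    ContDiffOn ℝ ∞ (fun q => fderiv ℝ (nbi x N) q (V q)) (W ×ˢ (Set.univ : Set ℝ)) := by
  have h3 : ContDiffOn ℝ ∞ (fun q : W3 => fderiv ℝ (nbi x N) q (0, 1))
      (W ×ˢ (Set.univ : Set ℝ)) :=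
    (h.smooth_nbi.fderiv_infty h.isOpen_prod).clm_apply contDiffOn_const
  refine (((h.smooth_coeff.smul h.smooth_leg).add (h.swap.smooth_coeff.smul h.swap.smooth_leg)).add
    (h.smooth_coeffN.smul h3)).congr ?_
  rintro ⟨p, t⟩ hq
  rw [hV _ hq.1, h.Jc_meanCurv_eq hq.1 hm (hH _ hq.1) (hV _ hq.1)]
  rfl

/-- The contribution of the first leg of a principal frame to the divergence. -/
theorem divergence_e₁ (h : MovingFrame W x N e₁ e₂) (hm : ∀ p ∈ W, sff x N e₁ e₂ p = 0)
    (hH : ∀ q : W3, q.1 ∈ W → IsMeanCurvAt (nbi x N) q (H q))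
    (hV : ∀ q : W3, q.1 ∈ W → fderiv ℝ (nbi x N) q (V q) = Jc (H q)) (hp : p ∈ W) (t : ℝ) :
    ip6 (fderiv ℝ (fun y => fderiv ℝ (nbi x N) y (V y)) (p, t) (e₁ p, 0))
      (fderiv ℝ (nbi x N) (p, t) (e₁ p, 0)) =
    along e₁ (fun p => coeff x N e₁ e₂ (p, t) * (1 + t ^ 2 * sff x N e₁ e₁ p ^ 2)) p
      - coeff x N e₁ e₂ (p, t) * (t ^ 2 * sff x N e₁ e₁ p * along e₁ (sff x N e₁ e₁) p)
      - coeff x N e₂ e₁ (p, t) *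
        (geo x e₁ e₂ p * (1 + t ^ 2 * sff x N e₁ e₁ p * sff x N e₂ e₂ p))
      + coeffN x N e₁ e₂ (p, t) * (t * sff x N e₁ e₁ p ^ 2) := by
  have hY := h.smooth_Jc_meanCurv hm hH hV
  have dY := hY.differentiableAt_of_isOpen h.isOpen_prod (p := (p, t)) ⟨hp, trivial⟩
  have hι : HasFDerivAt (fun p' : ℝ × ℝ => (p', t)) (ContinuousLinearMap.inl ℝ (ℝ × ℝ) ℝ) p :=
    hasFDerivAt_prodMk_left p t
  have dYt : DifferentiableAt ℝ (fun p' => fderiv ℝ (nbi x N) (p', t) (V (p', t))) p :=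
    DifferentiableAt.comp (g := fun q : W3 => fderiv ℝ (nbi x N) q (V q)) p dY
      hι.differentiableAt
  have dE := h.diff hp h.smooth_E₁
  have dN : DifferentiableAt ℝ (fun p' => t • along e₁ N p') p :=
    (h.diff hp h.smooth_N₁).fun_const_smul t
  have dF : DifferentiableAt ℝ (fun p' => ((along e₁ x p', t • along e₁ N p') : V6)) p :=
    dE.prodMk dN
  have hDF : along e₁ (fun p' => ((along e₁ x p', t • along e₁ N p') : V6)) p =
      (along e₁ (along e₁ x) p, t • along e₁ (along e₁ N) p) := by
    have := (dE.hasFDerivAt.prodMk dN.hasFDerivAt).fderiv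
    rw [along, this, fderiv_fun_const_smul (h.diff hp h.smooth_N₁)]
    rfl
  have key := along_ip6 (e := e₁) dYt dF
  rw [along_congr (g' := fun p => coeff x N e₁ e₂ (p, t) * (1 + t ^ 2 * sff x N e₁ e₁ p ^ 2))
    h.isOpen (fun p' hp' => by
      have := h.ip6_Jc_meanCurv_e₁ hp' hm (hH (p', t) hp')
      rwa [h.fderiv_nbi_e₁ hp', ← hV (p', t) hp'] at this)
    hp, hDF, hV (p, t) hp, h.Jc_meanCurv_eq hp hm (hH _ hp) (hV _ hp)] at key
  rw [fderiv_apply_fst dY, h.fderiv_nbi_e₁ hp, key]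
  change ip6 (along e₁ (fun p' => fderiv ℝ (nbi x N) (p', t) (V (p', t))) p) _ = _
  have hY : ip6 (coeff x N e₁ e₂ (p, t) • fderiv ℝ (nbi x N) (p, t) (e₁ p, 0) +
      coeff x N e₂ e₁ (p, t) • fderiv ℝ (nbi x N) (p, t) (e₂ p, 0) +
      coeffN x N e₁ e₂ (p, t) • fderiv ℝ (nbi x N) (p, t) (0, 1))
      (along e₁ (along e₁ x) p, t • along e₁ (along e₁ N) p) =
      coeff x N e₁ e₂ (p, t) * (t ^ 2 * sff x N e₁ e₁ p * along e₁ (sff x N e₁ e₁) p)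
      + coeff x N e₂ e₁ (p, t) *
        (geo x e₁ e₂ p * (1 + t ^ 2 * sff x N e₁ e₁ p * sff x N e₂ e₂ p))
      - coeffN x N e₁ e₂ (p, t) * (t * sff x N e₁ e₁ p ^ 2) := by
    rw [h.fderiv_nbi_e₁ hp, h.swap.fderiv_nbi_e₁ hp,
      h.fderiv_nbi_t hp, h.along_along_N hp, h.along₁_E₁ hp, h.along₁_E₂ hp, h.along₁_N hp,
      h.along₂_N hp, along_eq_zero_of_const h.isOpen hm hp, hm p hp]
    simp only [ip6, inner_add_left, inner_add_right,
      Prod.fst_add, Prod.snd_add, Prod.smul_fst, Prod.smul_snd, real_inner_smul_left,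
      real_inner_smul_right, h.unit₁ p hp, h.unit₂ p hp, h.unit_N p hp, h.orth p hp,
      h.orth' hp, h.normal_left hp, h.normal_right hp, inner_zero_left]
    ring
  rw [hY] at key
  linarith

theorem along_coeff (h : MovingFrame W x N e₁ e₂) (hp : p ∈ W) (t : ℝ) :
    along e₁ (fun p => coeff x N e₁ e₂ (p, t) * (1 + t ^ 2 * sff x N e₁ e₁ p ^ 2)) p =
      t * (along e₁ (along e₁ (sff x N e₁ e₁)) p / (1 + t ^ 2 * sff x N e₁ e₁ p ^ 2)
        - 2 * t ^ 2 * sff x N e₁ e₁ p * along e₁ (sff x N e₁ e₁) p ^ 2 /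
          (1 + t ^ 2 * sff x N e₁ e₁ p ^ 2) ^ 2
        + along e₁ (along e₁ (sff x N e₂ e₂)) p / (1 + t ^ 2 * sff x N e₂ e₂ p ^ 2)
        - 2 * t ^ 2 * sff x N e₂ e₂ p * along e₁ (sff x N e₂ e₂) p ^ 2 /
          (1 + t ^ 2 * sff x N e₂ e₂ p ^ 2) ^ 2) := by
  have d1 := h.diff hp h.smooth_sff₁₁
  have d2 := h.diff hp h.smooth_sff₂₂
  have d3 := h.diff hp (h.smooth_along h.smooth_sff₁₁)
  have d4 := h.diff hp (h.smooth_along h.smooth_sff₂₂)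
  have d5 := d3.div_one_add_sq t d1
  have d6 := d4.div_one_add_sq t d2
  have e : (fun p => coeff x N e₁ e₂ (p, t) * (1 + t ^ 2 * sff x N e₁ e₁ p ^ 2)) =
      fun p => t • (along e₁ (sff x N e₁ e₁) p / (1 + t ^ 2 * sff x N e₁ e₁ p ^ 2) +
        along e₁ (sff x N e₂ e₂) p / (1 + t ^ 2 * sff x N e₂ e₂ p ^ 2)) := by
    funext p
    rw [coeff, div_mul_cancel₀ _ (by positivity), smul_eq_mul]
  rw [e, along_smul (c := fun _ => t) (differentiableAt_const t) (d5.fun_add d6), along_add d5 d6,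
    along_div_one_add_sq t d3 d1, along_div_one_add_sq t d4 d2]
  rw [show along e₁ (fun _ => t) p = 0 from along_eq_zero_of_const h.isOpen (fun _ _ => rfl) hp]
  simp only [smul_eq_mul]
  ring

theorem divergence_t (h : MovingFrame W x N e₁ e₂) (hm : ∀ p ∈ W, sff x N e₁ e₂ p = 0)
    (hH : ∀ q : W3, q.1 ∈ W → IsMeanCurvAt (nbi x N) q (H q))
    (hV : ∀ q : W3, q.1 ∈ W → fderiv ℝ (nbi x N) q (V q) = Jc (H q)) (hp : p ∈ W) (t : ℝ) :
    ip6 (fderiv ℝ (fun y => fderiv ℝ (nbi x N) y (V y)) (p, t) (0, 1))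
      (fderiv ℝ (nbi x N) (p, t) (0, 1)) =
    -(2 * t * sff x N e₁ e₁ p ^ 3) / (1 + t ^ 2 * sff x N e₁ e₁ p ^ 2) ^ 2
      - 2 * t * sff x N e₂ e₂ p ^ 3 / (1 + t ^ 2 * sff x N e₂ e₂ p ^ 2) ^ 2 := by
  have dY := (h.smooth_Jc_meanCurv hm hH hV).differentiableAt_of_isOpen h.isOpen_prod
    (p := (p, t)) ⟨hp, trivial⟩
  have hι : HasFDerivAt (fun t' : ℝ => (p, t')) (ContinuousLinearMap.inr ℝ (ℝ × ℝ) ℝ) t :=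
    hasFDerivAt_prodMk_right p t
  have dYt : DifferentiableAt ℝ (fun t' => fderiv ℝ (nbi x N) (p, t') (V (p, t'))) t :=
    DifferentiableAt.comp (g := fun q : W3 => fderiv ℝ (nbi x N) q (V q)) t dY
      hι.differentiableAt
  have h1 : HasDerivAt (fun t' => ip6 (fderiv ℝ (nbi x N) (p, t') (V (p, t'))) (0, N p))
      (ip6 (deriv (fun t' => fderiv ℝ (nbi x N) (p, t') (V (p, t'))) t) (0, N p)) t := by
    have := ((ip6ₗ.flip (0, N p)).toContinuousLinearMap.hasFDerivAt).comp_hasDerivAt t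
      dYt.hasDerivAt
    exact this
  have e : (fun t' => ip6 (fderiv ℝ (nbi x N) (p, t') (V (p, t'))) (0, N p)) =
      fun t' => coeffN x N e₁ e₂ (p, t') := by
    funext t'
    have := h.ip6_Jc_meanCurv_t hp hm (hH (p, t') hp)
    rwa [h.fderiv_nbi_t hp, ← hV (p, t') hp] at this
  rw [fderiv_apply_snd dY, h.fderiv_nbi_t hp]
  rw [e] at h1
  have hd : ∀ a : ℝ, HasDerivAt (fun t' : ℝ => a / (1 + t' ^ 2 * a ^ 2))
      (-(2 * t * a ^ 3) / (1 + t ^ 2 * a ^ 2) ^ 2) t := by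
    intro a
    have h0 : 1 + t ^ 2 * a ^ 2 ≠ 0 := by positivity
    have := (hasDerivAt_const t a).fun_div
      (((hasDerivAt_pow 2 t).mul_const (a ^ 2)).const_add 1) h0
    refine this.congr_deriv ?_
    push_cast
    ring
  rw [h1.unique ((hd (sff x N e₁ e₁ p)).add (hd (sff x N e₂ e₂ p)))]
  ring

/-- The divergence of `Jc H` in terms of principal curvatures. -/
theorem divergence_eq (h : MovingFrame W x N e₁ e₂) (hm : ∀ p ∈ W, sff x N e₁ e₂ p = 0)
    (hH : ∀ q : W3, q.1 ∈ W → IsMeanCurvAt (nbi x N) q (H q))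
    (hV : ∀ q : W3, q.1 ∈ W → fderiv ℝ (nbi x N) q (V q) = Jc (H q)) (hp : p ∈ W) {t : ℝ}
    {v₁ v₂ v₃ : W3} (hv : ONFrame (nbi x N) (p, t) v₁ v₂ v₃) :
    ip6 (fderiv ℝ (fun y => fderiv ℝ (nbi x N) y (V y)) (p, t) v₁)
        (fderiv ℝ (nbi x N) (p, t) v₁) +
      ip6 (fderiv ℝ (fun y => fderiv ℝ (nbi x N) y (V y)) (p, t) v₂)
        (fderiv ℝ (nbi x N) (p, t) v₂) +
      ip6 (fderiv ℝ (fun y => fderiv ℝ (nbi x N) y (V y)) (p, t) v₃)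
        (fderiv ℝ (nbi x N) (p, t) v₃) =
      divExpr (sff x N e₁ e₁ p) (sff x N e₂ e₂ p)
        (along e₁ (sff x N e₁ e₁) p) (along e₂ (sff x N e₁ e₁) p)
        (along e₁ (sff x N e₂ e₂) p) (along e₂ (sff x N e₂ e₂) p)
        (geo x e₁ e₂ p) (geo x e₂ e₁ p)
        (along e₁ (along e₁ (sff x N e₁ e₁)) p) (along e₂ (along e₂ (sff x N e₁ e₁)) p)
        (along e₁ (along e₁ (sff x N e₂ e₂)) p) (along e₂ (along e₂ (sff x N e₂ e₂)) p) t := by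
  have hm' : ∀ p ∈ W, sff x N e₂ e₁ p = 0 := fun p hp => by rw [h.sff_comm hp, hm p hp]
  have := h.sum_bilin hp (by rw [hm p hp, zero_mul]) hv
    (ip6ₗ.compl₁₂ (fderiv ℝ (fun y => fderiv ℝ (nbi x N) y (V y)) (p, t) : W3 →ₗ[ℝ] V6)
      (fderiv ℝ (nbi x N) (p, t) : W3 →ₗ[ℝ] V6))
  simp only [LinearMap.compl₁₂_apply, ip6ₗ_apply, ContinuousLinearMap.coe_coe] at this
  rw [this, h.divergence_e₁ hm hH hV hp, h.swap.divergence_e₁ hm' hH hV hp,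
    h.divergence_t hm hH hV hp, nbiNormSq_eq (hm p hp), nbiNormSq_eq (hm' p hp),
    h.along_coeff hp, h.swap.along_coeff hp, coeffN_swap, divExpr, coeff, coeff, coeffN]
  ring

end MovingFrame

namespace MovingFrame

variable {W W' : Set (ℝ × ℝ)} {x N : ℝ × ℝ → E3} {e₁ e₂ e₁' e₂' : ℝ × ℝ → ℝ × ℝ} {p : ℝ × ℝ}
  {H : W3 → V6} {V : W3 → W3}

theorem exists_of_surfaceData {U : Set (ℝ × ℝ)} (hS : SurfaceData U x N) :
    ∃ e₁ e₂, MovingFrame U x N e₁ e₂ := by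
  have hdx := hS.smooth_x.fderiv_infty hS.open_U
  have inj0 : ∀ p ∈ U, ∀ v, fderiv ℝ x p v = 0 → v = 0 := fun p hp v hv =>
    hS.immersion p hp (by rw [hv, map_zero])
  have hX : ∀ p ∈ U, ‖fderiv ℝ x p (1, 0)‖ ≠ 0 := fun p hp h0 => by
    simpa using inj0 p hp _ (norm_eq_zero.mp h0)
  have sX : ContDiffOn ℝ ∞ (fun p => fderiv ℝ x p (1, 0)) U := hdx.clm_apply contDiffOn_const
  let e₁ : ℝ × ℝ → ℝ × ℝ := fun p => ‖fderiv ℝ x p (1, 0)‖⁻¹ • (1, 0)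
  have s₁ : ContDiffOn ℝ ∞ e₁ U :=
    ((sX.norm ℝ fun p hp => norm_ne_zero_iff.mp (hX p hp)).inv hX).smul contDiffOn_const
  have u₁ : ∀ p ∈ U, ⟪along e₁ x p, along e₁ x p⟫_ℝ = 1 := fun p hp => by
    have := hX p hp
    have hE₁ : along e₁ x p = ‖fderiv ℝ x p (1, 0)‖⁻¹ • fderiv ℝ x p (1, 0) := by
      simp only [along, e₁, map_smul]
    rw [hE₁, real_inner_smul_left, real_inner_smul_right, real_inner_self_eq_norm_sq]
    field_simp
  have sE₁ : ContDiffOn ℝ ∞ (along e₁ x) U := hS.smooth_x.along s₁ hS.open_U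
  let f : ℝ × ℝ → ℝ × ℝ := fun p => (0, 1) - ⟪fderiv ℝ x p (0, 1), along e₁ x p⟫_ℝ • e₁ p
  have sf : ContDiffOn ℝ ∞ f U :=
    contDiffOn_const.sub (((hdx.clm_apply contDiffOn_const).inner ℝ sE₁).smul s₁)
  have sF : ContDiffOn ℝ ∞ (along f x) U := hS.smooth_x.along sf hS.open_U
  have hF : ∀ p ∈ U, ‖along f x p‖ ≠ 0 := fun p hp h0 => by
    simpa [f, e₁] using congrArg Prod.snd (inj0 p hp _ (norm_eq_zero.mp h0))
  let e₂ : ℝ × ℝ → ℝ × ℝ := fun p => ‖along f x p‖⁻¹ • f p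
  have hE₂ : ∀ p, along e₂ x p = ‖along f x p‖⁻¹ • along f x p := fun p => by
    simp only [along, e₂, map_smul]
  have hFe : ∀ p, along f x p =
      fderiv ℝ x p (0, 1) - ⟪fderiv ℝ x p (0, 1), along e₁ x p⟫_ℝ • along e₁ x p := fun p => by
    simp only [along, f, map_sub, map_smul]
  refine ⟨e₁, e₂, hS.open_U, hS.smooth_x, hS.smooth_N, s₁,
    ((sF.norm ℝ fun p hp => norm_ne_zero_iff.mp (hF p hp)).inv hF).smul sf, hS.immersion,
    fun p hp => by rw [real_inner_self_eq_norm_sq, hS.unit_N p hp, one_pow], hS.normal_N, u₁, ?_, ?_⟩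
  · intro p hp
    have := hF p hp
    rw [hE₂, real_inner_smul_left, real_inner_smul_right, real_inner_self_eq_norm_sq]
    field_simp
  · intro p hp
    rw [hE₂, real_inner_smul_right, real_inner_comm, hFe p, inner_sub_left, real_inner_smul_left, u₁ p hp]
    ring

/-- The trace of a bilinear form may be computed in any orthonormal basis. -/
theorem trace_eq_of_orthonormal (h : MovingFrame W x N e₁ e₂) (hp : p ∈ W) {v₁ v₂ : ℝ × ℝ}
    (h₁ : ⟪fderiv ℝ x p v₁, fderiv ℝ x p v₁⟫_ℝ = 1)
    (h₂ : ⟪fderiv ℝ x p v₂, fderiv ℝ x p v₂⟫_ℝ = 1)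
    (h₁₂ : ⟪fderiv ℝ x p v₁, fderiv ℝ x p v₂⟫_ℝ = 0) (B : ℝ × ℝ →ₗ[ℝ] ℝ × ℝ →ₗ[ℝ] ℝ) :
    B v₁ v₁ + B v₂ v₂ = B (e₁ p) (e₁ p) + B (e₂ p) (e₂ p) := by
  let g : ℝ × ℝ →ₗ[ℝ] ℝ × ℝ →ₗ[ℝ] ℝ := (innerₗ E3).compl₁₂ (fderiv ℝ x p : ℝ × ℝ →ₗ[ℝ] E3)
    (fderiv ℝ x p : ℝ × ℝ →ₗ[ℝ] E3)
  have key : ∀ {v₁ v₂ : ℝ × ℝ}, ⟪fderiv ℝ x p v₁, fderiv ℝ x p v₁⟫_ℝ = 1 →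
      ⟪fderiv ℝ x p v₂, fderiv ℝ x p v₂⟫_ℝ = 1 → ⟪fderiv ℝ x p v₁, fderiv ℝ x p v₂⟫_ℝ = 0 →
      ∀ i j : Fin 2, g (![v₁, v₂] i) (![v₁, v₂] j) = if i = j then 1 else 0 := by
    intro v₁ v₂ h₁ h₂ h₁₂ i j
    fin_cases i <;> fin_cases j
    exacts [h₁, h₁₂, (real_inner_comm _ _).trans h₁₂, h₂]
  have := sum_bilin_eq_of_orthonormal (by simp) (fun v w => real_inner_comm (fderiv ℝ x p w) (fderiv ℝ x p v)) B
    (key (h.unit₁ p hp) (h.unit₂ p hp) (h.orth p hp)) (key h₁ h₂ h₁₂)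
  simpa [Fin.sum_univ_two] using this

theorem trace_eq (h : MovingFrame W x N e₁ e₂) (h' : MovingFrame W' x N e₁' e₂') (hp : p ∈ W)
    (hp' : p ∈ W') (B : ℝ × ℝ →ₗ[ℝ] ℝ × ℝ →ₗ[ℝ] ℝ) :
    B (e₁' p) (e₁' p) + B (e₂' p) (e₂' p) = B (e₁ p) (e₁ p) + B (e₂ p) (e₂ p) :=
  h.trace_eq_of_orthonormal hp (h'.unit₁ p hp') (h'.unit₂ p hp') (h'.orth p hp') B

/-- Rotation of a moving frame. -/
theorem rotate (h : MovingFrame W x N e₁ e₂) {C S : ℝ × ℝ → ℝ} (hC : ContDiffOn ℝ ∞ C W)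
    (hS : ContDiffOn ℝ ∞ S W) (hCS : ∀ p ∈ W, C p ^ 2 + S p ^ 2 = 1) :
    MovingFrame W x N (fun p => C p • e₁ p + S p • e₂ p) (fun p => -S p • e₁ p + C p • e₂ p) where
  __ := h
  smooth₁ := (hC.smul h.smooth₁).add (hS.smul h.smooth₂)
  smooth₂ := (hS.neg.smul h.smooth₁).add (hC.smul h.smooth₂)
  unit₁ p hp := by
    have h1 := h.unit₁ p hp
    have h2 := h.unit₂ p hp
    have h3 := h.orth p hp
    have h4 := h.orth' hp
    simp only [along] at *
    simp only [map_add, map_smul, inner_add_left, inner_add_right, real_inner_smul_left,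
      real_inner_smul_right, h1, h2, h3, h4]
    linear_combination hCS p hp
  unit₂ p hp := by
    have h1 := h.unit₁ p hp
    have h2 := h.unit₂ p hp
    have h3 := h.orth p hp
    have h4 := h.orth' hp
    simp only [along] at *
    simp only [map_add, map_smul, inner_add_left, inner_add_right, real_inner_smul_left,
      real_inner_smul_right, h1, h2, h3, h4]
    linear_combination hCS p hp
  orth p hp := by
    have h1 := h.unit₁ p hp
    have h2 := h.unit₂ p hp
    have h3 := h.orth p hp
    have h4 := h.orth' hp
    simp only [along] at *
    simp only [map_add, map_smul, inner_add_left, inner_add_right, real_inner_smul_left,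
      real_inner_smul_right, h1, h2, h3, h4]
    ring

theorem sff_rotate (h : MovingFrame W x N e₁ e₂) (hp : p ∈ W) (C S : ℝ × ℝ → ℝ) :
    sff x N (fun p => C p • e₁ p + S p • e₂ p) (fun p => -S p • e₁ p + C p • e₂ p) p =
      C p * S p * (sff x N e₂ e₂ p - sff x N e₁ e₁ p) + (C p ^ 2 - S p ^ 2) * sff x N e₁ e₂ p := by
  have := h.sff_comm hp e₂ e₁
  simp only [sff, along] at *
  simp only [map_add, map_smul, inner_add_left, inner_add_right, real_inner_smul_left,
      real_inner_smul_right]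
  linear_combination -S p ^ 2 * this

/-- The discriminant of the shape operator; it vanishes exactly at the umbilics. -/
def disc (x N : ℝ × ℝ → E3) (e₁ e₂ : ℝ × ℝ → ℝ × ℝ) (p : ℝ × ℝ) : ℝ :=
  (sff x N e₁ e₁ p - sff x N e₂ e₂ p) ^ 2 + 4 * sff x N e₁ e₂ p ^ 2

/-- The trace of the shape operator. -/
def tr (x N : ℝ × ℝ → E3) (e₁ e₂ : ℝ × ℝ → ℝ × ℝ) (p : ℝ × ℝ) : ℝ :=
  sff x N e₁ e₁ p + sff x N e₂ e₂ p

theorem smooth_disc (h : MovingFrame W x N e₁ e₂) : ContDiffOn ℝ ∞ (disc x N e₁ e₂) W :=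
  ((h.smooth_sff₁₁.sub h.smooth_sff₂₂).pow 2).add
    (contDiffOn_const.mul (h.smooth_sff₁₂.pow 2))

theorem smooth_tr (h : MovingFrame W x N e₁ e₂) : ContDiffOn ℝ ∞ (tr x N e₁ e₂) W :=
  h.smooth_sff₁₁.add h.smooth_sff₂₂

theorem tr_eq (h : MovingFrame W x N e₁ e₂) (h' : MovingFrame W' x N e₁' e₂') (hp : p ∈ W)
    (hp' : p ∈ W') : tr x N e₁' e₂' p = tr x N e₁ e₂ p := by
  have := h.trace_eq h' hp hp' ((innerₗ E3).compl₁₂ (fderiv ℝ N p : ℝ × ℝ →ₗ[ℝ] E3)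
    (fderiv ℝ x p : ℝ × ℝ →ₗ[ℝ] E3))
  simp only [LinearMap.compl₁₂_apply, ContinuousLinearMap.coe_coe, innerₗ_apply_apply] at this
  simp only [tr, sff, along]
  linarith

theorem disc_eq (h : MovingFrame W x N e₁ e₂) (h' : MovingFrame W' x N e₁' e₂') (hp : p ∈ W)
    (hp' : p ∈ W') : disc x N e₁' e₂' p = disc x N e₁ e₂ p := by
  have ht := h.tr_eq h' hp hp'
  have := h.trace_eq h' hp hp' ((innerₗ E3).compl₁₂ (fderiv ℝ N p : ℝ × ℝ →ₗ[ℝ] E3)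
    (fderiv ℝ N p : ℝ × ℝ →ₗ[ℝ] E3))
  simp only [LinearMap.compl₁₂_apply, ContinuousLinearMap.coe_coe, innerₗ_apply_apply] at this
  have key : ∀ {W : Set (ℝ × ℝ)} {e₁ e₂ : ℝ × ℝ → ℝ × ℝ}, MovingFrame W x N e₁ e₂ → p ∈ W →
      ⟪fderiv ℝ N p (e₁ p), fderiv ℝ N p (e₁ p)⟫_ℝ + ⟪fderiv ℝ N p (e₂ p), fderiv ℝ N p (e₂ p)⟫_ℝ
        = (disc x N e₁ e₂ p + tr x N e₁ e₂ p ^ 2) / 2 := by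
    intro W e₁ e₂ h hp
    have e1 : fderiv ℝ N p (e₁ p) = _ := h.along₁_N hp
    have e2 : fderiv ℝ N p (e₂ p) = _ := h.along₂_N hp
    rw [e1, e2]
    simp only [inner_add_left, inner_add_right, real_inner_smul_left, real_inner_smul_right,
      h.unit₁ p hp, h.unit₂ p hp, h.orth p hp, h.orth' hp, disc, tr]
    ring
  rw [key h hp, key h' hp', ht] at this
  linarith

theorem disc_swap (h : MovingFrame W x N e₁ e₂) (hp : p ∈ W) :
    disc x N e₂ e₁ p = disc x N e₁ e₂ p := h.disc_eq h.swap hp hp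

/-- Principal frames exist near non-umbilic points. -/
theorem exists_principal (h : MovingFrame W x N e₁ e₂) (hp : p ∈ W)
    (hd : disc x N e₁ e₂ p ≠ 0) :
    ∃ W' e₁' e₂', W' ⊆ W ∧ p ∈ W' ∧ MovingFrame W' x N e₁' e₂' ∧
      ∀ p ∈ W', sff x N e₁' e₂' p = 0 := by
  wlog hl : sff x N e₂ e₂ p ≤ sff x N e₁ e₁ p generalizing e₁ e₂
  · exact this h.swap (by rwa [h.disc_swap hp]) (not_le.mp hl).le
  let k : ℝ × ℝ → ℝ := fun p =>
    sff x N e₁ e₁ p - sff x N e₂ e₂ p + √(disc x N e₁ e₂ p)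
  have hd0 : 0 < disc x N e₁ e₂ p := lt_of_le_of_ne (by unfold disc; positivity) hd.symm
  have hO : IsOpen {p ∈ W | 0 < disc x N e₁ e₂ p} :=
    h.smooth_disc.continuousOn.isOpen_inter_preimage h.isOpen isOpen_Ioi
  have h1 := h.mono hO fun p hp => hp.1
  have sk1 : ContDiffOn ℝ ∞ k {p ∈ W | 0 < disc x N e₁ e₂ p} :=
    (h1.smooth_sff₁₁.sub h1.smooth_sff₂₂).add (h1.smooth_disc.sqrt fun p hp => hp.2.ne')
  have hO2 : IsOpen {q ∈ {p ∈ W | 0 < disc x N e₁ e₂ p} | 0 < k q} :=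
    sk1.continuousOn.isOpen_inter_preimage hO isOpen_Ioi
  have h2 := h1.mono hO2 fun p hp => hp.1
  have sk := sk1.mono (fun p (hp : p ∈ {q ∈ {p ∈ W | 0 < disc x N e₁ e₂ p} | 0 < k q}) => hp.1)
  set W₂ := {q ∈ {p ∈ W | 0 < disc x N e₁ e₂ p} | 0 < k q} with hW₂
  let r : ℝ × ℝ → ℝ := fun p => √(k p ^ 2 + (2 * sff x N e₁ e₂ p) ^ 2)
  have hr0 : ∀ p ∈ W₂, 0 < k p ^ 2 + (2 * sff x N e₁ e₂ p) ^ 2 := fun p hp => by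
    have : 0 < k p := hp.2
    positivity
  have sm : ContDiffOn ℝ ∞ (fun p => 2 * sff x N e₁ e₂ p) W₂ :=
    contDiffOn_const.mul h2.smooth_sff₁₂
  have sr : ContDiffOn ℝ ∞ r W₂ :=
    ((sk.pow 2).add (sm.pow 2)).sqrt fun p hp => (hr0 p hp).ne'
  have hr : ∀ p ∈ W₂, r p ≠ 0 := fun p hp => (Real.sqrt_pos.mpr (hr0 p hp)).ne'
  have hr2 : ∀ p ∈ W₂, r p ^ 2 = k p ^ 2 + (2 * sff x N e₁ e₂ p) ^ 2 := fun p hp =>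
    Real.sq_sqrt (hr0 p hp).le
  have sC : ContDiffOn ℝ ∞ (fun p => k p / r p) W₂ := sk.div sr hr
  have sS : ContDiffOn ℝ ∞ (fun p => 2 * sff x N e₁ e₂ p / r p) W₂ := sm.div sr hr
  refine ⟨W₂, _, _, fun p hp => hp.1.1, ⟨⟨hp, hd0⟩, ?_⟩,
    h2.rotate sC sS fun p hp => ?_, fun p hp => ?_⟩
  · have := Real.sqrt_pos.mpr hd0
    simp only [k]
    linarith
  · have := hr p hp
    field_simp
    rw [hr2 p hp, mul_pow]
  · rw [h2.sff_rotate hp (fun p => k p / r p) (fun p => 2 * sff x N e₁ e₂ p / r p)]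
    have := hr p hp
    field_simp
    have hs := Real.sq_sqrt hp.1.2.le
    simp only [k]
    generalize √(disc x N e₁ e₂ p) = d at *
    rw [disc] at hs
    linear_combination (sff x N e₁ e₂ p) * hs

end MovingFrame

/-- In the principal frame `e₁, e₂` the divergence of the mean curvature field vanishes. -/
def StationaryOn (W : Set (ℝ × ℝ)) (x N : ℝ × ℝ → E3) (e₁ e₂ : ℝ × ℝ → ℝ × ℝ) : Prop :=
  ∀ p ∈ W, ∀ t, divExpr (sff x N e₁ e₁ p) (sff x N e₂ e₂ p)
    (along e₁ (sff x N e₁ e₁) p) (along e₂ (sff x N e₁ e₁) p)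
    (along e₁ (sff x N e₂ e₂) p) (along e₂ (sff x N e₂ e₂) p)
    (geo x e₁ e₂ p) (geo x e₂ e₁ p)
    (along e₁ (along e₁ (sff x N e₁ e₁)) p) (along e₂ (along e₂ (sff x N e₁ e₁)) p)
    (along e₁ (along e₁ (sff x N e₂ e₂)) p) (along e₂ (along e₂ (sff x N e₂ e₂)) p) t = 0

namespace StationaryOn

variable {W W' : Set (ℝ × ℝ)} {x N : ℝ × ℝ → E3} {e₁ e₂ : ℝ × ℝ → ℝ × ℝ} {p : ℝ × ℝ}

theorem swap (hD : StationaryOn W x N e₁ e₂) : StationaryOn W x N e₂ e₁ := fun p hp t => by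
  rw [divExpr_swap]
  exact hD p hp t

theorem mono (hD : StationaryOn W x N e₁ e₂) (hs : W' ⊆ W) : StationaryOn W' x N e₁ e₂ :=
  fun p hp => hD p (hs hp)

end StationaryOn

namespace MovingFrame

variable {W W' : Set (ℝ × ℝ)} {x N : ℝ × ℝ → E3} {e₁ e₂ : ℝ × ℝ → ℝ × ℝ} {p : ℝ × ℝ}

theorem along_sff_eq_zero_of_stationary (h : MovingFrame W x N e₁ e₂)
    (hD : StationaryOn W x N e₁ e₂) (hab : ∀ p ∈ W, sff x N e₁ e₁ p ^ 2 ≠ sff x N e₂ e₂ p ^ 2)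
    (hp : p ∈ W) : along e₁ (sff x N e₁ e₁) p = 0 := by
  by_contra h1
  have hO : IsOpen {p ∈ W | along e₁ (sff x N e₁ e₁) p ≠ 0} :=
    (h.smooth_along h.smooth_sff₁₁).continuousOn.isOpen_inter_preimage h.isOpen isOpen_ne
  refine h1 (along_eq_zero_of_const hO (c := 0) (fun p hp => ?_) ⟨hp, h1⟩)
  by_contra ha
  exact hp.2 (divExpr_pole_three (hD p hp.1) ha (hab p hp.1))

theorem principal_of_stationary (h : MovingFrame W x N e₁ e₂)
    (hm : ∀ p ∈ W, sff x N e₁ e₂ p = 0) (hD : StationaryOn W x N e₁ e₂)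
    (hab : ∀ p ∈ W, sff x N e₁ e₁ p ^ 2 ≠ sff x N e₂ e₂ p ^ 2) (hp : p ∈ W)
    (ha : sff x N e₁ e₁ p ≠ 0) :
    along e₂ (sff x N e₁ e₁) p ^ 2 =
      sff x N e₁ e₁ p ^ 2 * (sff x N e₁ e₁ p ^ 2 - sff x N e₂ e₂ p ^ 2) := by
  have h1 : ∀ p ∈ W, along e₁ (sff x N e₁ e₁) p = 0 := fun p hp =>
    h.along_sff_eq_zero_of_stationary hD hab hp
  have h2 : ∀ p ∈ W, along e₂ (sff x N e₂ e₂) p = 0 := fun p hp =>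
    h.swap.along_sff_eq_zero_of_stationary hD.swap (fun p hp => (hab p hp).symm) hp
  have h11 := along_eq_zero_of_const (e := e₁) h.isOpen h1 hp
  have h22 := along_eq_zero_of_const (e := e₂) h.isOpen h2 hp
  have hc := h.codazzi₁ hp
  rw [along_eq_zero_of_const h.isOpen hm hp, hm p hp] at hc
  have hD' := hD p hp
  rw [h1 p hp, h2 p hp, h11, h22] at hD'
  exact divExpr_pole_two hD' ha (hab p hp) (by linarith)

/-- A stationary principal frame with `a ≠ 0` and `a² ≠ b²` is flat. -/
theorem flat_of_stationary (h : MovingFrame W x N e₁ e₂)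
    (hm : ∀ p ∈ W, sff x N e₁ e₂ p = 0) (hD : StationaryOn W x N e₁ e₂)
    (hab : ∀ p ∈ W, sff x N e₁ e₁ p ^ 2 ≠ sff x N e₂ e₂ p ^ 2)
    (ha : ∀ p ∈ W, sff x N e₁ e₁ p ≠ 0) (hp : p ∈ W) :
    sff x N e₂ e₂ p = 0 ∧ along e₁ (sff x N e₁ e₁) p = 0 ∧
      along e₂ (sff x N e₁ e₁) p ^ 2 = sff x N e₁ e₁ p ^ 4 := by
  have h2 := h.principal_of_stationary hm hD hab hp (ha p hp)
  have hb : sff x N e₂ e₂ p = 0 := by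
    by_contra hb
    have h3 := h.swap.principal_of_stationary (fun p hp => by rw [h.sff_comm hp, hm p hp]) hD.swap
      (fun p hp => (hab p hp).symm) hp hb
    have ha2 : 0 < sff x N e₁ e₁ p ^ 2 := by have := ha p hp; positivity
    have hb2 : 0 < sff x N e₂ e₂ p ^ 2 := by positivity
    have h4 := nonneg_of_mul_nonneg_right (h2 ▸ sq_nonneg _) ha2
    have h5 := nonneg_of_mul_nonneg_right (h3 ▸ sq_nonneg _) hb2
    exact hab p hp (by linarith)
  refine ⟨hb, h.along_sff_eq_zero_of_stationary hD hab hp, ?_⟩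
  rw [h2, hb]
  ring

end MovingFrame

namespace MovingFrame

variable {U W W' : Set (ℝ × ℝ)} {x N : ℝ × ℝ → E3} {e₁ e₂ e₁' e₂' : ℝ × ℝ → ℝ × ℝ} {p : ℝ × ℝ}

/-- The principal curvatures of a stationary cone in the principal frame `e₁, e₂`. -/
def FlatOn (W : Set (ℝ × ℝ)) (x N : ℝ × ℝ → E3) (e₁ e₂ : ℝ × ℝ → ℝ × ℝ) : Prop :=
  ∀ p ∈ W, sff x N e₁ e₁ p ≠ 0 ∧ sff x N e₂ e₂ p = 0 ∧
    along e₁ (sff x N e₁ e₁) p = 0 ∧ along e₂ (sff x N e₁ e₁) p ^ 2 = sff x N e₁ e₁ p ^ 4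

theorem exists_flat_of_stationary (h : MovingFrame U x N e₁ e₂)
    (hst : ∀ {W : Set (ℝ × ℝ)} {e₁ e₂ : ℝ × ℝ → ℝ × ℝ}, W ⊆ U → MovingFrame W x N e₁ e₂ →
      (∀ p ∈ W, sff x N e₁ e₂ p = 0) → StationaryOn W x N e₁ e₂)
    (hp : p ∈ U) (ht : tr x N e₁ e₂ p ≠ 0) (hd : disc x N e₁ e₂ p ≠ 0) :
    ∃ W e₁' e₂', W ⊆ U ∧ p ∈ W ∧ MovingFrame W x N e₁' e₂' ∧
      (∀ p ∈ W, sff x N e₁' e₂' p = 0) ∧ FlatOn W x N e₁' e₂' := by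
  obtain ⟨W, f₁, f₂, hWU, hpW, hf, hm⟩ := h.exists_principal hp hd
  wlog ha : sff x N f₁ f₁ p ≠ 0 generalizing f₁ f₂
  · refine this f₂ f₁ hf.swap (fun p hp => by rw [hf.sff_comm hp, hm p hp]) fun hb => ht ?_
    rw [← h.tr_eq hf hp hpW, tr, hb, not_not.mp ha, add_zero]
  have hab : sff x N f₁ f₁ p ^ 2 - sff x N f₂ f₂ p ^ 2 ≠ 0 := by
    rw [← h.tr_eq hf hp hpW, tr] at ht
    rw [← h.disc_eq hf hp hpW, disc, hm p hpW] at hd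
    rw [sq_sub_sq]
    refine mul_ne_zero ht fun h0 => hd (by rw [h0]; ring)
  have hO : IsOpen {p ∈ W | sff x N f₁ f₁ p ≠ 0} :=
    hf.smooth_sff₁₁.continuousOn.isOpen_inter_preimage hf.isOpen isOpen_ne
  have hf1 := hf.mono hO fun p hp => hp.1
  have hO2 : IsOpen {q ∈ {p ∈ W | sff x N f₁ f₁ p ≠ 0} |
      sff x N f₁ f₁ q ^ 2 - sff x N f₂ f₂ q ^ 2 ≠ 0} :=
    ((hf1.smooth_sff₁₁.pow 2).sub (hf1.smooth_sff₂₂.pow 2)).continuousOn.isOpen_inter_preimage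
      hO isOpen_ne
  have hf2 := hf1.mono hO2 fun p hp => hp.1
  refine ⟨{q ∈ {p ∈ W | sff x N f₁ f₁ p ≠ 0} |
      sff x N f₁ f₁ q ^ 2 - sff x N f₂ f₂ q ^ 2 ≠ 0}, f₁, f₂, fun p hp => hWU hp.1.1, ⟨⟨hpW, ha⟩, hab⟩, hf2, fun p hp => hm p hp.1.1,
    fun p hp => ⟨hp.1.2, ?_⟩⟩
  exact hf2.flat_of_stationary (fun p hp => hm p hp.1.1)
    ((hst hWU hf hm).mono fun p hp => hp.1.1) (fun p hp => sub_ne_zero.mp hp.2)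
    (fun p hp => hp.1.2) hp

/-- The squared norm of the gradient of a function. -/
def gradSq (e₁ e₂ : ℝ × ℝ → ℝ × ℝ) (g : ℝ × ℝ → ℝ) (p : ℝ × ℝ) : ℝ :=
  along e₁ g p ^ 2 + along e₂ g p ^ 2

theorem gradSq_eq (h : MovingFrame W x N e₁ e₂) (h' : MovingFrame W' x N e₁' e₂') (hp : p ∈ W)
    (hp' : p ∈ W') {g g' : ℝ × ℝ → ℝ} (hg : ∀ p ∈ W', g' p = g p) :
    gradSq e₁' e₂' g' p = gradSq e₁ e₂ g p := by
  have := h.trace_eq h' hp hp' ((LinearMap.mul ℝ ℝ).compl₁₂ (fderiv ℝ g p : ℝ × ℝ →ₗ[ℝ] ℝ)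
    (fderiv ℝ g p : ℝ × ℝ →ₗ[ℝ] ℝ))
  simp only [LinearMap.compl₁₂_apply, ContinuousLinearMap.coe_coe, LinearMap.mul_apply'] at this
  rw [gradSq, along_congr h'.isOpen hg hp', along_congr h'.isOpen hg hp']
  simp only [gradSq, along]
  linarith

theorem disc_eq_of_flat (h : MovingFrame U x N e₁ e₂) (h' : MovingFrame W x N e₁' e₂')
    (hp : p ∈ U) (hp' : p ∈ W) (hm : sff x N e₁' e₂' p = 0) (hb : sff x N e₂' e₂' p = 0) :
    disc x N e₁ e₂ p = tr x N e₁ e₂ p ^ 2 := by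
  rw [← h.disc_eq h' hp hp', ← h.tr_eq h' hp hp', disc, tr, hm, hb]
  ring

theorem along_tr_eq_zero_of_umbilic (h : MovingFrame W x N e₁ e₂)
    (hd : ∀ p ∈ W, disc x N e₁ e₂ p = 0) (hp : p ∈ W) :
    along e₁ (tr x N e₁ e₂) p = 0 := by
  have hm : ∀ p ∈ W, sff x N e₁ e₂ p = 0 := fun p hp => by
    have := hd p hp
    rw [disc] at this
    nlinarith [sq_nonneg (sff x N e₁ e₁ p - sff x N e₂ e₂ p), sq_nonneg (sff x N e₁ e₂ p)]
  have hl : ∀ p ∈ W, sff x N e₂ e₂ p = sff x N e₁ e₁ p := fun p hp => by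
    have := hd p hp
    rw [disc, hm p hp] at this
    nlinarith [sq_nonneg (sff x N e₁ e₁ p - sff x N e₂ e₂ p)]
  have hc := h.codazzi₂ hp
  rw [along_eq_zero_of_const h.isOpen hm hp, hm p hp, along_congr h.isOpen hl hp, hl p hp] at hc
  have : along e₁ (tr x N e₁ e₂) p = along e₁ (sff x N e₁ e₁) p + along e₁ (sff x N e₂ e₂) p :=
    along_add (h.diff hp h.smooth_sff₁₁) (h.diff hp h.smooth_sff₂₂)
  rw [this, along_congr h.isOpen hl hp]
  linarith

theorem gradSq_tr_eq_zero_of_umbilic (h : MovingFrame W x N e₁ e₂)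
    (hd : ∀ p ∈ W, disc x N e₁ e₂ p = 0) (hp : p ∈ W) :
    gradSq e₁ e₂ (tr x N e₁ e₂) p = 0 := by
  have := h.swap.along_tr_eq_zero_of_umbilic (fun p hp => by rw [h.disc_swap hp, hd p hp]) hp
  rw [along_congr h.isOpen (fun p hp => h.tr_eq h.swap hp hp) hp] at this
  rw [gradSq, this, h.along_tr_eq_zero_of_umbilic hd hp]
  ring

theorem disc_eq_zero_or (h : MovingFrame U x N e₁ e₂)
    (hst : ∀ {W : Set (ℝ × ℝ)} {e₁ e₂ : ℝ × ℝ → ℝ × ℝ}, W ⊆ U → MovingFrame W x N e₁ e₂ →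
      (∀ p ∈ W, sff x N e₁ e₂ p = 0) → StationaryOn W x N e₁ e₂)
    (hp : p ∈ U) (ht : tr x N e₁ e₂ p ≠ 0) :
    disc x N e₁ e₂ p = 0 ∨ disc x N e₁ e₂ p = tr x N e₁ e₂ p ^ 2 := by
  by_contra! hc
  obtain ⟨W, f₁, f₂, -, hpW, hf, hm, hflat⟩ := h.exists_flat_of_stationary hst hp ht hc.1
  exact hc.2 (h.disc_eq_of_flat hf hp hpW (hm p hpW) (hflat p hpW).2.1)

theorem gradSq_tr_le (h : MovingFrame U x N e₁ e₂)
    (hst : ∀ {W : Set (ℝ × ℝ)} {e₁ e₂ : ℝ × ℝ → ℝ × ℝ}, W ⊆ U → MovingFrame W x N e₁ e₂ →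
      (∀ p ∈ W, sff x N e₁ e₂ p = 0) → StationaryOn W x N e₁ e₂) (hp : p ∈ U) :
    gradSq e₁ e₂ (tr x N e₁ e₂) p ≤ tr x N e₁ e₂ p ^ 4 := by
  have main : ∀ p ∈ U, tr x N e₁ e₂ p ≠ 0 →
      gradSq e₁ e₂ (tr x N e₁ e₂) p ≤ tr x N e₁ e₂ p ^ 4 := by
    intro p hp ht
    by_cases hd : disc x N e₁ e₂ p = 0
    · have hO : IsOpen {p ∈ U | tr x N e₁ e₂ p ≠ 0} :=
        h.smooth_tr.continuousOn.isOpen_inter_preimage h.isOpen isOpen_ne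
      have h1 := h.mono hO fun p hp => hp.1
      have hO2 : IsOpen {q ∈ {p ∈ U | tr x N e₁ e₂ p ≠ 0} |
          disc x N e₁ e₂ q - tr x N e₁ e₂ q ^ 2 ≠ 0} :=
        (h1.smooth_disc.sub (h1.smooth_tr.pow 2)).continuousOn.isOpen_inter_preimage hO isOpen_ne
      rw [(h1.mono hO2 fun p hp => hp.1).gradSq_tr_eq_zero_of_umbilic
        (fun q hq => (h.disc_eq_zero_or hst hq.1.1 hq.1.2).resolve_right (sub_ne_zero.mp hq.2))
        ⟨⟨hp, ht⟩, by simpa [hd] using ht⟩]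
      positivity
    · obtain ⟨W, f₁, f₂, hWU, hpW, hf, hm, hflat⟩ := h.exists_flat_of_stationary hst hp ht hd
      have htr : ∀ p ∈ W, sff x N f₁ f₁ p = tr x N e₁ e₂ p := fun p hp => by
        rw [← h.tr_eq hf (hWU hp) hp, tr, (hflat p hp).2.1, add_zero]
      rw [← h.gradSq_eq hf hp hpW htr, ← htr p hpW, gradSq, (hflat p hpW).2.2.1,
        (hflat p hpW).2.2.2]
      linarith
  by_contra! hlt
  let g : ℝ × ℝ → ℝ := fun p => gradSq e₁ e₂ (tr x N e₁ e₂) p - tr x N e₁ e₂ p ^ 4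
  have sg : ContDiffOn ℝ ∞ g U :=
    (((h.smooth_along h.smooth_tr).pow 2).add ((h.swap.smooth_along h.smooth_tr).pow 2)).sub
      (h.smooth_tr.pow 4)
  have hO : IsOpen {p ∈ U | 0 < g p} := sg.continuousOn.isOpen_inter_preimage h.isOpen isOpen_Ioi
  have h0 : ∀ p ∈ {p ∈ U | 0 < g p}, tr x N e₁ e₂ p = 0 := fun p hp => by
    by_contra ht
    have h1 := main p hp.1 ht
    have h2 : 0 < g p := hp.2
    simp only [g] at h2
    linarith
  have hpO : p ∈ {p ∈ U | 0 < g p} := ⟨hp, sub_pos.mpr hlt⟩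
  rw [gradSq, along_eq_zero_of_const hO h0 hpO, along_eq_zero_of_const hO h0 hpO, h0 p hpO] at hlt
  norm_num at hlt

end MovingFrame

namespace MovingFrame

variable {U W W' : Set (ℝ × ℝ)} {x N : ℝ × ℝ → E3} {e₁ e₂ e₁' e₂' : ℝ × ℝ → ℝ × ℝ} {p : ℝ × ℝ}

theorem fderiv_sq_le (h : MovingFrame U x N e₁ e₂) (hp : p ∈ U) (g : ℝ × ℝ → ℝ) (v : ℝ × ℝ) :
    fderiv ℝ g p v ^ 2 ≤ gradSq e₁ e₂ g p * ‖fderiv ℝ x p v‖ ^ 2 := by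
  have h1 := h.expand_vector hp v
  have h2 := E3.inner_eq_sum (h.unit₁ p hp) (h.unit₂ p hp) (h.unit_N p hp) (h.orth p hp)
    (h.normal_left hp e₁) (h.normal_left hp e₂) (fderiv ℝ x p v) (fderiv ℝ x p v)
  rw [← real_inner_self_eq_norm_sq, h2, real_inner_comm (N p), h.normal_N p hp]
  rw [show fderiv ℝ g p v = ⟪fderiv ℝ x p v, along e₁ x p⟫_ℝ * along e₁ g p +
    ⟪fderiv ℝ x p v, along e₂ x p⟫_ℝ * along e₂ g p by
      conv_lhs => rw [h1]
      simp [along]]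
  rw [gradSq]
  generalize ⟪fderiv ℝ x p v, along e₁ x p⟫_ℝ = c
  generalize ⟪fderiv ℝ x p v, along e₂ x p⟫_ℝ = d
  nlinarith [sq_nonneg (c * along e₂ g p - d * along e₁ g p)]

theorem eq_zero_of_segment (h : MovingFrame U x N e₁ e₂) {g : ℝ × ℝ → ℝ}
    (hg : ContDiffOn ℝ ∞ g U) (hle : ∀ p ∈ U, gradSq e₁ e₂ g p ≤ g p ^ 4) (hp : g p = 0)
    {v : ℝ × ℝ} (hv : ∀ s ∈ Set.Icc (0 : ℝ) 1, p + s • v ∈ U) : g (p + v) = 0 := by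
  have hc : ContinuousOn (fun s : ℝ => p + s • v) (Set.Icc 0 1) := by fun_prop
  have hgc : ContinuousOn (fun s : ℝ => g (p + s • v)) (Set.Icc 0 1) :=
    hg.continuousOn.comp hc hv
  have hxc : ContinuousOn (fun s : ℝ => fderiv ℝ x (p + s • v) v) (Set.Icc 0 1) :=
    ((h.smooth_x.fderiv_infty h.isOpen).continuousOn.comp hc hv).clm_apply continuousOn_const
  obtain ⟨K, hK⟩ := isCompact_Icc.exists_bound_of_continuousOn (hgc.norm.mul hxc.norm)
  have := eq_zero_of_abs_deriv_le_mul_abs_self_of_eq_zero_right (K := K)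
    (f' := fun s => fderiv ℝ g (p + s • v) v) hgc ?_ (by simpa using hp) ?_ 1 (by simp)
  · simpa using this
  · intro s hs
    have hd := (h.diff (hv s ⟨hs.1, hs.2.le⟩) hg).hasFDerivAt
    have hl : HasDerivAt (fun s : ℝ => p + s • v) v s := by
      simpa using ((hasDerivAt_id s).smul_const v).const_add p
    exact (hd.comp_hasDerivAt s hl).hasDerivWithinAt
  · intro s hs
    have hs' : s ∈ Set.Icc (0 : ℝ) 1 := ⟨hs.1, hs.2.le⟩
    have hU := hv s hs'
    have h1 := h.fderiv_sq_le hU g v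
    have h2 : fderiv ℝ g (p + s • v) v ^ 2 ≤
        (‖g (p + s • v)‖ * ‖g (p + s • v)‖ * ‖fderiv ℝ x (p + s • v) v‖) ^ 2 := by
      refine h1.trans ((mul_le_mul_of_nonneg_right (hle _ hU) (sq_nonneg _)).trans (le_of_eq ?_))
      rw [Real.norm_eq_abs, abs_mul_abs_self]
      ring
    have h3 := abs_le_of_sq_le_sq h2 (by positivity)
    have h4 : ‖g (p + s • v)‖ * ‖fderiv ℝ x (p + s • v) v‖ ≤ K :=
      (le_abs_self _).trans (hK s hs')
    rw [Real.norm_eq_abs]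
    calc _ ≤ ‖g (p + s • v)‖ * ‖g (p + s • v)‖ * ‖fderiv ℝ x (p + s • v) v‖ := h3
      _ = (‖g (p + s • v)‖ * ‖fderiv ℝ x (p + s • v) v‖) * ‖g (p + s • v)‖ := by ring
      _ ≤ _ := mul_le_mul_of_nonneg_right h4 (norm_nonneg _)

theorem eq_zero_or_ne_zero (h : MovingFrame U x N e₁ e₂) (hU : IsPreconnected U) {g : ℝ × ℝ → ℝ}
    (hg : ContDiffOn ℝ ∞ g U) (hle : ∀ p ∈ U, gradSq e₁ e₂ g p ≤ g p ^ 4) :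
    (∀ p ∈ U, g p = 0) ∨ ∀ p ∈ U, g p ≠ 0 := by
  have hO : IsOpen {p ∈ U | g p = 0} := by
    rw [Metric.isOpen_iff]
    rintro p ⟨hp, h0⟩
    obtain ⟨r, hr, hb⟩ := Metric.isOpen_iff.mp h.isOpen p hp
    refine ⟨r, hr, fun q hq => ⟨hb hq, ?_⟩⟩
    have := h.eq_zero_of_segment hg hle h0 (v := q - p) fun s hs => hb ?_
    · simpa using this
    · exact (convex_ball p r).add_smul_sub_mem (Metric.mem_ball_self hr) hq hs
  have hO2 : IsOpen {p ∈ U | g p ≠ 0} :=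
    hg.continuousOn.isOpen_inter_preimage h.isOpen isOpen_ne
  have := hU.subset_or_subset hO hO2 (Set.disjoint_left.mpr fun p hp hp' => hp'.2 hp.2)
    fun p hp => (em (g p = 0)).imp (⟨hp, ·⟩) (⟨hp, ·⟩)
  exact this.imp (fun hs p hp => (hs hp).2) (fun hs p hp => (hs hp).2)

theorem trichotomy_of_stationary (h : MovingFrame U x N e₁ e₂) (hU : IsPreconnected U)
    (hst : ∀ {W : Set (ℝ × ℝ)} {e₁ e₂ : ℝ × ℝ → ℝ × ℝ}, W ⊆ U → MovingFrame W x N e₁ e₂ →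
      (∀ p ∈ W, sff x N e₁ e₂ p = 0) → StationaryOn W x N e₁ e₂) :
    (∀ p ∈ U, tr x N e₁ e₂ p = 0) ∨
      (∀ p ∈ U, tr x N e₁ e₂ p ≠ 0) ∧
        ((∀ p ∈ U, disc x N e₁ e₂ p = 0) ∨ ∀ p ∈ U, disc x N e₁ e₂ p ≠ 0) := by
  refine (h.eq_zero_or_ne_zero hU h.smooth_tr fun p hp => h.gradSq_tr_le hst hp).imp_right
    fun ht => ⟨ht, ?_⟩
  have hO : IsOpen {p ∈ U | disc x N e₁ e₂ p - tr x N e₁ e₂ p ^ 2 ≠ 0} :=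
    (h.smooth_disc.sub (h.smooth_tr.pow 2)).continuousOn.isOpen_inter_preimage h.isOpen isOpen_ne
  have hO2 : IsOpen {p ∈ U | disc x N e₁ e₂ p ≠ 0} :=
    h.smooth_disc.continuousOn.isOpen_inter_preimage h.isOpen isOpen_ne
  have h0 : ∀ p ∈ U, disc x N e₁ e₂ p - tr x N e₁ e₂ p ^ 2 ≠ 0 → disc x N e₁ e₂ p = 0 :=
    fun p hp hd => (h.disc_eq_zero_or hst hp (ht p hp)).resolve_right (sub_ne_zero.mp hd)
  have := hU.subset_or_subset hO hO2
    (Set.disjoint_left.mpr fun p hp hp' => hp'.2 (h0 p hp.1 hp.2)) fun p hp => by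
      by_cases hd : disc x N e₁ e₂ p = 0
      · exact Or.inl ⟨hp, by simpa [hd] using ht p hp⟩
      · exact Or.inr ⟨hp, hd⟩
  exact this.imp (fun hs p hp => h0 p hp (hs hp).2) (fun hs p hp => (hs hp).2)

end MovingFrame

namespace MovingFrame

variable {U W W' : Set (ℝ × ℝ)} {x N : ℝ × ℝ → E3} {e₁ e₂ e₁' e₂' : ℝ × ℝ → ℝ × ℝ} {p : ℝ × ℝ}

section Const

variable {F : Type*} [NormedAddCommGroup F] [NormedSpace ℝ F] {g : ℝ × ℝ → F}

theorem fderiv_eq_zero (h : MovingFrame W x N e₁ e₂) (hp : p ∈ W)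
    (h1 : along e₁ g p = 0) (h2 : along e₂ g p = 0) : fderiv ℝ g p = 0 := by
  refine ContinuousLinearMap.ext fun v => ?_
  rw [h.expand_vector hp v, map_add, map_smul, map_smul]
  simp only [along] at h1 h2
  simp [h1, h2]

theorem exists_const (h : MovingFrame U x N e₁ e₂) (hU : IsPreconnected U)
    (hg : ContDiffOn ℝ ∞ g U) (hd : ∀ p ∈ U, fderiv ℝ g p = 0) : ∃ c, ∀ p ∈ U, g p = c :=
  h.isOpen.exists_is_const_of_fderiv_eq_zero hU (fun _ hp => (h.diff hp hg).differentiableWithinAt)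
    hd

end Const

theorem sff_of_umbilic (hd : disc x N e₁ e₂ p = 0) :
    sff x N e₁ e₂ p = 0 ∧ sff x N e₁ e₁ p = tr x N e₁ e₂ p / 2 ∧
      sff x N e₂ e₂ p = tr x N e₁ e₂ p / 2 := by
  rw [disc] at hd
  have hm : sff x N e₁ e₂ p = 0 := by
    nlinarith [sq_nonneg (sff x N e₁ e₁ p - sff x N e₂ e₂ p), sq_nonneg (sff x N e₁ e₂ p)]
  rw [hm] at hd
  have hl : sff x N e₁ e₁ p = sff x N e₂ e₂ p := by
    nlinarith [sq_nonneg (sff x N e₁ e₁ p - sff x N e₂ e₂ p)]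
  exact ⟨hm, by rw [tr]; linarith, by rw [tr]; linarith⟩

theorem inRoundSphere_of_umbilic (h : MovingFrame U x N e₁ e₂) (hU : IsConnected U)
    (ht : ∀ p ∈ U, tr x N e₁ e₂ p ≠ 0) (hd : ∀ p ∈ U, disc x N e₁ e₂ p = 0) :
    InRoundSphere U x := by
  obtain ⟨p₀, hp₀⟩ := hU.nonempty
  have hg : ∀ p ∈ U, along e₁ (tr x N e₁ e₂) p = 0 ∧ along e₂ (tr x N e₁ e₂) p = 0 := by
    intro p hp
    have := h.gradSq_tr_eq_zero_of_umbilic hd hp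
    rw [gradSq] at this
    constructor <;>
      nlinarith [sq_nonneg (along e₁ (tr x N e₁ e₂) p), sq_nonneg (along e₂ (tr x N e₁ e₂) p)]
  obtain ⟨τ, hτ⟩ := h.exists_const hU.isPreconnected h.smooth_tr
    fun p hp => h.fderiv_eq_zero hp (hg p hp).1 (hg p hp).2
  have hτ0 : τ ≠ 0 := hτ p₀ hp₀ ▸ ht p₀ hp₀
  have al : ∀ p ∈ U, ∀ e, along e (fun p => x p + (2 / τ) • N p) p =
      along e x p + (2 / τ) • along e N p := fun p hp e => by
    have := h.diff hp h.smooth_N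
    rw [along_add (h.diff hp h.smooth_x) (this.fun_const_smul _)]
    simp only [along]
    rw [fderiv_fun_const_smul this]
    rfl
  obtain ⟨c, hc⟩ := h.exists_const (g := fun p => x p + (2 / τ) • N p) hU.isPreconnected
    (h.smooth_x.add (h.smooth_N.const_smul _)) fun p hp => by
      obtain ⟨hm, hl, hn⟩ := sff_of_umbilic (hd p hp)
      rw [hτ p hp] at hl hn
      apply h.fderiv_eq_zero hp
      · rw [al p hp, h.along₁_N hp, hm, hl]
        match_scalars <;> field_simp <;> ring
      · rw [al p hp, h.along₂_N hp, hm, hn]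
        match_scalars <;> field_simp <;> ring
  refine ⟨c, ‖2 / τ‖, norm_pos_iff.mpr (div_ne_zero two_ne_zero hτ0), fun p hp => ?_⟩
  have hN : ‖N p‖ = 1 := by
    have := h.unit_N p hp
    rw [real_inner_self_eq_norm_sq] at this
    nlinarith [norm_nonneg (N p)]
  rw [← hc p hp, sub_add_cancel_left, norm_neg, norm_smul, hN, mul_one]

/-- The gradient of `g`, as a tangent vector of the surface. -/
def grad (x : ℝ × ℝ → E3) (e₁ e₂ : ℝ × ℝ → ℝ × ℝ) (g : ℝ × ℝ → ℝ) (p : ℝ × ℝ) : E3 :=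
  along e₁ g p • along e₁ x p + along e₂ g p • along e₂ x p

theorem grad_eq (h : MovingFrame W x N e₁ e₂) (h' : MovingFrame W' x N e₁' e₂') (hp : p ∈ W)
    (hp' : p ∈ W') {g g' : ℝ × ℝ → ℝ} (hg : ∀ p ∈ W', g' p = g p) :
    grad x e₁' e₂' g' p = grad x e₁ e₂ g p := by
  refine ext_inner_right ℝ fun z => ?_
  have := h.trace_eq h' hp hp' ((LinearMap.mul ℝ ℝ).compl₁₂ (fderiv ℝ g p : ℝ × ℝ →ₗ[ℝ] ℝ)
    (innerₗ E3 z ∘ₗ (fderiv ℝ x p : ℝ × ℝ →ₗ[ℝ] E3)))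
  simp only [LinearMap.compl₁₂_apply, ContinuousLinearMap.coe_coe, LinearMap.mul_apply',
    LinearMap.comp_apply, innerₗ_apply_apply] at this
  rw [grad, along_congr h'.isOpen hg hp', along_congr h'.isOpen hg hp']
  simp only [grad, along, inner_add_left, real_inner_smul_left]
  simpa only [real_inner_comm] using this

/-- The axis direction of a flat cone, up to scale. -/
def coneAxis (x N : ℝ × ℝ → E3) (e₁ e₂ : ℝ × ℝ → ℝ × ℝ) (p : ℝ × ℝ) : E3 :=
  N p + -(tr x N e₁ e₂ p ^ 2)⁻¹ • grad x e₁ e₂ (tr x N e₁ e₂) p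

/-- The vertex of a flat cone. -/
def coneVertex (x N : ℝ × ℝ → E3) (e₁ e₂ : ℝ × ℝ → ℝ × ℝ) (p : ℝ × ℝ) : E3 :=
  x p + (tr x N e₁ e₂ p ^ 3)⁻¹ • grad x e₁ e₂ (tr x N e₁ e₂) p

theorem smooth_grad_tr (h : MovingFrame U x N e₁ e₂) :
    ContDiffOn ℝ ∞ (grad x e₁ e₂ (tr x N e₁ e₂)) U :=
  ((h.smooth_along h.smooth_tr).smul h.smooth_E₁).add
    ((h.swap.smooth_along h.smooth_tr).smul h.smooth_E₂)

theorem smooth_coneAxis (h : MovingFrame U x N e₁ e₂) (ht : ∀ p ∈ U, tr x N e₁ e₂ p ≠ 0) :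
    ContDiffOn ℝ ∞ (coneAxis x N e₁ e₂) U :=
  h.smooth_N.add (((h.smooth_tr.pow 2).inv fun p hp => pow_ne_zero 2 (ht p hp)).neg.smul
    h.smooth_grad_tr)

theorem smooth_coneVertex (h : MovingFrame U x N e₁ e₂) (ht : ∀ p ∈ U, tr x N e₁ e₂ p ≠ 0) :
    ContDiffOn ℝ ∞ (coneVertex x N e₁ e₂) U :=
  h.smooth_x.add (((h.smooth_tr.pow 3).inv fun p hp => pow_ne_zero 3 (ht p hp)).smul
    h.smooth_grad_tr)

theorem tr_of_flat (hflat : FlatOn W x N e₁ e₂) (hp : p ∈ W) : tr x N e₁ e₂ p = sff x N e₁ e₁ p := by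
  rw [tr, (hflat p hp).2.1, add_zero]

theorem grad_of_flat (h : MovingFrame W x N e₁ e₂) (hflat : FlatOn W x N e₁ e₂) (hp : p ∈ W) :
    grad x e₁ e₂ (tr x N e₁ e₂) p =
    along e₂ (sff x N e₁ e₁) p • along e₂ x p := by
  have ht : ∀ p ∈ W, tr x N e₁ e₂ p = sff x N e₁ e₁ p := fun p hp => tr_of_flat hflat hp
  rw [grad, along_congr h.isOpen ht hp, along_congr h.isOpen ht hp, (hflat p hp).2.2.1, zero_smul,
    zero_add]

theorem coneAxis_of_flat (h : MovingFrame W x N e₁ e₂) (hflat : FlatOn W x N e₁ e₂) (hp : p ∈ W) :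
    coneAxis x N e₁ e₂ p = N p +
    -(along e₂ (sff x N e₁ e₁) p / sff x N e₁ e₁ p ^ 2) • along e₂ x p := by
  rw [coneAxis, h.grad_of_flat hflat hp, tr_of_flat hflat hp]
  module

theorem coneVertex_of_flat (h : MovingFrame W x N e₁ e₂) (hflat : FlatOn W x N e₁ e₂) (hp : p ∈ W) :
    coneVertex x N e₁ e₂ p = x p +
    (along e₂ (sff x N e₁ e₁) p / sff x N e₁ e₁ p ^ 3) • along e₂ x p := by
  rw [coneVertex, h.grad_of_flat hflat hp, tr_of_flat hflat hp]
  module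

theorem cone_of_flat (h : MovingFrame W x N e₁ e₂) (hm : ∀ p ∈ W, sff x N e₁ e₂ p = 0)
    (hflat : FlatOn W x N e₁ e₂) (hp : p ∈ W) :
    fderiv ℝ (coneAxis x N e₁ e₂) p = 0 ∧ fderiv ℝ (coneVertex x N e₁ e₂) p = 0 ∧
      ⟪coneAxis x N e₁ e₂ p, coneAxis x N e₁ e₂ p⟫_ℝ = 2 ∧
      ⟪x p - coneVertex x N e₁ e₂ p, coneAxis x N e₁ e₂ p⟫_ℝ = (tr x N e₁ e₂ p)⁻¹ ∧
      ⟪x p - coneVertex x N e₁ e₂ p, x p - coneVertex x N e₁ e₂ p⟫_ℝ =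
        (tr x N e₁ e₂ p)⁻¹ ^ 2 := by
  have ha := fun p hp => (hflat p hp).1
  have s₁ := h.smooth_sff₁₁
  have s₂ := h.swap.smooth_along s₁
  let u : ℝ × ℝ → ℝ := fun p => along e₂ (sff x N e₁ e₁) p / sff x N e₁ e₁ p ^ 2
  let v : ℝ × ℝ → ℝ := fun p => along e₂ (sff x N e₁ e₁) p / sff x N e₁ e₁ p ^ 3
  have su : ContDiffOn ℝ ∞ u W := s₂.div (s₁.pow 2) fun p hp => pow_ne_zero 2 (ha p hp)
  have sv : ContDiffOn ℝ ∞ v W := s₂.div (s₁.pow 3) fun p hp => pow_ne_zero 3 (ha p hp)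
  have hu2 : ∀ p ∈ W, u p • u p = 1 := fun p hp => by
    have := ha p hp
    simp only [u, smul_eq_mul]
    field_simp
    rw [(hflat p hp).2.2.2]
  have hvu : ∀ p ∈ W, v p • sff x N e₁ e₁ p = u p := fun p hp => by
    have := ha p hp
    simp only [u, v, smul_eq_mul]
    field_simp
  have hu : ∀ e, along e u p = 0 := fun e => by
    have h1 := along_eq_zero_of_const (e := e) h.isOpen hu2 hp
    rw [along_smul (h.diff hp su) (h.diff hp su)] at h1
    have h2 := hu2 p hp
    simp only [smul_eq_mul] at h1 h2
    have h3 : u p ≠ 0 := fun h0 => by simp [h0] at h2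
    exact mul_left_cancel₀ h3 (by linarith)
  have hv : ∀ e, v p * along e (sff x N e₁ e₁) p + along e v p * sff x N e₁ e₁ p = 0 := fun e => by
    have h1 := along_congr (e := e) h.isOpen hvu hp
    rwa [along_smul (h.diff hp sv) (h.diff hp s₁), hu] at h1
  have hpg : geo x e₁ e₂ p = u p * sff x N e₁ e₁ p := by
    have := h.codazzi₁ hp
    rw [along_eq_zero_of_const h.isOpen hm hp, hm p hp, (hflat p hp).2.1] at this
    have := ha p hp
    simp only [u]
    field_simp
    linarith
  have hqg : geo x e₂ e₁ p = 0 := by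
    have := h.codazzi₂ hp
    rw [along_eq_zero_of_const h.isOpen hm hp, hm p hp, (hflat p hp).2.1,
      along_eq_zero_of_const h.isOpen (fun p hp => (hflat p hp).2.1) hp] at this
    exact (mul_eq_zero.mp (by linarith : geo x e₂ e₁ p * sff x N e₁ e₁ p = 0)).resolve_right
      (ha p hp)
  have h12 : along e₁ (along e₂ x) p = -(u p * sff x N e₁ e₁ p) • along e₁ x p := by
    rw [h.along₁_E₂ hp, hpg, hm p hp, zero_smul, add_zero]
  have h22 : along e₂ (along e₂ x) p = 0 := by
    rw [h.along₂_E₂ hp, hqg, (hflat p hp).2.1, zero_smul, zero_smul, add_zero]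
  have hN1 : along e₁ N p = -(sff x N e₁ e₁ p) • along e₁ x p := by
    rw [h.along₁_N hp, hm p hp, neg_zero, zero_smul, add_zero]
  have hN2 : along e₂ N p = 0 := by
    rw [h.along₂_N hp, hm p hp, (hflat p hp).2.1, neg_zero, zero_smul, zero_smul, add_zero]
  have hap := ha p hp
  have hu2p : u p * u p = 1 := hu2 p hp
  have hvup : v p * sff x N e₁ e₁ p = u p := hvu p hp
  have dE := h.diff hp h.smooth_E₂
  have du := h.diff hp su
  have dv := h.diff hp sv
  have hA : ∀ e, along e (coneAxis x N e₁ e₂) p =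
      along e N p + (-(u p) • along e (along e₂ x) p) := fun e => by
    rw [along_congr h.isOpen (fun p hp => h.coneAxis_of_flat hflat hp) hp,
      along_add (h.diff hp h.smooth_N) (du.fun_neg.fun_smul dE), along_smul du.fun_neg dE,
      along_neg, hu, neg_zero, zero_smul, add_zero]
  have hV : ∀ e, along e (coneVertex x N e₁ e₂) p =
      along e x p + (v p • along e (along e₂ x) p + along e v p • along e₂ x p) := fun e => by
    rw [along_congr h.isOpen (fun p hp => h.coneVertex_of_flat hflat hp) hp,
      along_add (h.diff hp h.smooth_x) (dv.fun_smul dE), along_smul dv dE]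
  have hv1 : along e₁ v p = 0 := by
    have := hv e₁
    rw [(hflat p hp).2.2.1, mul_zero, zero_add] at this
    exact (mul_eq_zero.mp this).resolve_right hap
  have hv2 : along e₂ v p = -1 := by
    have h1 := hv e₂
    have h2 : along e₂ (sff x N e₁ e₁) p = u p * sff x N e₁ e₁ p ^ 2 := by
      simp only [u]
      field_simp
    rw [h2] at h1
    refine mul_right_cancel₀ hap ?_
    linear_combination h1 - u p * sff x N e₁ e₁ p * hvup - sff x N e₁ e₁ p * hu2p
  have hE := h.unit₂ p hp
  have hNN := h.unit_N p hp
  have hEN := h.normal_left hp e₂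
  have hNE := h.normal_right hp e₂
  have hAp : coneAxis x N e₁ e₂ p = N p + -(u p) • along e₂ x p := h.coneAxis_of_flat hflat hp
  have hVp : x p - coneVertex x N e₁ e₂ p = -(v p) • along e₂ x p := by
    rw [h.coneVertex_of_flat hflat hp, sub_add_cancel_left, neg_smul]
  rw [hAp, hVp, tr_of_flat hflat hp]
  refine ⟨h.fderiv_eq_zero hp ?_ ?_, h.fderiv_eq_zero hp ?_ ?_, ?_, ?_, ?_⟩
  · rw [hA, hN1, h12, smul_smul, ← add_smul]
    convert zero_smul ℝ _ using 2
    linear_combination sff x N e₁ e₁ p * hu2p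
  · rw [hA, hN2, h22, smul_zero, add_zero]
  · rw [hV, h12, hv1, smul_smul, zero_smul, add_zero]
    nth_rewrite 1 [← one_smul ℝ (along e₁ x p)]
    rw [← add_smul]
    convert zero_smul ℝ _ using 2
    linear_combination -u p * hvup - hu2p
  · rw [hV, h22, hv2]
    module
  · simp only [inner_add_left, inner_add_right, real_inner_smul_left, real_inner_smul_right, hE,
      hNN, hEN, hNE]
    linear_combination hu2p
  · simp only [inner_add_right, real_inner_smul_left, real_inner_smul_right, hE, hEN]
    field_simp
    linear_combination u p * hvup + hu2p
  · simp only [real_inner_smul_left, real_inner_smul_right, hE]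
    field_simp
    linear_combination (v p * sff x N e₁ e₁ p + u p) * hvup + hu2p

end MovingFrame

theorem mem_coneSet_one {y : E3} : y ∈ coneSet 1 ↔ 0 < y 2 ∧ y 0 ^ 2 + y 1 ^ 2 = y 2 ^ 2 := by
  have h2 : (0 : ℝ) < √(1 ^ 2 + 1) := by positivity
  constructor
  · rintro ⟨s, θ, hs, h0, h1, hy⟩
    refine ⟨hy ▸ div_pos hs h2, ?_⟩
    rw [h0, h1, hy]
    field_simp
    rw [Real.cos_sq_add_sin_sq]
  · rintro ⟨hy, h⟩
    have hz : ‖(⟨y 0, y 1⟩ : ℂ)‖ = y 2 := by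
      rw [Complex.norm_def, Complex.normSq_mk, ← sq, ← sq, h, Real.sqrt_sq hy.le]
    have h0 : ‖(⟨y 0, y 1⟩ : ℂ)‖ * Real.cos (Complex.arg ⟨y 0, y 1⟩) = y 0 :=
      Complex.norm_mul_cos_arg ⟨y 0, y 1⟩
    have h1 : ‖(⟨y 0, y 1⟩ : ℂ)‖ * Real.sin (Complex.arg ⟨y 0, y 1⟩) = y 1 :=
      Complex.norm_mul_sin_arg ⟨y 0, y 1⟩
    rw [hz] at h0 h1
    refine ⟨√(1 ^ 2 + 1) * y 2, Complex.arg ⟨y 0, y 1⟩, mul_pos h2 hy, ?_, ?_, ?_⟩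
    · rw [eq_div_iff h2.ne', mul_one, mul_assoc, h0, mul_comm]
    · rw [eq_div_iff h2.ne', mul_one, mul_assoc, h1, mul_comm]
    · rw [eq_div_iff h2.ne', mul_comm]

theorem E3.exists_rotation {w : E3} (hw : ‖w‖ = 1) :
    ∃ S : E3 ≃ₗᵢ[ℝ] E3, LinearMap.det (S.toLinearEquiv : E3 →ₗ[ℝ] E3) = 1 ∧
      S (EuclideanSpace.single 2 1) = w := by
  have hdet : ∀ v : E3, v ≠ 0 →
      LinearMap.det ((ℝ ∙ v)ᗮ.reflection.toLinearEquiv : E3 →ₗ[ℝ] E3) = -1 := fun v hv => by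
    have := (ℝ ∙ v)ᗮ.det_reflection
    rwa [Submodule.orthogonal_orthogonal, finrank_span_singleton hv, pow_one] at this
  by_cases h : (EuclideanSpace.single 2 1 : E3) = w
  · exact ⟨LinearIsometryEquiv.refl ℝ E3, LinearMap.det_id, h⟩
  have h0 : (EuclideanSpace.single 0 1 : E3) ≠ 0 := by simp
  refine ⟨(ℝ ∙ (EuclideanSpace.single 0 1 : E3))ᗮ.reflection.trans
    (ℝ ∙ ((EuclideanSpace.single 2 1 : E3) - w))ᗮ.reflection, ?_, ?_⟩
  · refine (LinearMap.det_comp _ _).trans ?_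
    rw [hdet _ h0, hdet _ (sub_ne_zero.mpr h)]
    norm_num
  · have hmem : (EuclideanSpace.single 2 1 : E3) ∈ (ℝ ∙ (EuclideanSpace.single 0 1 : E3))ᗮ := by
      rw [Submodule.mem_orthogonal_singleton_iff_inner_right]
      simp [EuclideanSpace.inner_single_left]
    rw [LinearIsometryEquiv.trans_apply, Submodule.reflection_mem_subspace_eq_self hmem,
      Submodule.reflection_sub (by simp [hw])]

theorem mem_image_coneSet_one (S : E3 ≃ₗᵢ[ℝ] E3) (c z : E3) :
    z ∈ (fun y => S y + c) '' coneSet 1 ↔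
      0 < ⟪z - c, S (EuclideanSpace.single 2 1)⟫_ℝ ∧
        2 * ⟪z - c, S (EuclideanSpace.single 2 1)⟫_ℝ ^ 2 = ⟪z - c, z - c⟫_ℝ := by
  obtain ⟨y, rfl⟩ : ∃ y, z = S y + c := ⟨S.symm (z - c), by simp⟩
  have hi : Function.Injective fun y => S y + c := fun a b hab =>
    S.injective (add_right_cancel hab)
  rw [hi.mem_set_image (a := y), add_sub_cancel_right, S.inner_map_map, S.inner_map_map,
    mem_coneSet_one]
  have h1 : ⟪y, EuclideanSpace.single 2 1⟫_ℝ = y 2 := by simp [EuclideanSpace.inner_single_right]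
  have h2 : ⟪y, y⟫_ℝ = y 0 ^ 2 + y 1 ^ 2 + y 2 ^ 2 := by
    rw [PiLp.inner_apply, Fin.sum_univ_three]
    simp [sq]
  rw [h1, h2]
  exact and_congr_right fun _ => ⟨fun h => by linarith, fun h => by linarith⟩

theorem exists_rigidMotion_image_coneSet {U : Set (ℝ × ℝ)} {x : ℝ × ℝ → E3} {c w : E3}
    (hw : ‖w‖ = 1) (h1 : ∀ p ∈ U, 0 < ⟪x p - c, w⟫_ℝ)
    (h2 : ∀ p ∈ U, 2 * ⟪x p - c, w⟫_ℝ ^ 2 = ⟪x p - c, x p - c⟫_ℝ) :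
    ∃ Φ : E3 → E3, RigidMotion Φ ∧ ∀ p ∈ U, x p ∈ Φ '' coneSet 1 := by
  obtain ⟨S, hS, rfl⟩ := E3.exists_rotation hw
  exact ⟨fun y => S y + c, ⟨S, c, hS, fun _ => rfl⟩, fun p hp =>
    (mem_image_coneSet_one S c (x p)).mpr ⟨h1 p hp, h2 p hp⟩⟩

namespace MovingFrame

variable {U W W' : Set (ℝ × ℝ)} {x N : ℝ × ℝ → E3} {e₁ e₂ e₁' e₂' : ℝ × ℝ → ℝ × ℝ} {p : ℝ × ℝ}

theorem cone_of_stationary (h : MovingFrame U x N e₁ e₂)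
    (hst : ∀ {W : Set (ℝ × ℝ)} {e₁ e₂ : ℝ × ℝ → ℝ × ℝ}, W ⊆ U → MovingFrame W x N e₁ e₂ →
      (∀ p ∈ W, sff x N e₁ e₂ p = 0) → StationaryOn W x N e₁ e₂)
    (hp : p ∈ U) (ht : tr x N e₁ e₂ p ≠ 0) (hd : disc x N e₁ e₂ p ≠ 0) :
    fderiv ℝ (coneAxis x N e₁ e₂) p = 0 ∧ fderiv ℝ (coneVertex x N e₁ e₂) p = 0 ∧
      ⟪coneAxis x N e₁ e₂ p, coneAxis x N e₁ e₂ p⟫_ℝ = 2 ∧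
      ⟪x p - coneVertex x N e₁ e₂ p, coneAxis x N e₁ e₂ p⟫_ℝ = (tr x N e₁ e₂ p)⁻¹ ∧
      ⟪x p - coneVertex x N e₁ e₂ p, x p - coneVertex x N e₁ e₂ p⟫_ℝ =
        (tr x N e₁ e₂ p)⁻¹ ^ 2 := by
  obtain ⟨W, f₁, f₂, hWU, hpW, hf, hm, hflat⟩ := h.exists_flat_of_stationary hst hp ht hd
  have htr : ∀ q ∈ W, tr x N f₁ f₂ q = tr x N e₁ e₂ q := fun q hq => h.tr_eq hf (hWU hq) hq
  have hA : ∀ q ∈ W, coneAxis x N f₁ f₂ q = coneAxis x N e₁ e₂ q := fun q hq => by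
    rw [coneAxis, htr q hq, h.grad_eq hf (hWU hq) hq htr, coneAxis]
  have hV : ∀ q ∈ W, coneVertex x N f₁ f₂ q = coneVertex x N e₁ e₂ q := fun q hq => by
    rw [coneVertex, htr q hq, h.grad_eq hf (hWU hq) hq htr, coneVertex]
  have := hf.cone_of_flat hm hflat hpW
  rwa [hA p hpW, hV p hpW, htr p hpW,
    (Filter.eventuallyEq_of_mem (hf.isOpen.mem_nhds hpW) hA).fderiv_eq,
    (Filter.eventuallyEq_of_mem (hf.isOpen.mem_nhds hpW) hV).fderiv_eq] at this

theorem inCone_of_stationary (h : MovingFrame U x N e₁ e₂) (hU : IsConnected U)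
    (hst : ∀ {W : Set (ℝ × ℝ)} {e₁ e₂ : ℝ × ℝ → ℝ × ℝ}, W ⊆ U → MovingFrame W x N e₁ e₂ →
      (∀ p ∈ W, sff x N e₁ e₂ p = 0) → StationaryOn W x N e₁ e₂)
    (ht : ∀ p ∈ U, tr x N e₁ e₂ p ≠ 0) (hd : ∀ p ∈ U, disc x N e₁ e₂ p ≠ 0) :
    ∃ Φ : E3 → E3, RigidMotion Φ ∧ ∀ p ∈ U, x p ∈ Φ '' coneSet 1 := by
  have key := fun p hp => h.cone_of_stationary hst hp (ht p hp) (hd p hp)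
  obtain ⟨a, ha⟩ := h.exists_const hU.isPreconnected (h.smooth_coneAxis ht) fun p hp => (key p hp).1
  obtain ⟨c, hc⟩ := h.exists_const hU.isPreconnected (h.smooth_coneVertex ht)
    fun p hp => (key p hp).2.1
  obtain ⟨p₀, hp₀⟩ := hU.nonempty
  have h2 : ⟪a, a⟫_ℝ = 2 := by rw [← (key p₀ hp₀).2.2.1, ha p₀ hp₀]
  have hax : ∀ p ∈ U, ⟪x p - c, a⟫_ℝ = (tr x N e₁ e₂ p)⁻¹ := fun p hp => by
    rw [← (key p hp).2.2.2.1, ha p hp, hc p hp]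
  have hc' : ∀ p ∈ U, ⟪x p - c, x p - c⟫_ℝ = (tr x N e₁ e₂ p)⁻¹ ^ 2 := fun p hp => by
    rw [← (key p hp).2.2.2.2, hc p hp]
  have h22 := Real.sq_sqrt (zero_le_two (α := ℝ))
  have main : ∀ ε : ℝ, ε ^ 2 = 1 → (∀ p ∈ U, 0 < ε * tr x N e₁ e₂ p) →
      ∃ Φ : E3 → E3, RigidMotion Φ ∧ ∀ p ∈ U, x p ∈ Φ '' coneSet 1 := by
    intro ε hε hpos
    refine exists_rigidMotion_image_coneSet (c := c) (w := (ε / √2) • a) ?_ (fun p hp => ?_)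
      fun p hp => ?_
    · rw [← sq_eq_sq₀ (norm_nonneg _) zero_le_one, ← real_inner_self_eq_norm_sq,
        real_inner_smul_left, real_inner_smul_right, h2]
      field_simp
      rw [h22, hε]
      norm_num
    · rw [real_inner_smul_right, hax p hp]
      have h1 := hpos p hp
      have h3 := ht p hp
      have : ε / √2 * (tr x N e₁ e₂ p)⁻¹ =
          ε * tr x N e₁ e₂ p / (√2 * tr x N e₁ e₂ p ^ 2) := by field_simp
      rw [this]
      positivity
    · rw [real_inner_smul_right, hax p hp, hc' p hp, mul_pow, div_pow, h22, hε]
      ring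
  have hO : IsOpen {p ∈ U | 0 < tr x N e₁ e₂ p} :=
    h.smooth_tr.continuousOn.isOpen_inter_preimage h.isOpen isOpen_Ioi
  have hO2 : IsOpen {p ∈ U | tr x N e₁ e₂ p < 0} :=
    h.smooth_tr.continuousOn.isOpen_inter_preimage h.isOpen isOpen_Iio
  rcases hU.isPreconnected.subset_or_subset hO hO2
    (Set.disjoint_left.mpr fun p hp hp' => (hp'.2.trans hp.2).false)
    (fun p hp => (ht p hp).lt_or_gt.elim (fun hl => Or.inr ⟨hp, hl⟩) fun hg => Or.inl ⟨hp, hg⟩)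
    with hs | hs
  · exact main 1 (by norm_num) fun p hp => by simpa using (hs hp).2
  · exact main (-1) (by norm_num) fun p hp => by simpa using (hs hp).2

end MovingFrame

theorem SurfMinimalAt.of_tr_eq_zero {W : Set (ℝ × ℝ)} {x N : ℝ × ℝ → E3} {e₁ e₂ : ℝ × ℝ → ℝ × ℝ}
    {p : ℝ × ℝ} (h : MovingFrame W x N e₁ e₂) (hp : p ∈ W) (ht : MovingFrame.tr x N e₁ e₂ p = 0) :
    SurfMinimalAt x N p := by
  intro v₁ v₂ h1 h2 h12
  have := h.trace_eq_of_orthonormal hp h1 h2 h12 ((innerₗ E3).compl₁₂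
    (fderiv ℝ N p : ℝ × ℝ →ₗ[ℝ] E3) (fderiv ℝ x p : ℝ × ℝ →ₗ[ℝ] E3))
  simp only [LinearMap.compl₁₂_apply, ContinuousLinearMap.coe_coe, innerₗ_apply_apply] at this
  rw [this]
  simp only [MovingFrame.tr, sff, along] at ht
  linarith

theorem SurfMinimalAt.tr_eq_zero {W : Set (ℝ × ℝ)} {x N : ℝ × ℝ → E3} {e₁ e₂ : ℝ × ℝ → ℝ × ℝ}
    {p : ℝ × ℝ} (hmin : SurfMinimalAt x N p) (h : MovingFrame W x N e₁ e₂) (hp : p ∈ W) :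
    MovingFrame.tr x N e₁ e₂ p = 0 := by
  have := hmin _ _ (h.unit₁ p hp) (h.unit₂ p hp) (h.orth p hp)
  simp only [MovingFrame.tr, sff, along]
  linarith

namespace MovingFrame

variable {U W : Set (ℝ × ℝ)} {x N : ℝ × ℝ → E3} {e₁ e₂ : ℝ × ℝ → ℝ × ℝ} {p : ℝ × ℝ} {c w : E3}

theorem inner_along_N_self (h : MovingFrame W x N e₁ e₂) (hp : p ∈ W) (e : ℝ × ℝ → ℝ × ℝ) :
    ⟪along e N p, N p⟫_ℝ = 0 := by
  have := h.inner_along_eq_of_const hp h.smooth_N h.smooth_N h.unit_N e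
  linarith

/-- If a position vector field is `g • N`, then its derivative determines the second fundamental
form and the derivative of `g`. -/
theorem inner_along_of_eq_smul_normal (h : MovingFrame W x N e₁ e₂) {ν : ℝ × ℝ → E3}
    (hν : ContDiffOn ℝ ∞ ν W) (hn : ∀ p ∈ W, ∀ e, ⟪ν p, along e x p⟫_ℝ = 0) (hp : p ∈ W)
    (e e' : ℝ × ℝ → ℝ × ℝ) :
    ⟪along e ν p, along e' x p⟫_ℝ = -(⟪ν p, N p⟫_ℝ * sff x N e e' p) ∧
      ⟪along e ν p, N p⟫_ℝ = along e (fun p => ⟪ν p, N p⟫_ℝ) p := by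
  have hg : ContDiffOn ℝ ∞ (fun p => ⟪ν p, N p⟫_ℝ) W := hν.inner ℝ h.smooth_N
  have key : along e ν p = ⟪ν p, N p⟫_ℝ • along e N p + along e (fun p => ⟪ν p, N p⟫_ℝ) p • N p := by
    rw [← along_smul (h.diff hp hg) (h.diff hp h.smooth_N)]
    refine along_congr h.isOpen (fun q hq => ?_) hp
    conv_lhs => rw [h.expand hq (ν q), hn q hq, hn q hq]
    simp
  constructor
  · conv_lhs => rw [key, inner_add_left, real_inner_smul_left, real_inner_smul_left,
      h.normal_right hp]
    rw [sff]
    ring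
  · conv_lhs => rw [key, inner_add_left, real_inner_smul_left, real_inner_smul_left,
      h.inner_along_N_self hp, h.unit_N p hp]
    ring

theorem along_mul {f g : ℝ × ℝ → ℝ} (hf : DifferentiableAt ℝ f p) (hg : DifferentiableAt ℝ g p)
    (e : ℝ × ℝ → ℝ × ℝ) : along e (fun p => f p * g p) p = f p * along e g p + along e f p * g p :=
  along_smul hf hg

theorem stationaryOn_of_sphere (h : MovingFrame U x N e₁ e₂) {ρ : ℝ}
    (hc : ∀ p ∈ U, ‖x p - c‖ = ρ) :
    (∀ p ∈ U, sff x N e₁ e₂ p = 0) ∧ StationaryOn U x N e₁ e₂ := by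
  have hν : ContDiffOn ℝ ∞ (fun p => x p - c) U := h.smooth_x.sub contDiffOn_const
  have hνe : ∀ (e : ℝ × ℝ → ℝ × ℝ) p, along e (fun p => x p - c) p = along e x p := fun e p => by
    simp [along, fderiv_sub_const]
  have hn : ∀ p ∈ U, ∀ e, ⟪x p - c, along e x p⟫_ℝ = 0 := fun p hp e => by
    have := h.inner_along_eq_of_const hp hν hν (c := ρ ^ 2)
      (fun p hp => by rw [real_inner_self_eq_norm_sq, hc p hp]) e
    rw [hνe] at this
    rw [real_inner_comm]
    linarith
  set g : ℝ × ℝ → ℝ := fun p => ⟪x p - c, N p⟫_ℝ with hg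
  have sg : ContDiffOn ℝ ∞ g U := hν.inner ℝ h.smooth_N
  have key : ∀ p ∈ U, ∀ e e', ⟪along e x p, along e' x p⟫_ℝ = -(g p * sff x N e e' p) :=
    fun p hp e e' => by
      rw [← hνe e]; exact (h.inner_along_of_eq_smul_normal hν hn hp e e').1
  have hge : ∀ p ∈ U, ∀ e, along e g p = 0 := fun p hp e => by
    rw [← (h.inner_along_of_eq_smul_normal hν hn hp e e).2, hνe, h.normal_left hp]
  have hl : ∀ p ∈ U, g p * sff x N e₁ e₁ p = -1 := fun p hp => by
    have := key p hp e₁ e₁; rw [h.unit₁ p hp] at this; linarith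
  have hr : ∀ p ∈ U, g p * sff x N e₂ e₂ p = -1 := fun p hp => by
    have := key p hp e₂ e₂; rw [h.unit₂ p hp] at this; linarith
  have hg0 : ∀ p ∈ U, g p ≠ 0 := fun p hp h0 => by
    have := hl p hp
    rw [h0] at this
    norm_num at this
  have hm : ∀ p ∈ U, sff x N e₁ e₂ p = 0 := fun p hp => by
    have := key p hp e₁ e₂
    rw [h.orth p hp] at this
    exact (mul_eq_zero.mp (neg_eq_zero.mp this.symm)).resolve_left (hg0 p hp)
  have hd : ∀ {f : ℝ × ℝ → ℝ}, ContDiffOn ℝ ∞ f U → (∀ p ∈ U, g p * f p = -1) →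
      ∀ e, ∀ p ∈ U, along e f p = 0 := fun {f} hf hgf e p hp => by
    have := along_mul (h.diff hp sg) (h.diff hp hf) e
    rw [along_eq_zero_of_const h.isOpen hgf hp, hge p hp] at this
    simpa [hg0 p hp] using this
  refine ⟨hm, fun p hp t => ?_⟩
  have d1 := hd h.smooth_sff₁₁ hl
  have d2 := hd h.smooth_sff₂₂ hr
  rw [along_eq_zero_of_const h.isOpen (d1 e₁) hp, along_eq_zero_of_const h.isOpen (d1 e₂) hp,
    along_eq_zero_of_const h.isOpen (d2 e₁) hp, along_eq_zero_of_const h.isOpen (d2 e₂) hp,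
    d1 e₁ p hp, d1 e₂ p hp, d2 e₁ p hp, d2 e₂ p hp,
    mul_left_cancel₀ (hg0 p hp) ((hl p hp).trans (hr p hp).symm)]
  exact divExpr_eq_zero_of_umbilic _ _ _ _

theorem stationaryOn_of_flat (h : MovingFrame W x N e₁ e₂) (hm : ∀ p ∈ W, sff x N e₁ e₂ p = 0)
    (hflat : FlatOn W x N e₁ e₂) : StationaryOn W x N e₁ e₂ := fun p hp t => by
  have hb := fun p hp => (hflat p hp).2.1
  have h1 := fun p hp => (hflat p hp).2.2.1
  obtain ⟨ha, -, -, h2⟩ := hflat p hp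
  have hcod := h.codazzi₁ hp
  rw [along_eq_zero_of_const h.isOpen hm hp, hm p hp, hb p hp] at hcod
  have s₁ := h.smooth_sff₁₁
  have s₂ := h.swap.smooth_along s₁
  have h22 : along e₂ (along e₂ (sff x N e₁ e₁)) p = 2 * sff x N e₁ e₁ p ^ 3 := by
    have d₁ := h.diff hp s₁
    have d₂ := h.diff hp s₂
    have d₁' := h.diff hp (s₁.mul s₁)
    have e1 := along_mul d₂ d₂ e₂
    have e2 := along_mul d₁' d₁' e₂
    have e3 := along_mul d₁ d₁ e₂
    rw [along_congr (g' := fun p => (sff x N e₁ e₁ p * sff x N e₁ e₁ p) *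
      (sff x N e₁ e₁ p * sff x N e₁ e₁ p)) h.isOpen (fun q hq => by
        have := (hflat q hq).2.2.2
        change _ * _ = _
        linear_combination this) hp] at e1
    change along e₂ (fun p => _) p = _ at e2
    rw [e1, e3] at e2
    have h20 : along e₂ (sff x N e₁ e₁) p ≠ 0 := fun h0 => by
      rw [h0] at h2
      exact ha (by simpa using h2.symm)
    apply mul_left_cancel₀ h20
    linear_combination e2 / 2
  rw [along_eq_zero_of_const h.isOpen h1 hp, h22, h1 p hp, hb p hp,
    along_eq_zero_of_const h.isOpen (fun p hp => along_eq_zero_of_const h.isOpen hb hp) hp,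
    along_eq_zero_of_const h.isOpen (fun p hp => along_eq_zero_of_const h.isOpen hb hp) hp,
    along_eq_zero_of_const h.isOpen hb hp, along_eq_zero_of_const h.isOpen hb hp]
  exact divExpr_eq_zero_of_flat ha h2 (by linarith) t

theorem cone_normal (h : MovingFrame U x N e₁ e₂)
    (h2 : ∀ p ∈ U, 2 * ⟪x p - c, w⟫_ℝ ^ 2 = ⟪x p - c, x p - c⟫_ℝ) (hp : p ∈ U)
    (e : ℝ × ℝ → ℝ × ℝ) :
    ⟪x p - c - (2 * ⟪x p - c, w⟫_ℝ) • w, along e x p⟫_ℝ = 0 := by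
  have hν : ContDiffOn ℝ ∞ (fun p => x p - c) U := h.smooth_x.sub contDiffOn_const
  have hνe : along e (fun p => x p - c) p = along e x p := by simp [along, fderiv_sub_const]
  have e1 := along_inner (e := e) (h.diff hp hν) (differentiableAt_const w)
  have e2 := along_inner (e := e) (h.diff hp hν) (h.diff hp hν)
  have hk : DifferentiableAt ℝ (fun p => ⟪x p - c, w⟫_ℝ) p :=
    (h.diff hp hν).inner ℝ (differentiableAt_const w)
  rw [← along_congr (g := fun p => 2 * (⟪x p - c, w⟫_ℝ * ⟪x p - c, w⟫_ℝ)) h.isOpen (fun p hp => by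
      rw [← h2 p hp]; ring) hp,
    along_mul (differentiableAt_const 2) (hk.fun_mul hk), along_mul hk hk, e1, hνe] at e2
  have h0 : along e (fun _ => w) p = 0 := by simp [along]
  have h0' : along e (fun _ => (2 : ℝ)) p = 0 := by simp [along]
  rw [h0, h0', inner_zero_right, real_inner_comm (x p - c)] at e2
  rw [inner_sub_left, real_inner_smul_left, real_inner_comm (along e x p) w]
  linarith

theorem flat_of_cone (h : MovingFrame U x N e₁ e₂) (hw : ‖w‖ = 1)
    (h1 : ∀ p ∈ U, 0 < ⟪x p - c, w⟫_ℝ)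
    (h2 : ∀ p ∈ U, 2 * ⟪x p - c, w⟫_ℝ ^ 2 = ⟪x p - c, x p - c⟫_ℝ)
    (hy : ∀ p ∈ U, x p - c = (√2 * ⟪x p - c, w⟫_ℝ) • along e₂ x p) :
    (∀ p ∈ U, sff x N e₁ e₂ p = 0) ∧ FlatOn U x N e₁ e₂ := by
  have h22 := Real.sq_sqrt (zero_le_two (α := ℝ))
  have h20 : √2 ≠ 0 := by positivity
  have hww : ⟪w, w⟫_ℝ = 1 := by rw [real_inner_self_eq_norm_sq, hw, one_pow]
  set k : ℝ × ℝ → ℝ := fun p => ⟪x p - c, w⟫_ℝ with hk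
  have sx : ContDiffOn ℝ ∞ (fun p => x p - c) U := h.smooth_x.sub contDiffOn_const
  have sk : ContDiffOn ℝ ∞ k U := sx.inner ℝ contDiffOn_const
  let ν : ℝ × ℝ → E3 := fun p => x p - c - (2 * k p) • w
  have hν : ContDiffOn ℝ ∞ ν U := sx.sub ((contDiffOn_const.mul sk).smul contDiffOn_const)
  have hn : ∀ p ∈ U, ∀ e, ⟪ν p, along e x p⟫_ℝ = 0 := fun p hp e => h.cone_normal h2 hp e
  have hke : ∀ p ∈ U, ∀ e, along e k p = ⟪along e x p, w⟫_ℝ := fun p hp e => by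
    rw [hk, along_inner (h.diff hp sx) (differentiableAt_const w)]
    simp [along, fderiv_sub_const]
  have hνe : ∀ p ∈ U, ∀ e, along e ν p = along e x p - (2 * ⟪along e x p, w⟫_ℝ) • w :=
    fun p hp e => by
      rw [← hke p hp]
      have hkw : DifferentiableAt ℝ (fun p => (2 * k p) • w) p :=
        ((h.diff hp sk).const_mul 2).smul_const w
      simp only [along, ν]
      rw [fderiv_fun_sub (h.diff hp sx) hkw, fderiv_sub_const,
        fderiv_smul_const ((h.diff hp sk).const_mul 2), fderiv_const_mul (h.diff hp sk)]
      simp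
  set g : ℝ × ℝ → ℝ := fun p => ⟪ν p, N p⟫_ℝ with hg
  have sg : ContDiffOn ℝ ∞ g U := hν.inner ℝ h.smooth_N
  have hνν : ∀ p ∈ U, g p ^ 2 = 2 * k p ^ 2 := fun p hp => by
    have e1 : ⟪ν p, ν p⟫_ℝ = g p ^ 2 := by
      conv_lhs => rw [h.expand hp (ν p), hn p hp, hn p hp]
      simp only [zero_smul, zero_add]
      rw [real_inner_smul_left, real_inner_smul_right, h.unit_N p hp]
      ring
    rw [← e1]
    simp only [ν, inner_sub_left (x p - c), inner_sub_right _ (x p - c), real_inner_smul_left,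
      real_inner_smul_right, hww, ← h2 p hp, real_inner_comm (x p - c) w]
    ring
  have hg0 : ∀ p ∈ U, g p ≠ 0 := fun p hp h0 => by
    have := hνν p hp
    have := h1 p hp
    rw [h0] at *
    nlinarith
  have hE₂ : ∀ p ∈ U, along e₂ ν p = (√2 * k p)⁻¹ • ν p := fun p hp => by
    have hk0 : k p ≠ 0 := (h1 p hp).ne'
    have hE : along e₂ x p = (√2 * k p)⁻¹ • (x p - c) := by
      rw [hy p hp, smul_smul, inv_mul_cancel₀ (mul_ne_zero h20 hk0), one_smul]
    rw [hνe p hp, hE, real_inner_smul_left]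
    change _ - (2 * (_ * k p)) • w = _ • (x p - c - (2 * k p) • w)
    rw [smul_sub _ (x p - c), smul_smul]
    congr 2
    ring
  have hE₁ : ∀ p ∈ U, along e₁ ν p = along e₁ x p := fun p hp => by
    have := hn p hp e₁
    simp only [ν] at this
    rw [inner_sub_left, real_inner_smul_left, hy p hp, real_inner_smul_left, h.orth' hp,
      real_inner_comm] at this
    have hk0 : k p ≠ 0 := (h1 p hp).ne'
    have : ⟪along e₁ x p, w⟫_ℝ = 0 := by
      rw [real_inner_comm]
      simpa [hk0] using this
    rw [hνe p hp, this]
    simp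
  have key := fun p hp => h.inner_along_of_eq_smul_normal (p := p) hν hn hp
  have hga : ∀ p ∈ U, g p * sff x N e₁ e₁ p = -1 := fun p hp => by
    have := (key p hp e₁ e₁).1
    rw [hE₁ p hp, h.unit₁ p hp] at this
    linarith
  have hg1 : ∀ p ∈ U, along e₁ g p = 0 := fun p hp => by
    rw [← (key p hp e₁ e₁).2, hE₁ p hp, h.normal_left hp]
  have hg2 : ∀ p ∈ U, along e₂ g p = (√2 * k p)⁻¹ * g p := fun p hp => by
    rw [← (key p hp e₂ e₂).2, hE₂ p hp, real_inner_smul_left]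
  have hN₂ : ∀ p ∈ U, ∀ e, sff x N e₂ e p = 0 := fun p hp e => by
    have := (key p hp e₂ e).1
    rw [hE₂ p hp, real_inner_smul_left, hn p hp, mul_zero, zero_eq_neg] at this
    exact (mul_eq_zero.mp this).resolve_left (hg0 p hp)
  refine ⟨fun p hp => by rw [h.sff_comm hp, hN₂ p hp], fun p hp => ?_⟩
  have hk0 : k p ≠ 0 := (h1 p hp).ne'
  have hd : ∀ e, g p * along e (sff x N e₁ e₁) p + along e g p * sff x N e₁ e₁ p = 0 := fun e => by
    rw [← along_mul (h.diff hp sg) (h.diff hp h.smooth_sff₁₁),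
      along_eq_zero_of_const h.isOpen hga hp]
  have hga := hga p hp
  have ha : sff x N e₁ e₁ p ≠ 0 := fun h0 => by
    rw [h0] at hga
    norm_num at hga
  refine ⟨ha, hN₂ p hp e₂, ?_, ?_⟩
  · have := hd e₁
    rw [hg1 p hp] at this
    simpa [hg0 p hp] using this
  · have := hd e₂
    rw [hg2 p hp] at this
    have h3 : along e₂ (sff x N e₁ e₁) p = -(√2 * k p)⁻¹ * sff x N e₁ e₁ p := by
      apply mul_left_cancel₀ (hg0 p hp)
      linarith
    have h4 : (√2 * k p)⁻¹ ^ 2 = sff x N e₁ e₁ p ^ 2 := by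
      have h5 : (√2 * k p) ^ 2 * sff x N e₁ e₁ p ^ 2 = 1 := by
        rw [mul_pow, h22, ← hνν p hp, ← mul_pow, hga]
        norm_num
      rw [inv_pow]
      exact inv_eq_of_mul_eq_one_right h5
    rw [h3, mul_pow, neg_sq, h4]
    ring

theorem exists_flat_of_cone (h : MovingFrame U x N e₁ e₂) (hw : ‖w‖ = 1)
    (h1 : ∀ p ∈ U, 0 < ⟪x p - c, w⟫_ℝ)
    (h2 : ∀ p ∈ U, 2 * ⟪x p - c, w⟫_ℝ ^ 2 = ⟪x p - c, x p - c⟫_ℝ) :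
    ∃ f₁ f₂, MovingFrame U x N f₁ f₂ ∧ (∀ p ∈ U, sff x N f₁ f₂ p = 0) ∧ FlatOn U x N f₁ f₂ := by
  have h22 := Real.sq_sqrt (zero_le_two (α := ℝ))
  have h20 : √2 ≠ 0 := by positivity
  have hww : ⟪w, w⟫_ℝ = 1 := by rw [real_inner_self_eq_norm_sq, hw, one_pow]
  have sx : ContDiffOn ℝ ∞ (fun p => x p - c) U := h.smooth_x.sub contDiffOn_const
  have ss : ContDiffOn ℝ ∞ (fun p => √2 * ⟪x p - c, w⟫_ℝ) U :=
    contDiffOn_const.mul (sx.inner ℝ contDiffOn_const)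
  have hs : ∀ p ∈ U, √2 * ⟪x p - c, w⟫_ℝ ≠ 0 := fun p hp => mul_ne_zero h20 (h1 p hp).ne'
  have htan : ∀ p ∈ U, ⟪x p - c, N p⟫_ℝ = 0 := fun p hp => by
    have hk := h1 p hp
    have hν := h.expand hp (x p - c - (2 * ⟪x p - c, w⟫_ℝ) • w)
    rw [h.cone_normal h2 hp, h.cone_normal h2 hp, zero_smul, zero_smul, zero_add, zero_add] at hν
    set g := ⟪x p - c - (2 * ⟪x p - c, w⟫_ℝ) • w, N p⟫_ℝ
    have e1 : g * ⟪x p - c, N p⟫_ℝ = 0 := by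
      rw [← real_inner_smul_right, ← hν, inner_sub_right, real_inner_smul_right, ← h2 p hp]
      ring
    refine (mul_eq_zero.mp e1).resolve_left fun hg => ?_
    rw [hg, zero_smul, sub_eq_zero] at hν
    have e2 := congrArg (fun z => ⟪z, w⟫_ℝ) hν
    simp only [real_inner_smul_left, hww] at e2
    linarith
  have hsq : ∀ p ∈ U, ⟪x p - c, along e₁ x p⟫_ℝ ^ 2 + ⟪x p - c, along e₂ x p⟫_ℝ ^ 2 =
      (√2 * ⟪x p - c, w⟫_ℝ) ^ 2 := fun p hp => by
    rw [mul_pow, h22, h2 p hp]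
    conv_rhs => rw [h.expand hp (x p - c), htan p hp]
    simp only [inner_add_left, inner_add_right, real_inner_smul_left, real_inner_smul_right,
      h.unit₁ p hp, h.unit₂ p hp, h.orth p hp, h.orth' hp, zero_smul, inner_zero_left,
      inner_zero_right]
    ring
  have hrot := h.rotate (C := fun p => ⟪x p - c, along e₁ x p⟫_ℝ / (√2 * ⟪x p - c, w⟫_ℝ))
    (S := fun p => ⟪x p - c, along e₂ x p⟫_ℝ / (√2 * ⟪x p - c, w⟫_ℝ))
    ((sx.inner ℝ h.smooth_E₁).div ss hs) ((sx.inner ℝ h.smooth_E₂).div ss hs)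
    fun p hp => by rw [div_pow, div_pow, ← add_div, hsq p hp, div_self (pow_ne_zero 2 (hs p hp))]
  refine ⟨_, _, hrot.swap, hrot.swap.flat_of_cone hw h1 h2 fun p hp => ?_⟩
  simp only [along, map_add, map_smul]
  rw [smul_add, smul_smul, smul_smul, mul_div_cancel₀ _ (hs p hp), mul_div_cancel₀ _ (hs p hp)]
  conv_lhs => rw [h.expand hp (x p - c), htan p hp]
  simp [along]

end MovingFrame

namespace MovingFrame

variable {U W : Set (ℝ × ℝ)} {x N : ℝ × ℝ → E3} {e₁ e₂ : ℝ × ℝ → ℝ × ℝ}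

theorem fderiv_field_eq_zero_of_minimal (h : MovingFrame U x N e₁ e₂)
    (hmin : ∀ p ∈ U, SurfMinimalAt x N p) {H : W3 → V6} {V : W3 → W3}
    (hH : ∀ q : W3, q.1 ∈ U → IsMeanCurvAt (nbi x N) q (H q))
    (hV : ∀ q : W3, q.1 ∈ U → fderiv ℝ (nbi x N) q (V q) = Jc (H q)) {q : W3} (hq : q.1 ∈ U) :
    fderiv ℝ (fun y => fderiv ℝ (nbi x N) y (V y)) q = 0 := by
  have hO : IsOpen {y : W3 | y.1 ∈ U} := h.isOpen.preimage continuous_fst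
  have : (fun y => fderiv ℝ (nbi x N) y (V y)) =ᶠ[nhds q] fun _ => 0 :=
    Filter.eventuallyEq_of_mem (hO.mem_nhds hq) fun y hy => (hV y hy).trans
      (h.Jc_meanCurv_eq_zero_of_minimal hy (fun p hp => (hmin p hp).tr_eq_zero h hp) (hH y hy)
        (hV y hy))
  rw [this.fderiv_eq]
  simp

end MovingFrame

/-- (Sakaki's theorem.) The normal bundle immersion of a surface in ℝ³ is
Hamiltonian stationary if and only if the surface is minimal, or is contained in a round
sphere, or is contained in a circular cone with vertex angle π/2. -/
theorem hamiltonian_stationary_iff (U : Set (ℝ × ℝ)) (x N : ℝ × ℝ → E3)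
    (hS : SurfaceData U x N)
    (H : W3 → V6) (hH : ∀ q : W3, q.1 ∈ U → IsMeanCurvAt (nbi x N) q (H q))
    (V : W3 → W3) (hV : ∀ q : W3, q.1 ∈ U → fderiv ℝ (nbi x N) q (V q) = Jc (H q)) :
    (∀ q : W3, q.1 ∈ U → ∀ v₁ v₂ v₃ : W3, ONFrame (nbi x N) q v₁ v₂ v₃ →
        ip6 (fderiv ℝ (fun y => fderiv ℝ (nbi x N) y (V y)) q v₁)
            (fderiv ℝ (nbi x N) q v₁) +
        ip6 (fderiv ℝ (fun y => fderiv ℝ (nbi x N) y (V y)) q v₂)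
            (fderiv ℝ (nbi x N) q v₂) +
        ip6 (fderiv ℝ (fun y => fderiv ℝ (nbi x N) y (V y)) q v₃)
            (fderiv ℝ (nbi x N) q v₃) = 0) ↔
      ((∀ p ∈ U, SurfMinimalAt x N p) ∨ InRoundSphere U x ∨
        ∃ Φ : E3 → E3, RigidMotion Φ ∧ ∀ p ∈ U, x p ∈ Φ '' coneSet 1) := by
  obtain ⟨e₁, e₂, h⟩ := MovingFrame.exists_of_surfaceData hS
  constructor
  · intro hst
    have key : ∀ {W : Set (ℝ × ℝ)} {e₁ e₂ : ℝ × ℝ → ℝ × ℝ}, W ⊆ U → MovingFrame W x N e₁ e₂ →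
        (∀ p ∈ W, sff x N e₁ e₂ p = 0) → StationaryOn W x N e₁ e₂ := fun hWU hf hm p hp t => by
      have hv := hf.onFrame hp (by rw [hm p hp, zero_mul]) t
      rw [← hf.divergence_eq hm (fun q hq => hH q (hWU hq)) (fun q hq => hV q (hWU hq)) hp hv]
      exact hst _ (hWU hp) _ _ _ hv
    rcases h.trichotomy_of_stationary hS.conn_U.isPreconnected key with ht | ⟨ht, hd | hd⟩
    · exact Or.inl fun p hp => SurfMinimalAt.of_tr_eq_zero h hp (ht p hp)
    · exact Or.inr (Or.inl (h.inRoundSphere_of_umbilic hS.conn_U ht hd))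
    · exact Or.inr (Or.inr (h.inCone_of_stationary hS.conn_U key ht hd))
  · rintro (hmin | ⟨c, ρ, -, hc⟩ | ⟨Φ, ⟨S, c, -, hΦ⟩, hx⟩)
    · intro q hq v₁ v₂ v₃ _
      rw [h.fderiv_field_eq_zero_of_minimal hmin hH hV hq]
      simp [ip6]
    · obtain ⟨hm, hD⟩ := h.stationaryOn_of_sphere hc
      rintro ⟨p, t⟩ hp v₁ v₂ v₃ hv
      exact (h.divergence_eq hm hH hV hp hv).trans (hD p hp t)
    · obtain rfl : Φ = fun y => S y + c := funext hΦ
      have hx' := fun p hp => (mem_image_coneSet_one S c (x p)).mp (hx p hp)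
      obtain ⟨f₁, f₂, hf, hm, hflat⟩ := h.exists_flat_of_cone (by simp) (fun p hp => (hx' p hp).1)
        fun p hp => (hx' p hp).2
      rintro ⟨p, t⟩ hp v₁ v₂ v₃ hv
      exact (hf.divergence_eq hm hH hV hp hv).trans (hf.stationaryOn_of_flat hm hflat p hp t)
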